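/- arXiv:math/0407322 — 3 statements merged into one kernel-verified Lean document; each statement's English description precedes it below -/
import Mathlib

section
/- Assume condition (exp). Then c_n / c_{n+1} → y^{−1} as n → ∞, and there exists N > 0 such that c_n / c_{n+1} < y^{−1} for all n > N. -/
open Finset Filter

/-- The number of multisets of total size `n` determined by the parameters `a j`
(the number of one-component multisets of size `j`), i.e.
`c_n = Σ_{η ∈ Ω_n} Π_{j=1}^n C(a_j + η_j - 1, η_j)` where
`Ω_n = {η : Σ_{j=1}^n j·η_j = n}` (indices shifted: `j ∈ Fin n` stands for `j+1`). -/
def multisetCount (a : ℕ → ℕ) (n : ℕ) : ℕ :=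
  ∑ η : Fin n → Fin (n + 1),
    if ∑ j : Fin n, (j.1 + 1) * (η j).1 = n then
      ∏ j : Fin n, Nat.choose (a (j.1 + 1) + (η j).1 - 1) (η j).1
    else 0

/-- Condition (exp): `a_j ≍ j^{r-1} y^j`, i.e. there are constants `D₁, D₂ > 0` with
`D₁ j^{r-1} y^j ≤ a_j ≤ D₂ j^{r-1} y^j` for all `j ≥ 1`. -/
def ExpansiveCond (a : ℕ → ℕ) (r y : ℝ) : Prop :=
  ∃ D₁ D₂ : ℝ, 0 < D₁ ∧ 0 < D₂ ∧ ∀ j : ℕ, 1 ≤ j →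
    D₁ * (j : ℝ) ^ (r - 1) * y ^ j ≤ (a j : ℝ) ∧ (a j : ℝ) ≤ D₂ * (j : ℝ) ^ (r - 1) * y ^ j

open PowerSeries in
/-- `F` has constant coefficient one and logarithmic derivative `G`. -/
def LogRel (G F : PowerSeries ℝ) : Prop :=
  coeff 0 F = 1 ∧ ∀ n : ℕ, (n : ℝ) * coeff n F = coeff n (G * F)

open PowerSeries in
lemma rel_iff (G F : PowerSeries ℝ) :
    LogRel G F ↔ coeff 0 F = 1 ∧ X * derivative ℝ F = G * F := by
  unfold LogRel
  have : ∀ n : ℕ, coeff n (X * derivative ℝ F) = (n : ℝ) * coeff n F := by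
    intro n
    cases n with
    | zero => simp
    | succ n => rw [coeff_succ_X_mul, coeff_derivative]; push_cast; ring
  constructor
  · rintro ⟨h, h'⟩
    refine ⟨h, ?_⟩
    ext n
    rw [this, h']
  · rintro ⟨h, h'⟩
    refine ⟨h, fun n => ?_⟩
    rw [← this, h']

open PowerSeries in
lemma LogRel.mul {G F G' F' : PowerSeries ℝ} (h : LogRel G F) (h' : LogRel G' F') :
    LogRel (G + G') (F * F') := by
  rw [rel_iff] at *
  obtain ⟨h0, h1⟩ := h
  obtain ⟨h0', h1'⟩ := h'
  refine ⟨by simp [coeff_mul, h0, h0'], ?_⟩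
  rw [Derivation.leibniz]
  simp only [smul_eq_mul]
  linear_combination F' * h1 + F * h1'

open PowerSeries in
lemma rel_one : LogRel 0 1 := by
  rw [rel_iff]; simp

lemma LogRel.pow {G F : PowerSeries ℝ} (h : LogRel G F) (k : ℕ) : LogRel ((k : PowerSeries ℝ) * G) (F ^ k) := by
  induction k with
  | zero => simpa using rel_one
  | succ k ih =>
    have := ih.mul h
    rw [pow_succ]
    convert this using 1
    push_cast; ring

lemma LogRel.prod {ι : Type*} (s : Finset ι) (G F : ι → PowerSeries ℝ) (h : ∀ i ∈ s, LogRel (G i) (F i)) :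
    LogRel (∑ i ∈ s, G i) (∏ i ∈ s, F i) := by
  classical
  induction s using Finset.induction_on with
  | empty => simpa using rel_one
  | insert i s hi ih =>
    rw [Finset.sum_insert hi, Finset.prod_insert hi]
    exact (h i (by simp)).mul (ih fun j hj => h j (by simp [hj]))

open PowerSeries in
lemma LogRel.coeff_zero {G F : PowerSeries ℝ} (h : LogRel G F) : coeff 0 G = 0 := by
  have := h.2 0
  have h0 := h.1
  rw [coeff_mul, Finset.Nat.antidiagonal_zero, Finset.sum_singleton, h0] at this
  simpa using this.symm

open PowerSeries in
lemma LogRel.unique {G F F' : PowerSeries ℝ} (h : LogRel G F) (h' : LogRel G F') : F = F' := by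
  ext n
  induction n using Nat.strong_induction_on with
  | _ n ih =>
    rcases Nat.eq_zero_or_pos n with rfl | hn
    · rw [h.1, h'.1]
    · have e1 := h.2 n
      have e2 := h'.2 n
      have : coeff n (G * F) = coeff n (G * F') := by
        rw [coeff_mul, coeff_mul]
        refine Finset.sum_congr rfl fun p hp => ?_
        rcases Nat.eq_zero_or_pos p.1 with h0 | h0
        · rw [h0, h.coeff_zero]; simp
        · rw [ih p.2 (by have := Finset.HasAntidiagonal.mem_antidiagonal.1 hp; omega)]
      have hn' : (n : ℝ) ≠ 0 := by positivity
      apply mul_left_cancel₀ hn'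
      rw [e1, e2, this]

open PowerSeries in
/-- geometric series : `x/(1-x)` is the log derivative of `1/(1-x)` -/
lemma rel_geom : LogRel (mk fun n => if n = 0 then 0 else 1) (mk 1) := by
  refine ⟨by simp, fun n => ?_⟩
  rw [coeff_mul, Finset.Nat.sum_antidiagonal_eq_sum_range_succ_mk, Finset.sum_range_succ']
  simp

/-! ### the combinatorial part -/

open PowerSeries in
/-- `(1 - x^(j+1))^{-a_(j+1)}` -/
noncomputable def fac (a : ℕ → ℕ) (j : ℕ) : PowerSeries ℝ :=
  mk fun i => if (j + 1) ∣ i then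
    ((Nat.choose (a (j + 1) + i / (j + 1) - 1) (i / (j + 1)) : ℕ) : ℝ) else 0

open PowerSeries in
lemma coeff_fac_prod (a : ℕ → ℕ) (n : ℕ) :
    coeff n (∏ j : Fin n, fac a j.1) = (multisetCount a n : ℝ) := by
  rw [coeff_prod, multisetCount]
  push_cast
  symm
  rw [← Finset.sum_filter]
  refine Finset.sum_bij_ne_zero
    (fun η _ _ => Finsupp.equivFunOnFinite.symm (fun j : Fin n => (j.1 + 1) * (η j).1)) ?_ ?_ ?_ ?_
  · intro η hη _
    simp only [Finset.mem_filter, Finset.mem_univ, true_and] at hη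
    simp [Finset.mem_finsuppAntidiag, hη]
  · intro η hη _ η' hη' _ h
    funext j
    have := DFunLike.congr_fun h j
    simp at this
    exact Fin.ext this
  · intro l hl hne
    have hdvd : ∀ j : Fin n, (j.1 + 1) ∣ l j := by
      intro j
      by_contra hj
      apply hne
      apply Finset.prod_eq_zero (Finset.mem_univ j)
      simp [fac, hj]
    rw [Finset.mem_finsuppAntidiag] at hl
    have hle : ∀ j : Fin n, l j ≤ n := by
      intro j
      have := Finset.single_le_sum (f := fun j => l j) (fun _ _ => Nat.zero_le _) (Finset.mem_univ j)
      exact this.trans hl.1.le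
    have key : ∀ j : Fin n, (j.1 + 1) * (l j / (j.1 + 1)) = l j := fun j => Nat.mul_div_cancel' (hdvd j)
    refine ⟨fun j => ⟨l j / (j.1 + 1), Nat.lt_succ_of_le ((Nat.div_le_self _ _).trans (hle j))⟩, ?_, ?_, ?_⟩
    · simp [key, hl.1]
    · convert hne using 2 with j
      simp [fac, hdvd j]
    · ext j
      simp [key]
  · intro η hη _
    refine Finset.prod_congr rfl fun j _ => ?_
    simp [fac]

open PowerSeries in
lemma coeff_fac_prod' (a : ℕ → ℕ) (n N : ℕ) (h : n ≤ N) :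
    coeff n (∏ j ∈ Finset.range N, fac a j) = (multisetCount a n : ℝ) := by
  induction N, h using Nat.le_induction with
  | base => rw [← coeff_fac_prod, Finset.prod_range]
  | succ N hN ih =>
    rw [Finset.prod_range_succ, coeff_mul, ← ih]
    rw [Finset.sum_eq_single (n, 0)]
    · simp [fac]
    · rintro ⟨p, q⟩ hpq hne
      have := Finset.HasAntidiagonal.mem_antidiagonal.1 hpq
      simp only at this
      have hq : q ≠ 0 := by
        rintro rfl
        apply hne
        simp at this
        simp [this]
      have : ¬ (N + 1 ∣ q) := fun hd => by
        have := Nat.le_of_dvd (Nat.pos_of_ne_zero hq) hd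
        omega
      simp [fac, this]
    · simp

open PowerSeries in
lemma rel_fac (a : ℕ → ℕ) (j : ℕ) (ha : 1 ≤ a (j + 1)) :
    LogRel (mk fun i => if i ≠ 0 ∧ (j + 1) ∣ i then ((j + 1 : ℕ) : ℝ) * a (j + 1) else 0) (fac a j) := by
  set G : PowerSeries ℝ :=
    mk fun i => if i ≠ 0 ∧ (j + 1) ∣ i then ((j + 1 : ℕ) : ℝ) * a (j + 1) else 0 with hG
  rw [rel_iff]
  refine ⟨by simp [fac], ?_⟩
  have h1 : (1 - X ^ (j + 1)) * G = C (((j + 1 : ℕ) : ℝ) * a (j + 1)) * X ^ (j + 1) := by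
    ext i
    rw [sub_mul, one_mul, map_sub, coeff_X_pow_mul', coeff_C_mul, coeff_X_pow]
    simp only [hG, coeff_mk]
    rcases lt_trichotomy i (j + 1) with h | h | h
    · have : ¬ (i ≠ 0 ∧ j + 1 ∣ i) := by
        rintro ⟨h0, hd⟩
        have := Nat.le_of_dvd (Nat.pos_of_ne_zero h0) hd
        omega
      rw [if_neg this, if_neg (by omega), if_neg (by omega)]; simp
    · subst h
      simp
    · have e : (j + 1 ∣ i - (j + 1)) ↔ (j + 1 ∣ i) := by
        rw [Nat.dvd_sub_self_right]
        constructor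
        · rintro (h' | h')
          · exact h'
          · omega
        · exact Or.inl
      rw [if_pos (by omega : j + 1 ≤ i), if_neg (by omega : ¬ i = j + 1)]
      have a1 : i ≠ 0 := by omega
      have a2 : i - (j + 1) ≠ 0 := by omega
      simp only [e, a1, a2, ne_eq, not_false_eq_true, true_and]
      simp
  have h2 : (1 - X ^ (j + 1)) * (X * derivative ℝ (fac a j)) =
      C (((j + 1 : ℕ) : ℝ) * a (j + 1)) * X ^ (j + 1) * fac a j := by
    have hc : ∀ n : ℕ, coeff n (X * derivative ℝ (fac a j)) = (n : ℝ) * coeff n (fac a j) := by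
      intro n
      cases n with
      | zero => simp
      | succ n => rw [coeff_succ_X_mul, coeff_derivative]; push_cast; ring
    ext i
    rw [sub_mul, one_mul, map_sub, coeff_X_pow_mul', mul_assoc, coeff_C_mul, coeff_X_pow_mul', hc, hc]
    by_cases hi : j + 1 ≤ i
    · rw [if_pos hi, if_pos hi]
      obtain ⟨q, rfl⟩ := Nat.exists_eq_add_of_le hi
      rw [Nat.add_sub_cancel_left]
      by_cases hd : j + 1 ∣ q
      · obtain ⟨k, rfl⟩ := hd
        have e1 : (j + 1) + (j + 1) * k = (j + 1) * (k + 1) := by ring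
        rw [e1]
        have hp : 0 < j + 1 := by omega
        simp only [fac, coeff_mk, dvd_mul_right, if_true, Nat.mul_div_cancel_left _ hp]
        obtain ⟨A, hA⟩ : ∃ A, a (j + 1) = A + 1 := ⟨a (j + 1) - 1, by omega⟩
        rw [hA]
        have e2 : A + 1 + (k + 1) - 1 = (A + k) + 1 := by omega
        have e3 : A + 1 + k - 1 = A + k := by omega
        rw [e2, e3]
        have := Nat.add_one_mul_choose_eq (A + k) k
        have this' : ((A + k : ℝ) + 1) * ((A + k).choose k : ℝ) = ((A + k + 1).choose (k + 1) : ℝ) * (k + 1) := by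
          exact_mod_cast this
        push_cast
        linear_combination (-(j + 1 : ℝ)) * this'
      · have hd' : ¬ (j + 1 ∣ (j + 1) + q) := by
          rwa [Nat.dvd_add_right (dvd_refl _)]
        simp [fac, hd, hd']
    · rw [if_neg hi, if_neg hi]
      rcases Nat.eq_zero_or_pos i with rfl | h0
      · simp
      · have : ¬ (j + 1 ∣ i) := fun hd => hi (Nat.le_of_dvd h0 hd)
        simp [fac, this]
  have hne : (1 - X ^ (j + 1) : PowerSeries ℝ) ≠ 0 := by
    intro h
    have := congrArg (coeff 0) h
    simp at this
  apply mul_left_cancel₀ hne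
  rw [h2, ← h1]; ring

/-- the recursion `n c_n = Σ_m g_m c_{n-m}` -/
lemma count_rec (a : ℕ → ℕ) (ha : ∀ j, 1 ≤ j → 1 ≤ a j) (n : ℕ) :
    (n : ℝ) * multisetCount a n = ∑ p ∈ Finset.HasAntidiagonal.antidiagonal n,
      (∑ d ∈ p.1.divisors, (d : ℝ) * a d) * multisetCount a p.2 := by
  have h := LogRel.prod (Finset.range n) _ (fun j => fac a j)
    (fun j _ => rel_fac a j (ha (j + 1) (by omega)))
  have := h.2 n
  rw [coeff_fac_prod' a n n le_rfl, PowerSeries.coeff_mul] at this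
  rw [this]
  refine Finset.sum_congr rfl fun p hp => ?_
  have hp' := Finset.HasAntidiagonal.mem_antidiagonal.1 hp
  rw [coeff_fac_prod' a p.2 n (by omega)]
  congr 1
  rw [map_sum]
  simp only [PowerSeries.coeff_mk]
  rcases Nat.eq_zero_or_pos p.1 with h0 | h0
  · simp [h0]
  · rw [Nat.divisors]
    rw [Finset.sum_filter, Finset.sum_Ico_eq_sum_range]
    have : Finset.range p.1 ⊆ Finset.range n := Finset.range_subset_range.2 (by omega)
    rw [Nat.add_sub_cancel]
    rw [← Finset.sum_subset this]
    · refine Finset.sum_congr rfl fun j _ => ?_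
      rw [Nat.add_comm 1 j]
      have : p.1 ≠ 0 := by omega
      simp [this]
    · intro j _ hj
      rw [if_neg]
      rintro ⟨_, hd⟩
      have := Nat.le_of_dvd h0 hd
      simp at hj
      omega
/-! ### the analytic part -/

/-- coefficients of the exponential -/
noncomputable def expCoeff (g : ℕ → ℝ) (n : ℕ) : ℝ :=
  if n = 0 then 1 else (∑ k : Fin n, g (n - k.1) * expCoeff g k.1) / n
termination_by n
decreasing_by exact k.2

open PowerSeries in
/-- coefficients of the exponential defined through the recursion -/
lemma exists_logRel (g : ℕ → ℝ) (hg0 : g 0 = 0) (hg : ∀ n, 0 ≤ g n) :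
    ∃ F : PowerSeries ℝ, LogRel (mk g) F ∧ ∀ n, 0 ≤ coeff n F := by
  have hex : ∃ f : ℕ → ℝ, ∀ n, f n = if n = 0 then 1 else
      (∑ k ∈ Finset.range n, g (n - k) * f k) / n := by
    refine ⟨expCoeff g, fun n => ?_⟩
    rw [expCoeff, Finset.sum_range]
  obtain ⟨f, hf⟩ := hex
  have hnn : ∀ n, 0 ≤ f n := by
    intro n
    induction n using Nat.strong_induction_on with
    | _ n ih =>
      rw [hf]
      split_ifs
      · norm_num
      · refine div_nonneg (Finset.sum_nonneg fun k hk => mul_nonneg (hg _) (ih k (Finset.mem_range.1 hk))) (Nat.cast_nonneg _)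
  refine ⟨mk f, ⟨by rw [coeff_mk, hf]; simp, fun n => ?_⟩, fun n => by rw [coeff_mk]; exact hnn n⟩
  rw [mul_comm (mk g), coeff_mul, Finset.Nat.sum_antidiagonal_eq_sum_range_succ_mk, Finset.sum_range_succ]
  simp only [coeff_mk, Nat.sub_self, hg0, mul_zero, add_zero]
  rcases Nat.eq_zero_or_pos n with rfl | hn
  · simp
  · have hn' : (n : ℝ) ≠ 0 := by positivity
    rw [hf n, if_neg hn.ne', mul_div_cancel₀ _ hn']
    exact Finset.sum_congr rfl fun k _ => mul_comm _ _

open PowerSeries in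
/-- exponential of a monomial -/
lemma exists_single (m : ℕ) (hm : 1 ≤ m) (t : ℝ) :
    ∃ F : PowerSeries ℝ, LogRel (mk fun n => if n = m then t else 0) F ∧
      (Summable fun n => ‖coeff n F‖) ∧ 0 < ∑' n, coeff n F := by
  set f : ℕ → ℝ := fun n => if m ∣ n then (t / m) ^ (n / m) / (n / m).factorial else 0 with hf
  have hm' : (m : ℝ) ≠ 0 := by positivity
  have hinj : Function.Injective (fun k : ℕ => m * k) := fun a b h => Nat.eq_of_mul_eq_mul_left hm h
  have hcomp : ∀ k, f (m * k) = (t / m) ^ k / k.factorial := by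
    intro k
    simp only [hf, dvd_mul_right, if_true, Nat.mul_div_cancel_left _ hm]
  have hout : ∀ x ∉ Set.range (fun k : ℕ => m * k), f x = 0 := by
    intro x hx
    simp only [hf]
    rw [if_neg]
    rintro ⟨k, rfl⟩
    exact hx ⟨k, rfl⟩
  have hs : HasSum f (Real.exp (t / m)) := by
    rw [← hinj.hasSum_iff hout]
    have := NormedSpace.expSeries_div_hasSum_exp (t / m : ℝ)
    rw [← Real.exp_eq_exp_ℝ] at this
    have e : (f ∘ fun k : ℕ => m * k) = fun k : ℕ => (t / m) ^ k / (k.factorial : ℝ) :=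
      funext hcomp
    rw [e]
    exact this
  refine ⟨mk f, ?_, ?_, ?_⟩
  · refine ⟨by simp [hf], fun n => ?_⟩
    have hG : (mk fun n => if n = m then t else 0 : PowerSeries ℝ) = C t * X ^ m := by
      ext i
      rw [coeff_C_mul, coeff_X_pow, coeff_mk]; split_ifs <;> simp
    rw [hG, mul_assoc, coeff_C_mul, coeff_X_pow_mul']
    simp only [coeff_mk]
    by_cases hn : m ≤ n
    · rw [if_pos hn]
      obtain ⟨q, rfl⟩ := Nat.exists_eq_add_of_le hn
      rw [Nat.add_sub_cancel_left]
      by_cases hd : m ∣ q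
      · obtain ⟨k, rfl⟩ := hd
        have e1 : m + m * k = m * (k + 1) := by ring
        rw [e1, hcomp, hcomp, Nat.factorial_succ]
        have := Nat.factorial_ne_zero k
        push_cast
        rw [pow_succ]
        field_simp
      · have hd' : ¬ (m ∣ m + q) := by
          rwa [Nat.dvd_add_right (dvd_refl _)]
        simp [hf, hd, hd']
    · rw [if_neg hn]
      rcases Nat.eq_zero_or_pos n with rfl | h0
      · simp
      · have : ¬ (m ∣ n) := fun hd => hn (Nat.le_of_dvd h0 hd)
        simp [hf, this]
  · simp only [coeff_mk]
    exact hs.summable.norm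
  · simp only [coeff_mk]
    rw [hs.tsum_eq]
    exact Real.exp_pos _

open PowerSeries in
lemma exists_poly (t : ℕ → ℝ) (M : ℕ) :
    ∃ F : PowerSeries ℝ, LogRel (mk fun n => if 1 ≤ n ∧ n ≤ M then t n else 0) F ∧
      (Summable fun n => ‖coeff n F‖) ∧ 0 < ∑' n, coeff n F := by
  induction M with
  | zero =>
    refine ⟨1, ?_, ?_, ?_⟩
    · convert rel_one using 1
      ext n
      rw [coeff_mk, if_neg (by omega)]; simp
    · apply summable_of_ne_finset_zero (s := {0})
      intro n hn
      simp at hn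
      simp [coeff_one, hn]
    · rw [tsum_eq_single 0]
      · simp
      · intro n hn
        simp [coeff_one, hn]
  | succ M ih =>
    obtain ⟨F, h1, h2, h3⟩ := ih
    obtain ⟨F', h1', h2', h3'⟩ := exists_single (M + 1) (by omega) (t (M + 1))
    refine ⟨F * F', ?_, ?_, ?_⟩
    · convert h1.mul h1' using 1
      ext n
      simp only [map_add, coeff_mk]
      by_cases hn : n = M + 1
      · subst hn; simp
      · rw [if_neg hn, add_zero]
        have : (1 ≤ n ∧ n ≤ M + 1) ↔ (1 ≤ n ∧ n ≤ M) := by omega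
        simp only [this]
    · have := summable_norm_sum_mul_antidiagonal_of_summable_norm
        (f := fun n => coeff n F) (g := fun n => coeff n F') h2 h2'
      refine this.congr fun n => ?_
      rw [coeff_mul]
    · have := tsum_mul_tsum_eq_tsum_sum_antidiagonal_of_summable_norm
        (f := fun n => coeff n F) (g := fun n => coeff n F') h2 h2'
      have e : ∑' n, coeff n (F * F') = (∑' n, coeff n F) * ∑' n, coeff n F' := by
        rw [this]
        refine tsum_congr fun n => ?_
        rw [coeff_mul]
      rw [e]
      exact mul_pos h3 h3'

/-- Schur lemma. -/
lemma schur (f : ℕ → ℝ) (hpos : ∀ n, 0 < f n) (hmono : Monotone f)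
    (hr : Tendsto (fun n => f n / f (n + 1)) atTop (nhds 1))
    (h : ℕ → ℝ) (hs : Summable fun n => ‖h n‖) :
    Tendsto (fun n => (∑ p ∈ Finset.HasAntidiagonal.antidiagonal n, h p.1 * f p.2) / f n) atTop
      (nhds (∑' n, h n)) := by
  have hk : ∀ k : ℕ, Tendsto (fun n => f n / f (n + k)) atTop (nhds 1) := by
    intro k
    induction k with
    | zero => 
      have : ∀ n, f n / f (n + 0) = 1 := fun n => div_self (hpos n).ne'
      simp only [this]; exact tendsto_const_nhds
    | succ k ih =>
      have h2 : Tendsto (fun n => f (n + k) / f (n + k + 1)) atTop (nhds 1) :=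
        hr.comp (tendsto_add_atTop_nat k)
      have := ih.mul h2
      rw [one_mul] at this
      refine this.congr fun n => ?_
      have := (hpos (n + k)).ne'
      have := (hpos (n + k + 1)).ne'
      rw [← add_assoc]
      field_simp
  have key : Tendsto (fun n => ∑' k, (if k ≤ n then h k * (f (n - k) / f n) else 0)) atTop
      (nhds (∑' n, h n)) := by
    apply tendsto_tsum_of_dominated_convergence hs
    · intro k
      have h1 : Tendsto (fun n => h k * (f (n - k) / f n)) atTop (nhds (h k)) := by
        have : Tendsto (fun n => h k * (f (n - k) / f n)) atTop (nhds (h k * 1)) := by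
          apply Tendsto.const_mul
          rw [← tendsto_add_atTop_iff_nat k]
          simpa using hk k
        simpa using this
      refine h1.congr' ?_
      filter_upwards [eventually_ge_atTop k] with n hn
      rw [if_pos hn]
    · refine Eventually.of_forall fun n k => ?_
      split_ifs with hkn
      · rw [norm_mul]
        apply mul_le_of_le_one_right (norm_nonneg _)
        rw [Real.norm_of_nonneg (div_nonneg (hpos _).le (hpos _).le), div_le_one (hpos _)]
        exact hmono (Nat.sub_le _ _)
      · simp
  refine key.congr fun n => ?_
  rw [Finset.Nat.sum_antidiagonal_eq_sum_range_succ_mk, Finset.sum_div]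
  rw [tsum_eq_sum (s := Finset.range (n + 1))]
  · refine Finset.sum_congr rfl fun k hk => ?_
    rw [if_pos (by simpa [Nat.lt_succ_iff] using hk), mul_div_assoc]
  · intro k hk
    rw [if_neg (by simpa [Nat.lt_succ_iff] using hk)]

/-- the main growth lemma -/
lemma growth (e : ℕ → ℝ) (he : ∀ n, 0 ≤ e n) (he0 : e 0 = 1) (p : ℕ) (C : ℝ) (hC : 0 ≤ C)
    (hrec : ∀ n : ℕ, (n : ℝ) * e n ≤ C * ∑ l ∈ Finset.range (n + 1), (l : ℝ) ^ (p + 1) * e (n - l)) :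
    let f : ℕ → ℝ := fun n => ∑ l ∈ Finset.range (n + 1), ((l + (p + 1)).choose (p + 1) : ℝ) * e (n - l)
    (∀ n, 0 < f n) ∧ Monotone f ∧ Tendsto (fun n => f n / f (n + 1)) atTop (nhds 1) := by
  intro f
  set w : ℕ → ℝ := fun l => ((l + (p + 1)).choose (p + 1) : ℝ) with hw
  set w' : ℕ → ℝ := fun l => ((l + p).choose p : ℝ) with hw'
  have hfdef : ∀ n, f n = ∑ l ∈ Finset.range (n + 1), w l * e (n - l) := fun n => rfl
  have hw1 : ∀ l, 1 ≤ w l := fun l => by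
    have : 1 ≤ (l + (p + 1)).choose (p + 1) := Nat.choose_pos (by omega)
    simp only [hw]
    exact_mod_cast this
  have hw'1 : ∀ l, 1 ≤ w' l := fun l => by
    have : 1 ≤ (l + p).choose p := Nat.choose_pos (by omega)
    simp only [hw']
    exact_mod_cast this
  have hww : ∀ l, w (l + 1) = w l + w' (l + 1) := fun l => by
    simp only [hw, hw']
    have : (l + 1 + (p + 1)).choose (p + 1) = (l + (p + 1)).choose (p + 1) + (l + 1 + p).choose p := by
      rw [show l + 1 + (p + 1) = (l + 1 + p) + 1 by ring, Nat.choose_succ_succ, add_comm,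
        show l + (p + 1) = l + 1 + p by ring]
    exact_mod_cast this
  have hw0 : w 0 = 1 := by simp [hw]
  have hw'0 : w' 0 = 1 := by simp [hw']
  have hrat : ∀ l : ℕ, w' l * (l + p + 1) = (p + 1) * w l := fun l => by
    have := Nat.add_one_mul_choose_eq (l + p) p
    have h' : ((l + p : ℝ) + 1) * ((l + p).choose p : ℝ) = ((l + p + 1).choose (p + 1) : ℝ) * (p + 1) := by
      exact_mod_cast this
    simp only [hw, hw']
    rw [show l + (p + 1) = l + p + 1 by ring]
    linarith
  have hpos : ∀ n, 0 < f n := by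
    intro n
    rw [hfdef]
    have : w n * e (n - n) ≤ ∑ l ∈ Finset.range (n + 1), w l * e (n - l) :=
      Finset.single_le_sum (f := fun l => w l * e (n - l))
        (fun l _ => mul_nonneg (zero_le_one.trans (hw1 l)) (he _)) (by simp)
    rw [Nat.sub_self, he0] at this
    linarith [hw1 n]
  have hdiff : ∀ n, f (n + 1) = f n + ∑ l ∈ Finset.range (n + 2), w' l * e (n + 1 - l) := by
    intro n
    rw [hfdef, hfdef, Finset.sum_range_succ', Finset.sum_range_succ' (fun l => w' l * e (n + 1 - l)),
      ← add_assoc, ← Finset.sum_add_distrib]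
    congr 1
    · refine Finset.sum_congr rfl fun l _ => ?_
      rw [hww, Nat.add_sub_add_right]; ring
    · rw [hw0, hw'0]
  have hmono : Monotone f := by
    apply monotone_nat_of_le_succ
    intro n
    rw [hdiff]
    have : 0 ≤ ∑ l ∈ Finset.range (n + 2), w' l * e (n + 1 - l) :=
      Finset.sum_nonneg fun l _ => mul_nonneg (zero_le_one.trans (hw'1 l)) (he _)
    linarith
  refine ⟨hpos, hmono, ?_⟩
  -- bound of a single coefficient
  set C' : ℝ := C * (p + 1).factorial with hC'
  have hC'0 : 0 ≤ C' := by positivity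
  have hef : ∀ n : ℕ, (n : ℝ) * e n ≤ C' * f n := by
    intro n
    refine (hrec n).trans ?_
    rw [hC', mul_assoc]
    apply mul_le_mul_of_nonneg_left _ hC
    rw [hfdef, Finset.mul_sum]
    refine Finset.sum_le_sum fun l _ => ?_
    rw [← mul_assoc]
    apply mul_le_mul_of_nonneg_right _ (he _)
    have h1 : l ^ (p + 1) ≤ (p + 1).factorial * (l + (p + 1)).choose (p + 1) := by
      rw [← Nat.ascFactorial_eq_factorial_mul_choose]
      exact (Nat.pow_le_pow_left (Nat.le_succ l) _).trans (Nat.pow_succ_le_ascFactorial _ _)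
    simp only [hw]
    exact_mod_cast h1
  -- bound of the difference
  have hbound : ∀ L n : ℕ, L < n → (∑ l ∈ Finset.range (n + 1), w' l * e (n - l)) ≤
      ((∑ l ∈ Finset.range L, w' l * C') / (n - L : ℝ) + (p + 1) / (L + p + 1)) * f n := by
    intro L n hL
    rw [← Finset.sum_range_add_sum_Ico _ (by omega : L ≤ n + 1), add_mul]
    have hnL : (0 : ℝ) < n - L := by
      have : (L : ℝ) < n := by exact_mod_cast hL
      linarith
    apply add_le_add
    · rw [div_mul_eq_mul_div, le_div_iff₀ hnL, Finset.sum_mul, Finset.sum_mul]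
      refine Finset.sum_le_sum fun l hl => ?_
      have hl' : l < L := Finset.mem_range.1 hl
      rw [mul_assoc, mul_assoc]
      apply mul_le_mul_of_nonneg_left _ (zero_le_one.trans (hw'1 l))
      have h1 := hef (n - l)
      have h2 : f (n - l) ≤ f n := hmono (Nat.sub_le _ _)
      have h3 : (n - L : ℝ) ≤ ((n - l : ℕ) : ℝ) := by
        rw [Nat.cast_sub (by omega)]
        have : (l : ℝ) ≤ L := by exact_mod_cast hl'.le
        linarith
      calc e (n - l) * (n - L : ℝ) ≤ e (n - l) * ((n - l : ℕ) : ℝ) :=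
            mul_le_mul_of_nonneg_left h3 (he _)
        _ ≤ C' * f (n - l) := by linarith
        _ ≤ C' * f n := mul_le_mul_of_nonneg_left h2 hC'0
    · have : ∑ l ∈ Finset.Ico L (n + 1), w l * e (n - l) ≤ f n := by
        rw [hfdef, ← Finset.sum_range_add_sum_Ico _ (by omega : L ≤ n + 1)]
        have : 0 ≤ ∑ l ∈ Finset.range L, w l * e (n - l) :=
          Finset.sum_nonneg fun l _ => mul_nonneg (zero_le_one.trans (hw1 l)) (he _)
        linarith
      refine le_trans ?_ (mul_le_mul_of_nonneg_left this (by positivity))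
      rw [Finset.mul_sum]
      refine Finset.sum_le_sum fun l hl => ?_
      rw [← mul_assoc]
      apply mul_le_mul_of_nonneg_right _ (he _)
      have hl' : (L : ℝ) ≤ l := by exact_mod_cast (Finset.mem_Ico.1 hl).1
      rw [div_mul_eq_mul_div, ← hrat l, le_div_iff₀ (by positivity)]
      apply mul_le_mul_of_nonneg_left _ (zero_le_one.trans (hw'1 l))
      linarith
  have hlim : Tendsto (fun n => (∑ l ∈ Finset.range (n + 1), w' l * e (n - l)) / f n) atTop (nhds 0) := by
    rw [Metric.tendsto_atTop]
    intro ε hε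
    have t1 : Tendsto (fun L : ℕ => ((p : ℝ) + 1) / ((L : ℝ) + p + 1)) atTop (nhds 0) := by
      apply Tendsto.div_atTop tendsto_const_nhds
      apply tendsto_atTop_add_const_right
      apply tendsto_atTop_add_const_right
      exact tendsto_natCast_atTop_atTop
    obtain ⟨L, hL⟩ := (t1.eventually (gt_mem_nhds (half_pos hε))).exists
    have t2 : Tendsto (fun n : ℕ => (∑ l ∈ Finset.range L, w' l * C') / ((n : ℝ) - L)) atTop (nhds 0) := by
      apply Tendsto.div_atTop tendsto_const_nhds
      simp only [sub_eq_add_neg]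
      apply tendsto_atTop_add_const_right
      exact tendsto_natCast_atTop_atTop
    obtain ⟨N, hN⟩ := eventually_atTop.1 ((t2.eventually (gt_mem_nhds (half_pos hε))).and (eventually_gt_atTop L))
    refine ⟨N, fun n hn => ?_⟩
    obtain ⟨h1, h2⟩ := hN n hn
    rw [Real.dist_eq, sub_zero, abs_of_nonneg (div_nonneg (Finset.sum_nonneg fun l _ =>
      mul_nonneg (zero_le_one.trans (hw'1 l)) (he _)) (hpos n).le), div_lt_iff₀ (hpos n)]
    refine (hbound L n h2).trans_lt ?_
    apply mul_lt_mul_of_pos_right _ (hpos n)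
    linarith
  have h1 : Tendsto (fun n => 1 - (∑ l ∈ Finset.range (n + 1 + 1), w' l * e (n + 1 - l)) / f (n + 1))
      atTop (nhds (1 - 0)) := tendsto_const_nhds.sub (hlim.comp (tendsto_add_atTop_nat 1))
  rw [sub_zero] at h1
  refine h1.congr fun n => ?_
  have := hdiff n
  have h3 := (hpos (n + 1)).ne'
  rw [eq_div_iff h3, sub_mul, div_mul_cancel₀ _ h3]
  linarith
open PowerSeries in
lemma growth_ps (E H : PowerSeries ℝ) (he : ∀ n, 0 ≤ coeff n E) (he0 : coeff 0 E = 1) (p : ℕ) (C : ℝ)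
    (hC : 0 ≤ C)
    (hrec : ∀ n : ℕ, (n : ℝ) * coeff n E ≤
      C * ∑ l ∈ Finset.range (n + 1), (l : ℝ) ^ (p + 1) * coeff (n - l) E)
    (hs : Summable fun n => ‖coeff n H‖) (hH : 0 < ∑' n, coeff n H) :
    (∀ᶠ n in atTop, 0 < coeff n (H * ((PowerSeries.mk 1 : PowerSeries ℝ) ^ (p + 2) * E))) ∧
    Tendsto (fun n => coeff n (H * ((PowerSeries.mk 1 : PowerSeries ℝ) ^ (p + 2) * E)) / coeff (n + 1) (H * ((PowerSeries.mk 1 : PowerSeries ℝ) ^ (p + 2) * E)))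
      atTop (nhds 1) := by
  obtain ⟨hpos, hmono, hr⟩ := growth (fun n => coeff n E) he he0 p C hC hrec
  set f : ℕ → ℝ := fun n => ∑ l ∈ Finset.range (n + 1),
    ((l + (p + 1)).choose (p + 1) : ℝ) * coeff (n - l) E with hf
  have hfc : ∀ n, coeff n ((PowerSeries.mk 1 : PowerSeries ℝ) ^ (p + 2) * E) = f n := by
    intro n
    rw [mk_one_pow_eq_mk_choose_add ℝ (p + 1), coeff_mul,
      Finset.Nat.sum_antidiagonal_eq_sum_range_succ_mk]
    simp only [coeff_mk, hf]
    refine Finset.sum_congr rfl fun l _ => ?_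
    rw [add_comm l]
  have hsch := schur f hpos hmono hr (fun n => coeff n H) hs
  set b : ℕ → ℝ := fun n => coeff n (H * ((PowerSeries.mk 1 : PowerSeries ℝ) ^ (p + 2) * E)) with hb
  have hbf : ∀ n, b n = ∑ p ∈ Finset.HasAntidiagonal.antidiagonal n, coeff p.1 H * f p.2 := by
    intro n
    simp only [hb]
    rw [coeff_mul]
    simp only [hfc]
  have hlim : Tendsto (fun n => b n / f n) atTop (nhds (∑' n, coeff n H)) := by
    simpa only [hbf] using hsch
  have hbpos : ∀ᶠ n in atTop, 0 < b n := by
    filter_upwards [hlim.eventually (lt_mem_nhds hH)] with n hn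
    exact (div_pos_iff_of_pos_right (hpos n)).1 hn
  refine ⟨hbpos, ?_⟩
  have := (hlim.div (hlim.comp (tendsto_add_atTop_nat 1)) hH.ne').mul hr
  rw [div_self hH.ne', one_mul] at this
  refine this.congr' ?_
  filter_upwards [(tendsto_add_atTop_nat 1).eventually hbpos] with n hn
  have h1 := (hpos n).ne'
  have h2 := (hpos (n + 1)).ne'
  have h3 := hn.ne'
  change b n / f n / (b (n + 1) / f (n + 1)) * (f n / f (n + 1)) = b n / b (n + 1)
  field_simp

open PowerSeries in
/-- abstract form of the theorem -/
lemma abstract_main (g : ℕ → ℝ) (B : PowerSeries ℝ) (hB : LogRel (mk g) B)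
    (C : ℝ) (hC : 0 ≤ C) (p : ℕ) (hup : ∀ n, g n ≤ C * (n : ℝ) ^ (p + 1))
    (hlow : Tendsto g atTop atTop) :
    (∀ᶠ n in atTop, 0 < coeff n B) ∧ (∀ᶠ n in atTop, coeff n B < coeff (n + 1) B) ∧
    Tendsto (fun n => coeff n B / coeff (n + 1) B) atTop (nhds 1) := by
  obtain ⟨M, hM⟩ := eventually_atTop.1 (hlow.eventually_ge_atTop ((p + 3 : ℕ) : ℝ))
  have hg0 : g 0 = 0 := by simpa using hB.coeff_zero
  set u : ℕ → ℝ := fun n => if M < n then g n - (p + 3 : ℕ) else 0 with hu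
  have hu0 : u 0 = 0 := by simp [hu]
  have hun : ∀ n, 0 ≤ u n := by
    intro n
    simp only [hu]
    split_ifs with h
    · linarith [hM n h.le]
    · exact le_rfl
  have hCn : ∀ n : ℕ, 0 ≤ C * (n : ℝ) ^ (p + 1) := fun n => by positivity
  have huC : ∀ n, u n ≤ C * (n : ℝ) ^ (p + 1) := by
    intro n
    simp only [hu]
    split_ifs with h
    · have : (0 : ℝ) ≤ ((p + 3 : ℕ) : ℝ) := Nat.cast_nonneg _
      linarith [hup n]
    · exact hCn n
  obtain ⟨E, hE, hEn⟩ := exists_logRel u hu0 hun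
  obtain ⟨H, hH, hHs, hHp⟩ := exists_poly (fun n => g n - (p + 3 : ℕ)) M
  have hBeq : B = H * ((PowerSeries.mk 1 : PowerSeries ℝ) ^ (p + 3) * E) := by
    refine hB.unique ?_
    convert hH.mul ((rel_geom.pow (p + 3)).mul hE) using 1
    ext n
    have e : ((p + 3 : ℕ) : PowerSeries ℝ) = PowerSeries.C ((p + 3 : ℕ) : ℝ) := (map_natCast PowerSeries.C (p + 3)).symm
    rw [map_add, map_add, e, coeff_C_mul]
    simp only [coeff_mk, hu]
    rcases Nat.eq_zero_or_pos n with rfl | hn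
    · simp [hg0]
    · rw [if_neg hn.ne']
      by_cases h : n ≤ M
      · rw [if_pos ⟨hn, h⟩, if_neg (by omega)]; ring
      · rw [if_neg (by omega), if_pos (by omega)]; ring
  have hrecE : ∀ n : ℕ, (n : ℝ) * coeff n E ≤
      C * ∑ l ∈ Finset.range (n + 1), (l : ℝ) ^ (p + 1) * coeff (n - l) E := by
    intro n
    rw [hE.2 n, coeff_mul, Finset.Nat.sum_antidiagonal_eq_sum_range_succ_mk, Finset.mul_sum]
    refine Finset.sum_le_sum fun l _ => ?_
    rw [coeff_mk, ← mul_assoc]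
    exact mul_le_mul_of_nonneg_right (huC l) (hEn _)
  have hrecE' : ∀ n : ℕ, (n : ℝ) * coeff n E ≤
      C * ∑ l ∈ Finset.range (n + 1), (l : ℝ) ^ (p + 1 + 1) * coeff (n - l) E := by
    intro n
    refine (hrecE n).trans (mul_le_mul_of_nonneg_left ?_ hC)
    refine Finset.sum_le_sum fun l _ => mul_le_mul_of_nonneg_right ?_ (hEn _)
    have : l ^ (p + 1) ≤ l ^ (p + 1 + 1) := by
      rcases Nat.eq_zero_or_pos l with rfl | h
      · simp
      · exact Nat.pow_le_pow_right h (by omega)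
    exact_mod_cast this
  obtain ⟨d1, -⟩ := growth_ps E H hEn hE.1 p C hC hrecE hHs hHp
  obtain ⟨b1, b2⟩ := growth_ps E H hEn hE.1 (p + 1) C hC hrecE' hHs hHp
  rw [show p + 1 + 2 = p + 3 by ring, ← hBeq] at b1 b2
  refine ⟨b1, ?_, b2⟩
  have hd : H * ((PowerSeries.mk 1 : PowerSeries ℝ) ^ (p + 2) * E) = B * (1 - X) := by
    rw [hBeq, pow_succ (PowerSeries.mk 1 : PowerSeries ℝ) (p + 2)]
    have := mk_one_mul_one_sub_eq_one ℝ
    linear_combination (-(H * ((PowerSeries.mk 1 : PowerSeries ℝ) ^ (p + 2) * E))) * this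
  rw [hd] at d1
  filter_upwards [(tendsto_add_atTop_nat 1).eventually d1] with n hn
  rw [mul_sub, mul_one, map_sub, coeff_succ_mul_X] at hn
  linarith

/-- under condition (exp), `c_n/c_{n+1} → y^{-1}`, and there exists `N > 0`
such that `c_n/c_{n+1} < y^{-1}` for all `n > N`. -/
theorem ratio_limit_and_inequality (a : ℕ → ℕ) (r y : ℝ) (hr : 0 < r) (hy : 1 ≤ y)
    (hexp : ExpansiveCond a r y) :
    Tendsto (fun n : ℕ => (multisetCount a n : ℝ) / (multisetCount a (n + 1) : ℝ))
      atTop (nhds y⁻¹) ∧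
    ∃ N : ℕ, 0 < N ∧ ∀ n : ℕ, N < n →
      (multisetCount a n : ℝ) / (multisetCount a (n + 1) : ℝ) < y⁻¹ := by
  obtain ⟨D₁, D₂, hD₁, hD₂, hD⟩ := hexp
  have hy0 : 0 < y := by linarith
  have ha : ∀ j, 1 ≤ j → 1 ≤ a j := by
    intro j hj
    have hj' : (0 : ℝ) < j := by exact_mod_cast hj
    have h1 := (hD j hj).1
    have h2 : 0 < D₁ * (j : ℝ) ^ (r - 1) * y ^ j := by positivity
    have : (0 : ℝ) < a j := lt_of_lt_of_le h2 h1
    exact_mod_cast this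
  set g : ℕ → ℝ := fun n => (∑ d ∈ n.divisors, (d : ℝ) * a d) / y ^ n with hg
  set B : PowerSeries ℝ := PowerSeries.mk fun n => (multisetCount a n : ℝ) / y ^ n with hBdef
  have hB : LogRel (PowerSeries.mk g) B := by
    refine ⟨by simp [hBdef, multisetCount], fun n => ?_⟩
    rw [PowerSeries.coeff_mul]
    simp only [hBdef, PowerSeries.coeff_mk, hg]
    rw [← mul_div_assoc, count_rec a ha n, Finset.sum_div]
    refine Finset.sum_congr rfl fun q hq => ?_
    have := Finset.HasAntidiagonal.mem_antidiagonal.1 hq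
    rw [← this, pow_add, div_mul_div_comm]
  have hjr : ∀ j : ℕ, 1 ≤ j → (j : ℝ) * (j : ℝ) ^ (r - 1) = (j : ℝ) ^ r := by
    intro j hj
    have hj' : (0 : ℝ) < j := by exact_mod_cast hj
    rw [Real.rpow_sub_one hj'.ne']
    field_simp
  obtain ⟨p, hp⟩ := exists_nat_ge r
  have hup : ∀ n, g n ≤ D₂ * (n : ℝ) ^ (p + 1) := by
    intro n
    rcases Nat.eq_zero_or_pos n with rfl | hn
    · simp [hg]
    have hn' : (1 : ℝ) ≤ n := by exact_mod_cast hn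
    simp only [hg]
    rw [div_le_iff₀ (by positivity)]
    have h1 : ∀ d ∈ n.divisors, (d : ℝ) * a d ≤ D₂ * (n : ℝ) ^ p * y ^ n := by
      intro d hd
      have hd1 : 1 ≤ d := Nat.pos_of_mem_divisors hd
      have hd2 : d ≤ n := Nat.divisor_le hd
      have hd1' : (1 : ℝ) ≤ d := by exact_mod_cast hd1
      have hd2' : (d : ℝ) ≤ n := by exact_mod_cast hd2
      have e1 : (d : ℝ) ^ r ≤ (n : ℝ) ^ p := by
        calc (d : ℝ) ^ r ≤ (n : ℝ) ^ r := Real.rpow_le_rpow (by positivity) hd2' hr.le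
          _ ≤ (n : ℝ) ^ (p : ℝ) := Real.rpow_le_rpow_of_exponent_le hn' hp
          _ = (n : ℝ) ^ p := Real.rpow_natCast _ _
      have e2 : y ^ d ≤ y ^ n := pow_le_pow_right₀ hy hd2
      calc (d : ℝ) * a d ≤ d * (D₂ * (d : ℝ) ^ (r - 1) * y ^ d) :=
            mul_le_mul_of_nonneg_left (hD d hd1).2 (by positivity)
        _ = D₂ * (d : ℝ) ^ r * y ^ d := by rw [← hjr d hd1]; ring
        _ ≤ D₂ * (n : ℝ) ^ p * y ^ n := by gcongr
    refine (Finset.sum_le_card_nsmul _ _ _ h1).trans ?_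
    rw [nsmul_eq_mul]
    have h2 : ((n.divisors.card : ℕ) : ℝ) ≤ n := by exact_mod_cast Nat.card_divisors_le_self n
    calc ((n.divisors.card : ℕ) : ℝ) * (D₂ * (n : ℝ) ^ p * y ^ n) ≤ n * (D₂ * (n : ℝ) ^ p * y ^ n) :=
          mul_le_mul_of_nonneg_right h2 (by positivity)
      _ = D₂ * (n : ℝ) ^ (p + 1) * y ^ n := by ring
  have hlow : Tendsto g atTop atTop := by
    have t : Tendsto (fun n : ℕ => D₁ * (n : ℝ) ^ r) atTop atTop :=
      ((tendsto_rpow_atTop hr).comp tendsto_natCast_atTop_atTop).const_mul_atTop hD₁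
    refine tendsto_atTop_mono' _ ?_ t
    filter_upwards [eventually_ge_atTop 1] with n hn
    simp only [hg]
    rw [le_div_iff₀ (by positivity)]
    have h1 : (n : ℝ) * a n ≤ ∑ d ∈ n.divisors, (d : ℝ) * a d :=
      Finset.single_le_sum (f := fun d : ℕ => (d : ℝ) * a d) (fun _ _ => by positivity)
        (Nat.mem_divisors_self n (by omega))
    refine le_trans ?_ h1
    calc D₁ * (n : ℝ) ^ r * y ^ n = n * (D₁ * (n : ℝ) ^ (r - 1) * y ^ n) := by rw [← hjr n hn]; ring
      _ ≤ n * a n := mul_le_mul_of_nonneg_left (hD n hn).1 (by positivity)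
  obtain ⟨h1, h2, h3⟩ := abstract_main g B hB D₂ hD₂.le p hup hlow
  have hcoeff : ∀ n, PowerSeries.coeff n B = (multisetCount a n : ℝ) / y ^ n := fun n => by
    simp [hBdef]
  have hquot : ∀ n, (multisetCount a n : ℝ) / (multisetCount a (n + 1) : ℝ) =
      PowerSeries.coeff n B / PowerSeries.coeff (n + 1) B * y⁻¹ := by
    intro n
    rw [hcoeff, hcoeff, pow_succ]
    field_simp
  simp only [hquot]
  refine ⟨by simpa using h3.mul_const y⁻¹, ?_⟩
  obtain ⟨N, hN⟩ := eventually_atTop.1 (((tendsto_add_atTop_nat 1).eventually h1).and h2)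
  refine ⟨N + 1, by omega, fun n hn => ?_⟩
  obtain ⟨q1, q2⟩ := hN n (by omega)
  have : PowerSeries.coeff n B / PowerSeries.coeff (n + 1) B < 1 := (div_lt_one q1).2 q2
  have hyi : 0 < y⁻¹ := by positivity
  calc _ < 1 * y⁻¹ := mul_lt_mul_of_pos_right this hyi
    _ = y⁻¹ := one_mul _
end

section
/- Corollary. Let r > 0, 0 < ε ≤ r/3 and y ≥ 1. If a ∈ 𝓕(2r/3 + ε, r, y), then δ_n → 0 as n → ∞ and c_n / c_{n+1} = y^{−1} exp(−δ_n + o(δ_n)); equivalently, (log(c_n/c_{n+1}) + log y) / δ_n → −1 as n → ∞. -/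
open Finset Filter

/-- `M_n(σ) = Σ_{j=1}^n j a_j e^{-jσ}/(1-e^{-jσ})`. -/
noncomputable def Mfun (a : ℕ → ℕ) (n : ℕ) (σ : ℝ) : ℝ :=
  ∑ j ∈ Finset.Icc 1 n, (j : ℝ) * (a j) * Real.exp (-(j * σ)) / (1 - Real.exp (-(j * σ)))

/-- `a ∈ 𝓕(r₁, r₂, y)`: there are `γ₁, γ₂ > 0` with
`γ₁ j^{r₁-1} y^j ≤ a_j ≤ γ₂ j^{r₂-1} y^j` for all `j ≥ 1`. -/
def FCond (a : ℕ → ℕ) (r₁ r₂ y : ℝ) : Prop :=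
  ∃ γ₁ γ₂ : ℝ, 0 < γ₁ ∧ 0 < γ₂ ∧ ∀ j : ℕ, 1 ≤ j →
    γ₁ * (j : ℝ) ^ (r₁ - 1) * y ^ j ≤ (a j : ℝ) ∧ (a j : ℝ) ≤ γ₂ * (j : ℝ) ^ (r₂ - 1) * y ^ j


/-- power series of `(1 - X^j)^{-A}` -/
noncomputable def Gser (A j : ℕ) : PowerSeries ℝ :=
  PowerSeries.mk fun k => if j ∣ k then (Nat.choose (A + k / j - 1) (k / j) : ℝ) else 0

lemma agree_mul {n : ℕ} {A B C D : PowerSeries ℝ}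
    (h : ∀ m ≤ n, PowerSeries.coeff m A = PowerSeries.coeff m B)
    (h' : ∀ m ≤ n, PowerSeries.coeff m C = PowerSeries.coeff m D) :
    ∀ m ≤ n, PowerSeries.coeff m (A * C) = PowerSeries.coeff m (B * D) := by
  intro m hm
  rw [PowerSeries.coeff_mul, PowerSeries.coeff_mul]
  apply Finset.sum_congr rfl
  rintro ⟨i, j⟩ hij
  rw [Finset.HasAntidiagonal.mem_antidiagonal] at hij
  simp only at hij ⊢
  rw [h i (by omega), h' j (by omega)]

lemma agree_prod {n : ℕ} {ι : Type*} (s : Finset ι) {A B : ι → PowerSeries ℝ}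
    (h : ∀ i ∈ s, ∀ m ≤ n, PowerSeries.coeff m (A i) = PowerSeries.coeff m (B i)) :
    ∀ m ≤ n, PowerSeries.coeff m (∏ i ∈ s, A i) = PowerSeries.coeff m (∏ i ∈ s, B i) := by
  classical
  induction s using Finset.induction_on with
  | empty => simp
  | insert i s hi ih =>
    rw [Finset.prod_insert hi, Finset.prod_insert hi]
    exact agree_mul (h i (by simp)) (ih fun k hk => h k (by simp [hk]))

lemma coeff_H (A j n m : ℕ) (hj : 1 ≤ j) (hm : m ≤ n) :
    PowerSeries.coeff m (Gser A j) = PowerSeries.coeff m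
      (∑ k : Fin (n + 1), PowerSeries.C (Nat.choose (A + k.1 - 1) k.1 : ℝ) *
        (PowerSeries.X : PowerSeries ℝ) ^ (j * k.1)) := by
  rw [map_sum]
  simp only [PowerSeries.coeff_C_mul, PowerSeries.coeff_X_pow, Gser, PowerSeries.coeff_mk]
  split_ifs with h
  · obtain ⟨k, rfl⟩ := h
    have hk : k ≤ j * k := Nat.le_mul_of_pos_left k (by omega)
    rw [Finset.sum_eq_single (⟨k, by omega⟩ : Fin (n + 1))]
    · simp [Nat.mul_div_cancel_left k (show 0 < j by omega)]
    · intro b _ hb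
      rw [if_neg, mul_zero]
      intro h
      apply hb
      ext
      exact (Nat.eq_of_mul_eq_mul_left (by omega) h).symm
    · simp
  · symm
    apply Finset.sum_eq_zero
    intro b _
    rw [if_neg, mul_zero]
    rintro rfl
    exact h ⟨_, rfl⟩

lemma coeff_prod_eq (a : ℕ → ℕ) (n N : ℕ) (hN : n ≤ N) :
    PowerSeries.coeff n (∏ j ∈ Finset.range N, Gser (a (j + 1)) (j + 1)) =
      (multisetCount a n : ℝ) := by
  have h1 : PowerSeries.coeff n (∏ j ∈ Finset.range N, Gser (a (j + 1)) (j + 1)) =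
      PowerSeries.coeff n (∏ j ∈ Finset.range n, Gser (a (j + 1)) (j + 1)) := by
    have := agree_prod (n := n) (Finset.range N) (A := fun j => Gser (a (j + 1)) (j + 1))
      (B := fun j => if j ∈ Finset.range n then Gser (a (j + 1)) (j + 1) else 1) (by
        intro j hj m hm
        split_ifs with h
        · rfl
        · simp only [Finset.mem_range] at h
          simp only [Gser, PowerSeries.coeff_mk, PowerSeries.coeff_one]
          rcases Nat.eq_zero_or_pos m with rfl | hm0
          · simp
          · rw [if_neg, if_neg (by omega)]
            intro hd
            have := Nat.le_of_dvd hm0 hd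
            omega) n le_rfl
    rw [this, Finset.prod_ite_mem]
    congr 2
    ext x; simp; omega
  rw [h1, Finset.prod_range fun j => Gser (a (j + 1)) (j + 1)]
  rw [agree_prod (n := n) Finset.univ (fun j _ m hm => coeff_H (a (j.1 + 1)) (j.1 + 1) n m (by omega) hm)
    n le_rfl]
  rw [Finset.prod_univ_sum, map_sum]
  simp only [Fintype.piFinset_univ, Finset.prod_mul_distrib, Finset.prod_pow_eq_pow_sum]
  unfold multisetCount
  push_cast
  apply Finset.sum_congr rfl
  intro η _
  rw [← map_prod, PowerSeries.coeff_C_mul, PowerSeries.coeff_X_pow]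
  by_cases h : ∑ j : Fin n, (j.1 + 1) * (η j).1 = n
  · rw [if_pos h, if_pos h.symm, mul_one]
  · rw [if_neg h, if_neg (fun h' => h h'.symm), mul_zero]

lemma Gser_nonneg (A j k : ℕ) : 0 ≤ PowerSeries.coeff k (Gser A j) := by
  simp only [Gser, PowerSeries.coeff_mk]; split_ifs <;> positivity

lemma Gser_hasSum (A j : ℕ) (hA : 1 ≤ A) (hj : 1 ≤ j) (z : ℂ) (hz : ‖z‖ < 1) :
    (Summable fun k => ‖((PowerSeries.coeff k (Gser A j) : ℝ) : ℂ) * z ^ k‖) ∧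
    HasSum (fun k => ((PowerSeries.coeff k (Gser A j) : ℝ) : ℂ) * z ^ k) (1 / (1 - z ^ j) ^ A) := by
  obtain ⟨B, rfl⟩ : ∃ B, A = B + 1 := ⟨A - 1, by omega⟩
  have hinj : Function.Injective (fun m : ℕ => j * m) := fun x y h =>
    Nat.eq_of_mul_eq_mul_left (by omega) h
  have hzj : ‖z ^ j‖ < 1 := by
    rw [norm_pow]; exact pow_lt_one₀ (norm_nonneg _) hz (by omega)
  have hz0 : ∀ k, k ∉ Set.range (fun m : ℕ => j * m) → PowerSeries.coeff k (Gser (B + 1) j) = 0 := by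
    intro k hk
    simp only [Gser, PowerSeries.coeff_mk]
    rw [if_neg]
    rintro ⟨m, rfl⟩
    exact hk ⟨m, rfl⟩
  have hco : ∀ m, PowerSeries.coeff (j * m) (Gser (B + 1) j) = ((m + B).choose B : ℝ) := by
    intro m
    simp only [Gser, PowerSeries.coeff_mk, Nat.mul_div_cancel_left m (show 0 < j by omega)]
    rw [if_pos ⟨m, rfl⟩]
    congr 1
    rw [show B + 1 + m - 1 = m + B by omega]
    rw [Nat.choose_symm_add]
  have hs := hasSum_choose_mul_geometric_of_norm_lt_one B hzj
  have hH : HasSum (fun k => ((PowerSeries.coeff k (Gser (B+1) j) : ℝ) : ℂ) * z ^ k)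
      (1 / (1 - z ^ j) ^ (B+1)) := by
    rw [← hinj.hasSum_iff]
    · have e : ((fun k => ((PowerSeries.coeff k (Gser (B+1) j) : ℝ) : ℂ) * z ^ k) ∘
          fun m : ℕ => j * m) = fun m => (((m + B).choose B : ℕ) : ℂ) * (z ^ j) ^ m := by
        funext m
        simp only [Function.comp]
        rw [hco, pow_mul]; push_cast; rfl
      rw [e]
      exact hs
    · intro k hk
      rw [hz0 k hk]; simp
  exact ⟨hH.summable.norm, hH⟩

lemma prod_hasSum (a : ℕ → ℕ) (ha : ∀ j, 1 ≤ j → 1 ≤ a j) (N : ℕ) (z : ℂ) (hz : ‖z‖ < 1) :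
    (Summable fun k => ‖((PowerSeries.coeff k (∏ j ∈ Finset.range N, Gser (a (j + 1)) (j + 1)) : ℝ) : ℂ) * z ^ k‖) ∧
    HasSum (fun k => ((PowerSeries.coeff k (∏ j ∈ Finset.range N, Gser (a (j + 1)) (j + 1)) : ℝ) : ℂ) * z ^ k)
      (∏ j ∈ Finset.range N, 1 / (1 - z ^ (j + 1)) ^ a (j + 1)) := by
  induction N with
  | zero =>
    have hH : HasSum (fun k => ((PowerSeries.coeff k (∏ j ∈ Finset.range 0, Gser (a (j + 1)) (j + 1)) : ℝ) : ℂ) * z ^ k)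
      (∏ j ∈ Finset.range 0, 1 / (1 - z ^ (j + 1)) ^ a (j + 1)) := by
      simp only [Finset.range_zero, Finset.prod_empty, PowerSeries.coeff_one]
      convert hasSum_ite_eq (0 : ℕ) (1 : ℂ) using 2 with k
      split_ifs with h <;> simp [h]
    exact ⟨hH.summable.norm, hH⟩
  | succ N ih =>
    obtain ⟨h1, h2⟩ := ih
    obtain ⟨g1, g2⟩ := Gser_hasSum (a (N + 1)) (N + 1) (ha _ (by omega)) (by omega) z hz
    have key := tsum_mul_tsum_eq_tsum_sum_antidiagonal_of_summable_norm h1 g1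
    have key2 := summable_norm_sum_mul_antidiagonal_of_summable_norm h1 g1
    have e : ∀ k, ∑ kl ∈ Finset.HasAntidiagonal.antidiagonal k,
        (((PowerSeries.coeff kl.1 (∏ j ∈ Finset.range N, Gser (a (j + 1)) (j + 1)) : ℝ) : ℂ) * z ^ kl.1) *
        (((PowerSeries.coeff kl.2 (Gser (a (N + 1)) (N + 1)) : ℝ) : ℂ) * z ^ kl.2)
        = ((PowerSeries.coeff k (∏ j ∈ Finset.range (N + 1), Gser (a (j + 1)) (j + 1)) : ℝ) : ℂ) * z ^ k := by
      intro k
      rw [Finset.prod_range_succ, PowerSeries.coeff_mul]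
      push_cast
      rw [Finset.sum_mul]
      apply Finset.sum_congr rfl
      rintro ⟨i, l⟩ h
      rw [Finset.HasAntidiagonal.mem_antidiagonal] at h
      simp only at h ⊢
      rw [← h, pow_add]; ring
    simp only [e] at key key2
    refine ⟨key2, ?_⟩
    have := key2.of_norm.hasSum
    rw [← key, h2.tsum_eq, g2.tsum_eq] at this
    rw [Finset.prod_range_succ (fun j => 1 / (1 - z ^ (j + 1)) ^ a (j + 1))]
    exact this

lemma fourier_coeff (d : ℕ → ℝ) (ρ : ℝ) (F : ℝ → ℂ)
    (hs : Summable fun k => ‖((d k : ℝ) : ℂ) * (ρ : ℂ) ^ k‖)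
    (hF : ∀ θ : ℝ, HasSum (fun k => ((d k : ℝ) : ℂ) * ((ρ : ℂ) * Complex.exp (θ * Complex.I)) ^ k) (F θ))
    (n : ℕ) :
    ∫ θ in (-Real.pi)..Real.pi, F θ * Complex.exp (-(n * θ) * Complex.I) =
      2 * Real.pi * (d n * ρ ^ n : ℝ) := by
  let f : ℕ → C(ℝ, ℂ) := fun k => ⟨fun θ : ℝ => ((d k : ℝ) : ℂ) * ((ρ : ℂ) * Complex.exp (θ * Complex.I)) ^ k
    * Complex.exp (-(n * θ) * Complex.I), by fun_prop⟩
  have hfn : ∀ k θ, ‖f k θ‖ = ‖((d k : ℝ) : ℂ) * (ρ : ℂ) ^ k‖ := by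
    intro k θ
    simp only [f, ContinuousMap.coe_mk, norm_mul, norm_pow, Complex.norm_exp_ofReal_mul_I]
    rw [show (-(n * θ) * Complex.I : ℂ) = ((-(n * θ) : ℝ) : ℂ) * Complex.I by push_cast; ring,
      Complex.norm_exp_ofReal_mul_I]
    simp
  have key := intervalIntegral.hasSum_intervalIntegral_of_summable_norm (a := -Real.pi) (b := Real.pi) (f := f) (by
    refine Summable.of_nonneg_of_le (fun _ => norm_nonneg _) (fun k => ?_) hs
    rw [ContinuousMap.norm_le _ (norm_nonneg _)]
    intro x
    exact (hfn k x).le)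
  have e1 : ∀ θ : ℝ, ∑' k, f k θ = F θ * Complex.exp (-(n * θ) * Complex.I) := fun θ =>
    ((hF θ).mul_right _).tsum_eq
  simp only [e1] at key
  have e2 : ∀ k, ∫ θ in (-Real.pi)..Real.pi, f k θ =
      if k = n then 2 * Real.pi * ((d n * ρ ^ n : ℝ) : ℂ) else 0 := by
    intro k
    have : ∀ θ, f k θ = ((d k * ρ ^ k : ℝ) : ℂ) * Complex.exp ((((k : ℂ) - n) * Complex.I) * θ) := by
      intro θ
      simp only [f, ContinuousMap.coe_mk]
      rw [mul_pow, ← Complex.exp_nat_mul]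
      push_cast
      rw [mul_assoc, mul_assoc, mul_assoc, ← Complex.exp_add]
      ring_nf
    simp only [this]
    rw [intervalIntegral.integral_const_mul]
    split_ifs with h
    · subst h
      simp
      ring
    · have hne : ((k : ℂ) - n) * Complex.I ≠ 0 := by
        apply mul_ne_zero _ Complex.I_ne_zero
        rw [sub_ne_zero]; exact_mod_cast h
      rw [integral_exp_mul_complex hne]
      have : Complex.exp (((k : ℂ) - n) * Complex.I * (Real.pi : ℝ)) =
          Complex.exp (((k : ℂ) - n) * Complex.I * ((-Real.pi : ℝ) : ℂ)) := by
        rw [Complex.exp_eq_exp_iff_exists_int]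
        refine ⟨(k : ℤ) - n, ?_⟩
        push_cast; ring
      rw [this]; simp
  simp only [e2] at key
  exact key.unique (hasSum_ite_eq n _)

/-- one normalized factor -/
noncomputable def wf (q φ : ℝ) : ℂ := (1 - q) / (1 - q * Complex.exp (φ * Complex.I))

/-- its argument -/
noncomputable def af (q φ : ℝ) : ℝ := -(Complex.log (1 - q * Complex.exp (φ * Complex.I))).im

lemma one_sub_re (q φ : ℝ) : (1 - q * Complex.exp (φ * Complex.I)).re = 1 - q * Real.cos φ := by
  simp [Complex.exp_ofReal_mul_I_re]

lemma one_sub_im (q φ : ℝ) : (1 - q * Complex.exp (φ * Complex.I)).im = - (q * Real.sin φ) := by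
  simp [Complex.exp_ofReal_mul_I_im]

lemma one_sub_normSq (q φ : ℝ) : Complex.normSq (1 - q * Complex.exp (φ * Complex.I)) =
    (1 - q) ^ 2 + 2 * q * (1 - Real.cos φ) := by
  rw [Complex.normSq_apply, one_sub_re, one_sub_im]
  have := Real.sin_sq_add_cos_sq φ
  linear_combination q ^ 2 * this

lemma one_sub_re_pos {q : ℝ} (hq : 0 < q) (hq1 : q < 1) (φ : ℝ) :
    0 < (1 - q * Complex.exp (φ * Complex.I)).re := by
  rw [one_sub_re]
  nlinarith [Real.cos_le_one φ]

lemma one_sub_ne {q : ℝ} (hq : 0 < q) (hq1 : q < 1) (φ : ℝ) :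
    (1 - q * Complex.exp (φ * Complex.I)) ≠ 0 := by
  intro h
  have := one_sub_re_pos hq hq1 φ
  rw [h] at this
  simp at this

lemma wf_polar {q : ℝ} (hq : 0 < q) (hq1 : q < 1) (φ : ℝ) :
    wf q φ = ‖wf q φ‖ * Complex.exp (af q φ * Complex.I) := by
  have h0 := one_sub_ne hq hq1 φ
  set u := (1 - q * Complex.exp (φ * Complex.I)) with hu
  have h1 : (‖u‖ : ℂ) * Complex.exp (u.arg * Complex.I) = u := Complex.norm_mul_exp_arg_mul_I u
  have hn : (‖u‖ : ℂ) ≠ 0 := by simpa using h0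
  have h2 : wf q φ = (1 - q) / u := rfl
  have h3 : af q φ = - u.arg := by rw [af, ← hu, Complex.log_im]
  have h4 : ‖(1 - q : ℂ)‖ = 1 - q := by
    rw [show (1 - q : ℂ) = ((1 - q : ℝ) : ℂ) by push_cast; ring, Complex.norm_real, Real.norm_eq_abs,
      abs_of_pos (by linarith)]
  rw [h3, h2, norm_div, h4]
  push_cast
  rw [neg_mul, Complex.exp_neg]
  conv_lhs => rw [← h1]
  have := Complex.exp_ne_zero (u.arg * Complex.I)
  field_simp

lemma wf_norm_sq {q : ℝ} (hq : 0 < q) (hq1 : q < 1) (φ : ℝ) :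
    ‖wf q φ‖ ^ 2 * (1 + 2 * q * (1 - Real.cos φ) / (1 - q) ^ 2) = 1 := by
  have hpos : 0 < 1 - q := by linarith
  rw [wf, norm_div, div_pow, ← Complex.normSq_eq_norm_sq, ← Complex.normSq_eq_norm_sq,
    one_sub_normSq, show (1 - q : ℂ) = ((1 - q : ℝ) : ℂ) by push_cast; ring, Complex.normSq_ofReal]
  have : 0 < (1 - q) ^ 2 + 2 * q * (1 - Real.cos φ) := by
    have := Real.cos_le_one φ
    have : 0 ≤ q * (1 - Real.cos φ) := mul_nonneg hq.le (by linarith)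
    nlinarith
  have e : 1 + 2 * q * (1 - Real.cos φ) / (1 - q) ^ 2 =
      ((1 - q) ^ 2 + 2 * q * (1 - Real.cos φ)) / (1 - q) ^ 2 := by
    field_simp
  rw [e]
  generalize (1 - q) ^ 2 + 2 * q * (1 - Real.cos φ) = D at *
  field_simp

lemma wf_upper {q : ℝ} (hq : 0 < q) (hq1 : q < 1) (φ : ℝ) :
    ‖wf q φ‖ ≤ Real.exp (-(q * (1 - Real.cos φ) / 5)) := by
  have h := wf_norm_sq hq hq1 φ
  have hc := Real.cos_le_one φ
  have hc' := Real.neg_one_le_cos φ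
  set t := q * (1 - Real.cos φ) with ht
  have ht0 : 0 ≤ t := mul_nonneg hq.le (by linarith)
  have ht2 : t ≤ 2 := by nlinarith
  have h1 : 2 * t ≤ 2 * q * (1 - Real.cos φ) / (1 - q) ^ 2 := by
    rw [le_div_iff₀ (by nlinarith)]
    have : (1 - q) ^ 2 ≤ 1 := by nlinarith
    nlinarith
  have h2 : Real.exp (2 * t / 5) ≤ 1 + 2 * t := by
    have h3 : 1 - 2 * t / 5 ≤ Real.exp (-(2 * t / 5)) := by
      have := Real.add_one_le_exp (-(2 * t / 5)); linarith
    have h4 : Real.exp (2 * t / 5) * Real.exp (-(2 * t / 5)) = 1 := by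
      rw [← Real.exp_add]; simp
    have h5 : Real.exp (2 * t / 5) * (1 - 2 * t / 5) ≤ 1 := by
      have := mul_le_mul_of_nonneg_left h3 (Real.exp_pos (2 * t / 5)).le
      rwa [h4] at this
    have h6 : 1 ≤ (1 + 2 * t) * (1 - 2 * t / 5) := by nlinarith
    exact le_of_mul_le_mul_right (h5.trans h6) (by linarith)
  have h3 : ‖wf q φ‖ ^ 2 * Real.exp (2 * t / 5) ≤ 1 := by
    rw [← h]
    apply mul_le_mul_of_nonneg_left _ (sq_nonneg _)
    linarith
  have h4 : ‖wf q φ‖ ^ 2 ≤ Real.exp (-(t / 5)) ^ 2 := by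
    rw [← Real.exp_nat_mul, show ((2 : ℕ) : ℝ) * -(t / 5) = -(2 * t / 5) by push_cast; ring,
      Real.exp_neg, ← one_div, le_div_iff₀ (Real.exp_pos _)]
    exact h3
  exact le_of_sq_le_sq h4 (Real.exp_pos _).le

lemma wf_lower {q : ℝ} (hq : 0 < q) (hq1 : q < 1) (φ : ℝ) :
    Real.exp (-(q * φ ^ 2 / (1 - q) ^ 2)) ≤ ‖wf q φ‖ := by
  have h := wf_norm_sq hq hq1 φ
  have hc := Real.cos_le_one φ
  have hc2 := Real.one_sub_sq_div_two_le_cos (x := φ)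
  have hp : 0 < (1 - q) ^ 2 := by nlinarith
  set t := q * φ ^ 2 / (1 - q) ^ 2 with ht
  have h0 : 0 ≤ t := by positivity
  have h1 : 2 * q * (1 - Real.cos φ) / (1 - q) ^ 2 ≤ t := by
    rw [ht]
    apply div_le_div_of_nonneg_right _ hp.le
    nlinarith
  have h2 : 1 ≤ ‖wf q φ‖ ^ 2 * Real.exp (2 * t) := by
    rw [← h]
    apply mul_le_mul_of_nonneg_left _ (sq_nonneg _)
    have := Real.add_one_le_exp (2 * t)
    linarith
  have h4 : Real.exp (-t) ^ 2 ≤ ‖wf q φ‖ ^ 2 := by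
    rw [← Real.exp_nat_mul, show ((2 : ℕ) : ℝ) * -t = -(2 * t) by push_cast; ring,
      Real.exp_neg, ← one_div, div_le_iff₀ (Real.exp_pos _)]
    exact h2
  exact le_of_sq_le_sq h4 (norm_nonneg _)

lemma af_hasDerivAt {q : ℝ} (hq : 0 < q) (hq1 : q < 1) (φ : ℝ) :
    HasDerivAt (af q) ((1 - q * Real.cos φ) / ((1 - q) ^ 2 + 2 * q * (1 - Real.cos φ)) - 1) φ := by
  have h0 := one_sub_ne hq hq1 φ
  have h1 : HasDerivAt (fun x : ℝ => (1 : ℂ) - q * Complex.exp (x * Complex.I))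
      (-(q * (Complex.exp (φ * Complex.I) * Complex.I))) φ := by
    have h := (((Complex.ofRealCLM.hasDerivAt (x := φ)).mul_const Complex.I).cexp.const_mul (q : ℂ)).const_sub 1
    simpa using h
  have h2 := h1.clog_real (Or.inl (one_sub_re_pos hq hq1 φ))
  have h3 := (Complex.imCLM.hasFDerivAt.comp_hasDerivAt φ h2).neg
  have e : -(Complex.imCLM (-(q * (Complex.exp (φ * Complex.I) * Complex.I)) / (1 - q * Complex.exp (φ * Complex.I))))
      = (1 - q * Real.cos φ) / ((1 - q) ^ 2 + 2 * q * (1 - Real.cos φ)) - 1 := by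
    rw [← one_sub_normSq, ← one_sub_re]
    set u := (1 - q * Complex.exp (φ * Complex.I)) with hu
    have : (-(q * (Complex.exp (φ * Complex.I) * Complex.I)) / u) = (1 - u⁻¹) * Complex.I := by
      have : u - 1 = - (q * Complex.exp (φ * Complex.I)) := by rw [hu]; ring
      field_simp
      linear_combination (-1 : ℂ) * this
    rw [this]
    simp [Complex.mul_im, Complex.inv_re]
  rw [← e]
  exact h3

lemma af_bound {q : ℝ} (hq : 0 < q) (hq1 : q < 1) (φ : ℝ) :
    |af q φ - q * φ / (1 - q)| ≤ q * |φ| ^ 3 / (1 - q) ^ 3 := by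
  have hp : 0 < 1 - q := by linarith
  have hd : ∀ x : ℝ, HasDerivAt (fun x => af q x - q * x / (1 - q))
      ((1 - q * Real.cos x) / ((1 - q) ^ 2 + 2 * q * (1 - Real.cos x)) - 1 - q * 1 / (1 - q)) x := by
    intro x
    exact (af_hasDerivAt hq hq1 x).sub (((hasDerivAt_id x).const_mul q).div_const (1 - q))
  have hb : ∀ x ∈ Set.uIcc 0 φ, ‖(1 - q * Real.cos x) / ((1 - q) ^ 2 + 2 * q * (1 - Real.cos x)) - 1 - q * 1 / (1 - q)‖
      ≤ q * φ ^ 2 / (1 - q) ^ 3 := by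
    intro x hx
    have hx2 : x ^ 2 ≤ φ ^ 2 := by
      rw [sq_le_sq]
      have := Set.abs_sub_left_of_mem_uIcc hx
      simpa using this
    have hc := Real.cos_le_one x
    have hc2 := Real.one_sub_sq_div_two_le_cos (x := x)
    have hD : (1 - q) ^ 2 ≤ (1 - q) ^ 2 + 2 * q * (1 - Real.cos x) := by nlinarith
    have hp2 : 0 < (1 - q) ^ 2 := by positivity
    have hD0 : 0 < (1 - q) ^ 2 + 2 * q * (1 - Real.cos x) := by linarith
    have e : (1 - q * Real.cos x) / ((1 - q) ^ 2 + 2 * q * (1 - Real.cos x)) - 1 - q * 1 / (1 - q) =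
        - (q * (1 + q) * (1 - Real.cos x) / (((1 - q) ^ 2 + 2 * q * (1 - Real.cos x)) * (1 - q))) := by
      obtain ⟨D, hDe⟩ : ∃ D, D = (1 - q) ^ 2 + 2 * q * (1 - Real.cos x) := ⟨_, rfl⟩
      rw [← hDe] at hD0 ⊢
      field_simp
      rw [hDe]
      ring
    rw [e, norm_neg, Real.norm_eq_abs, abs_of_nonneg (by
      apply div_nonneg
      · exact mul_nonneg (by positivity) (by linarith)
      · positivity)]
    apply div_le_div₀ (by positivity)
    · have h1 : (1 + q) * (1 - Real.cos x) ≤ 2 * (x ^ 2 / 2) :=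
        mul_le_mul (by linarith) (by linarith) (by linarith) (by norm_num)
      have h2 : (1 + q) * (1 - Real.cos x) ≤ φ ^ 2 := by linarith
      rw [mul_assoc]
      exact mul_le_mul_of_nonneg_left h2 hq.le
    · positivity
    · rw [pow_succ (1 - q) 2]
      exact mul_le_mul_of_nonneg_right hD hp.le
  have key := (convex_uIcc (0 : ℝ) φ).norm_image_sub_le_of_norm_hasDerivWithin_le
    (fun x _ => (hd x).hasDerivWithinAt) hb Set.left_mem_uIcc Set.right_mem_uIcc
  have a0 : af q 0 = 0 := by
    simp only [af, Complex.ofReal_zero, zero_mul, Complex.exp_zero, mul_one]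
    rw [show (1 - q : ℂ) = ((1 - q : ℝ) : ℂ) by push_cast; ring, ← Complex.ofReal_log hp.le]
    simp
  rw [a0] at key
  simp only [mul_zero, zero_div, sub_zero, Real.norm_eq_abs] at key
  calc _ ≤ _ := key
    _ = _ := by rw [← sq_abs]; ring

/-- the normalized generating function on the circle -/
noncomputable def Phi (a : ℕ → ℕ) (N : ℕ) (σ θ : ℝ) : ℂ :=
  ∏ j ∈ Finset.Icc 1 N, wf (Real.exp (-(j * σ))) (j * θ) ^ a j

lemma q_pos_lt {σ : ℝ} (hσ : 0 < σ) {j : ℕ} (hj : 1 ≤ j) :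
    0 < Real.exp (-(j * σ)) ∧ Real.exp (-(j * σ)) < 1 := by
  refine ⟨Real.exp_pos _, ?_⟩
  rw [Real.exp_lt_one_iff]
  have : (0 : ℝ) < j := by exact_mod_cast hj
  have := mul_pos this hσ
  linarith

lemma phi_polar (a : ℕ → ℕ) (N : ℕ) {σ : ℝ} (hσ : 0 < σ) (θ : ℝ) :
    Phi a N σ θ = ‖Phi a N σ θ‖ * Complex.exp
      ((∑ j ∈ Finset.Icc 1 N, a j * af (Real.exp (-(j * σ))) (j * θ) : ℝ) * Complex.I) := by
  have : ∀ j ∈ Finset.Icc 1 N, wf (Real.exp (-(j * σ))) (j * θ) ^ a j =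
      (‖wf (Real.exp (-(j * σ))) (j * θ) ^ a j‖ : ℂ) *
        Complex.exp ((a j * af (Real.exp (-(j * σ))) (j * θ) : ℝ) * Complex.I) := by
    intro j hj
    rw [Finset.mem_Icc] at hj
    have hq := q_pos_lt hσ hj.1
    conv_lhs => rw [wf_polar hq.1 hq.2]
    rw [mul_pow, ← Complex.exp_nat_mul, norm_pow]
    push_cast
    ring_nf
  have h2 : Phi a N σ θ = _ := Finset.prod_congr rfl this
  rw [Finset.prod_mul_distrib, ← Complex.exp_sum] at h2
  rw [h2]
  conv_rhs => rw [← h2]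
  rw [Phi, norm_prod]
  push_cast
  rw [Finset.sum_mul]

lemma phi_norm_le (a : ℕ → ℕ) (N : ℕ) {σ : ℝ} (hσ : 0 < σ) (θ : ℝ) :
    ‖Phi a N σ θ‖ ≤ Real.exp (-(1 / 5 * ∑ j ∈ Finset.Icc 1 N,
      a j * Real.exp (-(j * σ)) * (1 - Real.cos (j * θ)))) := by
  rw [Phi, norm_prod, Finset.mul_sum, ← Finset.sum_neg_distrib, Real.exp_sum]
  apply Finset.prod_le_prod (fun _ _ => norm_nonneg _)
  intro j hj
  rw [Finset.mem_Icc] at hj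
  have hq := q_pos_lt hσ hj.1
  rw [norm_pow]
  calc _ ≤ _ := pow_le_pow_left₀ (norm_nonneg _) (wf_upper hq.1 hq.2 _) _
    _ = _ := by rw [← Real.exp_nat_mul]; ring_nf

lemma phi_norm_ge (a : ℕ → ℕ) (N : ℕ) {σ : ℝ} (hσ : 0 < σ) (θ : ℝ) :
    Real.exp (-(θ ^ 2 * ∑ j ∈ Finset.Icc 1 N,
      a j * Real.exp (-(j * σ)) * j ^ 2 / (1 - Real.exp (-(j * σ))) ^ 2)) ≤ ‖Phi a N σ θ‖ := by
  rw [Phi, norm_prod, Finset.mul_sum, ← Finset.sum_neg_distrib, Real.exp_sum]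
  apply Finset.prod_le_prod (fun _ _ => (Real.exp_pos _).le)
  intro j hj
  rw [Finset.mem_Icc] at hj
  have hq := q_pos_lt hσ hj.1
  rw [norm_pow]
  refine le_trans (le_of_eq ?_) (pow_le_pow_left₀ (Real.exp_pos _).le (wf_lower hq.1 hq.2 (j * θ)) _)
  rw [← Real.exp_nat_mul]; ring_nf

lemma phi_arg (a : ℕ → ℕ) (N n : ℕ) {σ : ℝ} (hσ : 0 < σ) (θ : ℝ) :
    |(∑ j ∈ Finset.Icc 1 N, a j * af (Real.exp (-(j * σ))) (j * θ)) - n * θ| ≤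
      |θ| ^ 3 * (∑ j ∈ Finset.Icc 1 N,
        a j * Real.exp (-(j * σ)) * j ^ 3 / (1 - Real.exp (-(j * σ))) ^ 3)
      + |Mfun a N σ - n| * |θ| := by
  have e : (∑ j ∈ Finset.Icc 1 N, a j * af (Real.exp (-(j * σ))) (j * θ)) - n * θ =
      (∑ j ∈ Finset.Icc 1 N, a j * (af (Real.exp (-(j * σ))) (j * θ) -
        Real.exp (-(j * σ)) * (j * θ) / (1 - Real.exp (-(j * σ))))) + (Mfun a N σ - n) * θ := by
    rw [Mfun, sub_mul, Finset.sum_mul, ← add_sub_assoc, ← Finset.sum_add_distrib]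
    congr 1
    apply Finset.sum_congr rfl
    intro j _
    ring
  rw [e]
  refine (abs_add_le _ _).trans ?_
  rw [abs_mul]
  gcongr
  rw [Finset.mul_sum]
  refine (Finset.abs_sum_le_sum_abs _ _).trans ?_
  apply Finset.sum_le_sum
  intro j hj
  rw [Finset.mem_Icc] at hj
  have hq := q_pos_lt hσ hj.1
  rw [abs_mul, Nat.abs_cast]
  refine (mul_le_mul_of_nonneg_left (af_bound hq.1 hq.2 _) (Nat.cast_nonneg _)).trans (le_of_eq ?_)
  rw [abs_mul, Nat.abs_cast]
  ring

lemma prod_range_Icc (f : ℕ → ℂ) (N : ℕ) :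
    ∏ j ∈ Finset.range N, f (j + 1) = ∏ j ∈ Finset.Icc 1 N, f j := by
  induction N with
  | zero => simp
  | succ N ih => rw [Finset.prod_range_succ, Finset.prod_Icc_succ_top (by omega), ih]

lemma phi_fourier (a : ℕ → ℕ) (ha : ∀ j, 1 ≤ j → 1 ≤ a j) (N : ℕ) {σ : ℝ} (hσ : 0 < σ) :
    ∃ F0 : ℝ, 0 < F0 ∧ ∀ k ≤ N,
      ∫ θ in (-Real.pi)..Real.pi, Phi a N σ θ * Complex.exp (-(k * θ) * Complex.I) =
        ((F0 * ((multisetCount a k : ℝ) * Real.exp (-(k * σ))) : ℝ) : ℂ) := by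
  let F1 : ℝ := ∏ j ∈ Finset.Icc 1 N, (1 - Real.exp (-(j * σ))) ^ a j
  have hF1 : 0 < F1 := by
    apply Finset.prod_pos
    intro j hj
    rw [Finset.mem_Icc] at hj
    have hq := q_pos_lt hσ hj.1
    exact pow_pos (by linarith) _
  refine ⟨F1 * (2 * Real.pi), by positivity, ?_⟩
  intro k hk
  have hρ1 : Real.exp (-σ) < 1 := by rw [Real.exp_lt_one_iff]; linarith
  have hz : ∀ θ : ℝ, ‖(Real.exp (-σ) : ℂ) * Complex.exp (θ * Complex.I)‖ < 1 := by
    intro θ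
    rw [norm_mul, Complex.norm_exp_ofReal_mul_I, mul_one, Complex.norm_real, Real.norm_eq_abs,
      abs_of_pos (Real.exp_pos _)]
    exact hρ1
  have hz0 : ‖(Real.exp (-σ) : ℂ)‖ < 1 := by simpa using hz 0
  have key := fourier_coeff
    (fun k => PowerSeries.coeff k (∏ j ∈ Finset.range N, Gser (a (j + 1)) (j + 1)))
    (Real.exp (-σ)) _ (prod_hasSum a ha N _ hz0).1 (fun θ => (prod_hasSum a ha N _ (hz θ)).2) k
  rw [coeff_prod_eq a k N hk] at key
  have e : ∀ θ : ℝ, Phi a N σ θ = F1 * ∏ j ∈ Finset.range N,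
      1 / (1 - ((Real.exp (-σ) : ℂ) * Complex.exp (θ * Complex.I)) ^ (j + 1)) ^ a (j + 1) := by
    intro θ
    rw [prod_range_Icc (fun j => 1 / (1 - ((Real.exp (-σ) : ℂ) * Complex.exp (θ * Complex.I)) ^ j) ^ a j)]
    simp only [F1, Phi]
    push_cast
    rw [← Finset.prod_mul_distrib]
    apply Finset.prod_congr rfl
    intro j _
    rw [wf, mul_pow, ← Complex.exp_nat_mul, ← Complex.exp_nat_mul, div_pow]
    push_cast
    ring_nf
  simp only [e, mul_assoc]
  rw [intervalIntegral.integral_const_mul, key, ← Real.exp_nat_mul]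
  push_cast
  ring_nf

lemma phi_continuous (a : ℕ → ℕ) (N : ℕ) {σ : ℝ} (hσ : 0 < σ) : Continuous (Phi a N σ) := by
  unfold Phi
  apply continuous_finsetProd
  intro j hj
  rw [Finset.mem_Icc] at hj
  have hq := q_pos_lt hσ hj.1
  apply Continuous.pow
  unfold wf
  apply Continuous.div (by fun_prop) (by fun_prop)
  intro θ
  exact one_sub_ne hq.1 hq.2 _

lemma core_lower (g : ℝ → ℝ) (hg : Continuous g) {w E κ : ℝ} (hw : 0 ≤ w) (hwpi : w ≤ Real.pi)
    (hE0 : 0 ≤ E)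
    (h1 : ∀ θ, |θ| ≤ w → κ ≤ g θ) (h2 : ∀ θ, |θ| ≤ Real.pi → -E ≤ g θ) :
    2 * w * κ - 2 * Real.pi * E ≤ ∫ θ in (-Real.pi)..Real.pi, g θ := by
  have hi : ∀ x y, IntervalIntegrable g MeasureTheory.volume x y := fun x y => hg.intervalIntegrable x y
  rw [← intervalIntegral.integral_add_adjacent_intervals (hi (-Real.pi) (-w)) (hi (-w) Real.pi),
    ← intervalIntegral.integral_add_adjacent_intervals (hi (-w) w) (hi w Real.pi)]
  have b1 : ∫ _θ in (-Real.pi)..(-w), (-E) ≤ ∫ θ in (-Real.pi)..(-w), g θ := by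
    apply intervalIntegral.integral_mono_on (by linarith) (by simp) (hi _ _)
    intro x hx
    exact h2 x (abs_le.2 ⟨hx.1, by linarith [hx.2]⟩)
  have b2 : ∫ _θ in (-w)..w, κ ≤ ∫ θ in (-w)..w, g θ := by
    apply intervalIntegral.integral_mono_on (by linarith) (by simp) (hi _ _)
    intro x hx
    exact h1 x (abs_le.2 ⟨hx.1, hx.2⟩)
  have b3 : ∫ _θ in w..Real.pi, (-E) ≤ ∫ θ in w..Real.pi, g θ := by
    apply intervalIntegral.integral_mono_on (by linarith) (by simp) (hi _ _)
    intro x hx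
    exact h2 x (abs_le.2 ⟨by linarith [hx.1], hx.2⟩)
  simp only [intervalIntegral.integral_const, smul_eq_mul] at b1 b2 b3
  nlinarith

lemma core_upper (g : ℝ → ℂ) (hg : Continuous g) {T E : ℝ} (hT : 0 ≤ T) (hTpi : T ≤ Real.pi)
    (hE0 : 0 ≤ E)
    (h1 : ∀ θ, |θ| ≤ T → ‖g θ‖ ≤ T) (h2 : ∀ θ, T ≤ |θ| → |θ| ≤ Real.pi → ‖g θ‖ ≤ E) :
    ‖∫ θ in (-Real.pi)..Real.pi, g θ‖ ≤ 2 * T ^ 2 + 2 * Real.pi * E := by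
  have hi : ∀ x y, IntervalIntegrable g MeasureTheory.volume x y := fun x y => hg.intervalIntegrable x y
  rw [← intervalIntegral.integral_add_adjacent_intervals (hi (-Real.pi) (-T)) (hi (-T) Real.pi),
    ← intervalIntegral.integral_add_adjacent_intervals (hi (-T) T) (hi T Real.pi)]
  have b1 : ‖∫ θ in (-Real.pi)..(-T), g θ‖ ≤ E * |-T - -Real.pi| := by
    apply intervalIntegral.norm_integral_le_of_norm_le_const
    intro x hx
    rw [Set.uIoc_of_le (by linarith)] at hx
    exact h2 x (by rw [le_abs]; right; linarith [hx.2]) (abs_le.2 ⟨hx.1.le, by linarith [hx.2]⟩)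
  have b2 : ‖∫ θ in (-T)..T, g θ‖ ≤ T * |T - -T| := by
    apply intervalIntegral.norm_integral_le_of_norm_le_const
    intro x hx
    rw [Set.uIoc_of_le (by linarith)] at hx
    exact h1 x (abs_le.2 ⟨hx.1.le, hx.2⟩)
  have b3 : ‖∫ θ in T..Real.pi, g θ‖ ≤ E * |Real.pi - T| := by
    apply intervalIntegral.norm_integral_le_of_norm_le_const
    intro x hx
    rw [Set.uIoc_of_le (by linarith)] at hx
    exact h2 x (by rw [le_abs]; left; linarith [hx.1]) (abs_le.2 ⟨by linarith [hx.1], hx.2⟩)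
  rw [abs_of_nonneg (by linarith)] at b1 b2 b3
  refine (norm_add_le _ _).trans ((add_le_add_right (norm_add_le _ _) _).trans ?_)
  nlinarith

/-- Core estimate: smallness of `c_{n+1} e^{-σ}/c_n - 1`. -/
lemma core_ratio (a : ℕ → ℕ) (ha : ∀ j, 1 ≤ j → 1 ≤ a j) (n : ℕ) {σ : ℝ} (hσ : 0 < σ)
    {w T E κ : ℝ} (hw : 0 ≤ w) (hwT : w ≤ T) (hTpi : T ≤ Real.pi) (hE0 : 0 ≤ E)
    (hE : ∀ θ, T ≤ |θ| → |θ| ≤ Real.pi → ‖Phi a (n + 1) σ θ‖ ≤ E)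
    (harg : ∀ θ, |θ| ≤ T →
      |(∑ j ∈ Finset.Icc 1 (n + 1), a j * af (Real.exp (-(j * σ))) (j * θ)) - n * θ| ≤ 1)
    (hκ : ∀ θ, |θ| ≤ w → 2 * κ ≤ ‖Phi a (n + 1) σ θ‖)
    (hpos : 0 < 2 * w * κ - 2 * Real.pi * E) :
    0 < (multisetCount a n : ℝ) ∧
    |(multisetCount a (n + 1) : ℝ) * Real.exp (-σ) / multisetCount a n - 1| ≤
      (2 * T ^ 2 + 2 * Real.pi * (2 * E)) / (2 * w * κ - 2 * Real.pi * E) := by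
  obtain ⟨F0, hF0, hF⟩ := phi_fourier a ha (n + 1) hσ
  have hc := phi_continuous a (n + 1) hσ
  have hT0 : 0 ≤ T := hw.trans hwT
  have k1 := hF n (by omega)
  have k2 := hF (n + 1) le_rfl
  set Φ := Phi a (n + 1) σ with hΦ
  have hΦ1 : ∀ θ, ‖Φ θ‖ ≤ 1 := by
    intro θ
    refine (phi_norm_le a (n + 1) hσ θ).trans ?_
    rw [Real.exp_le_one_iff, neg_nonpos]
    apply mul_nonneg (by norm_num)
    apply Finset.sum_nonneg
    intro j _
    exact mul_nonneg (by positivity) (by linarith [Real.cos_le_one (j * θ)])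
  have hnexp : ∀ (m : ℝ) (θ : ℝ), ‖Complex.exp (-(m * θ) * Complex.I)‖ = 1 := by
    intro m θ
    rw [show (-(m * θ) * Complex.I : ℂ) = ((-(m * θ) : ℝ) : ℂ) * Complex.I by push_cast; ring,
      Complex.norm_exp_ofReal_mul_I]
  have hnexp' : ∀ (θ : ℝ), ‖Complex.exp (-(n * θ) * Complex.I)‖ = 1 := by
    intro θ; exact_mod_cast hnexp n θ
  -- real part
  have hre : ∀ θ, |θ| ≤ T → 1 / 2 * ‖Φ θ‖ ≤ (Φ θ * Complex.exp (-(n * θ) * Complex.I)).re := by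
    intro θ hθ
    rw [hΦ, phi_polar a (n + 1) hσ θ, mul_assoc, ← Complex.exp_add, ← hΦ]
    rw [show ((∑ j ∈ Finset.Icc 1 (n + 1), a j * af (Real.exp (-(j * σ))) (j * θ) : ℝ) * Complex.I +
      -(n * θ) * Complex.I : ℂ) = (((∑ j ∈ Finset.Icc 1 (n + 1), a j * af (Real.exp (-(j * σ))) (j * θ))
        - n * θ : ℝ) : ℂ) * Complex.I by push_cast; ring]
    rw [Complex.re_ofReal_mul, Complex.exp_ofReal_mul_I_re, norm_mul, Complex.norm_exp_ofReal_mul_I,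
      mul_one, Complex.norm_real, norm_norm, mul_comm]
    apply mul_le_mul_of_nonneg_left _ (norm_nonneg _)
    have h := harg θ hθ
    set α := (∑ j ∈ Finset.Icc 1 (n + 1), a j * af (Real.exp (-(j * σ))) (j * θ)) - n * θ
    have h2 := Real.one_sub_sq_div_two_le_cos (x := α)
    have h3 : α ^ 2 ≤ 1 := by rw [sq_le_one_iff_abs_le_one]; exact h
    linarith
  have hgc : Continuous fun θ : ℝ => Φ θ * Complex.exp (-(n * θ) * Complex.I) :=
    hc.mul (by fun_prop)
  have hgc1 : Continuous fun θ : ℝ => Φ θ * Complex.exp (-((n + 1 : ℕ) * θ) * Complex.I) :=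
    hc.mul (by fun_prop)
  have L := core_lower (fun θ => (Φ θ * Complex.exp (-(n * θ) * Complex.I)).re)
    (Complex.continuous_re.comp hgc) hw (hwT.trans hTpi) hE0 (κ := κ) (by
      intro θ hθ
      have := hre θ (hθ.trans hwT)
      have := hκ θ hθ
      linarith) (by
      intro θ hθ
      rcases le_total |θ| T with h | h
      · have := hre θ h
        have := norm_nonneg (Φ θ)
        linarith
      · have h1 := hE θ h hθ
        have h2 := Complex.abs_re_le_norm (Φ θ * Complex.exp (-(n * θ) * Complex.I))
        rw [norm_mul, hnexp', mul_one] at h2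
        have := neg_le_of_abs_le h2
        linarith)
  have U := core_upper (fun θ : ℝ => Φ θ * Complex.exp (-((n + 1 : ℕ) * θ) * Complex.I) -
      Φ θ * Complex.exp (-(n * θ) * Complex.I)) (hgc1.sub hgc) hT0 hTpi
      (E := 2 * E) (by linarith) (by
      intro θ hθ
      have e : Φ θ * Complex.exp (-((n + 1 : ℕ) * θ) * Complex.I) -
        Φ θ * Complex.exp (-(n * θ) * Complex.I) = Φ θ * Complex.exp (-(n * θ) * Complex.I) *
          (Complex.exp (Complex.I * ((-θ : ℝ) : ℂ)) - 1) := by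
        rw [mul_sub, mul_assoc, ← Complex.exp_add, mul_one]
        push_cast
        ring_nf
      rw [e, norm_mul, norm_mul, hnexp', mul_one]
      calc _ ≤ 1 * ‖-θ‖ := mul_le_mul (hΦ1 θ) (Real.norm_exp_I_mul_ofReal_sub_one_le) (norm_nonneg _) zero_le_one
        _ ≤ T := by simpa using hθ) (by
      intro θ h1 h2
      refine (norm_sub_le _ _).trans ?_
      have := hnexp (n + 1 : ℕ) θ
      push_cast at this ⊢
      rw [norm_mul, norm_mul, hnexp', this]
      have := hE θ h1 h2
      linarith)
  rw [intervalIntegral.integral_sub (hgc1.intervalIntegrable _ _)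
    (hgc.intervalIntegrable _ _), k1, k2, ← Complex.ofReal_sub, Complex.norm_real, Real.norm_eq_abs] at U
  have L2 : 2 * w * κ - 2 * Real.pi * E ≤ F0 * ((multisetCount a n : ℝ) * Real.exp (-(n * σ))) := by
    have : (∫ θ in (-Real.pi)..Real.pi, (Φ θ * Complex.exp (-(n * θ) * Complex.I)).re) =
        (∫ θ in (-Real.pi)..Real.pi, Φ θ * Complex.exp (-(n * θ) * Complex.I)).re := by
      have := Complex.reCLM.intervalIntegral_comp_comm (hgc.intervalIntegrable (μ := MeasureTheory.volume) (-Real.pi) Real.pi)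
      exact this
    rw [this, k1, Complex.ofReal_re] at L
    exact L
  have hcn : 0 < (multisetCount a n : ℝ) := by
    by_contra h
    have : (multisetCount a n : ℝ) = 0 := le_antisymm (not_lt.1 h) (Nat.cast_nonneg _)
    rw [this] at L2
    simp at L2
    linarith
  refine ⟨hcn, ?_⟩
  have hD : 0 < F0 * ((multisetCount a n : ℝ) * Real.exp (-(n * σ))) := lt_of_lt_of_le hpos L2
  have e : (multisetCount a (n + 1) : ℝ) * Real.exp (-σ) / multisetCount a n - 1 =
      (F0 * ((multisetCount a (n + 1) : ℝ) * Real.exp (-((n + 1 : ℕ) * σ))) -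
        F0 * ((multisetCount a n : ℝ) * Real.exp (-(n * σ)))) /
        (F0 * ((multisetCount a n : ℝ) * Real.exp (-(n * σ)))) := by
    rw [show (-((n + 1 : ℕ) * σ) : ℝ) = -(n * σ) + -σ by push_cast; ring, Real.exp_add]
    have := Real.exp_pos (-(n * σ))
    field_simp
  rw [e, abs_div, abs_of_pos hD]
  apply div_le_div₀ _ U hpos L2
  exact (abs_nonneg _).trans U

lemma rpow_exp_bound (s : ℝ) (hs : 0 < s) (u : ℝ) (hu : 0 ≤ u) :
    u ^ s ≤ s ^ s * Real.exp u := by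
  have h1 : u / s ≤ Real.exp (u / s) := by linarith [Real.add_one_le_exp (u / s)]
  have h2 : (u / s) ^ s ≤ Real.exp (u / s) ^ s := Real.rpow_le_rpow (by positivity) h1 hs.le
  rw [← Real.exp_mul, div_mul_cancel₀ _ hs.ne', Real.div_rpow hu hs.le] at h2
  have : 0 < s ^ s := Real.rpow_pos_of_pos hs s
  rwa [div_le_iff₀ this, mul_comm] at h2

lemma sum_rpow_bound (s : ℝ) (hs : 0 < s) : ∃ C : ℝ, 0 < C ∧ ∀ N : ℕ,
    ∑ j ∈ Finset.Icc 1 N, (j : ℝ) ^ (-1 - s) ≤ C := by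
  have h : Summable fun j : ℕ => (j : ℝ) ^ (-1 - s) := by
    rw [Real.summable_nat_rpow]; linarith
  refine ⟨(∑' j : ℕ, (j : ℝ) ^ (-1 - s)) + 1, ?_, ?_⟩
  · have : 0 ≤ ∑' j : ℕ, (j : ℝ) ^ (-1 - s) := tsum_nonneg fun j => by positivity
    linarith
  · intro N
    have := h.sum_le_tsum (Finset.Icc 1 N) (fun j _ => by positivity)
    linarith

lemma aq_eq {y : ℝ} (hy : 1 ≤ y) (δ : ℝ) (j : ℕ) :
    y ^ j * Real.exp (-(j * (δ + Real.log y))) = Real.exp (-(j * δ)) := by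
  have : y ^ j = Real.exp (j * Real.log y) := by
    rw [Real.exp_nat_mul, Real.exp_log (by linarith)]
  rw [this, ← Real.exp_add]
  ring_nf

lemma aq_upper {a : ℕ → ℕ} {γ r y : ℝ} (hy : 1 ≤ y)
    (h : ∀ j : ℕ, 1 ≤ j → (a j : ℝ) ≤ γ * (j : ℝ) ^ (r - 1) * y ^ j) (δ : ℝ) {j : ℕ} (hj : 1 ≤ j) :
    a j * Real.exp (-(j * (δ + Real.log y))) ≤ γ * (j : ℝ) ^ (r - 1) * Real.exp (-(j * δ)) := by
  rw [← aq_eq hy δ j, ← mul_assoc]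
  exact mul_le_mul_of_nonneg_right (h j hj) (Real.exp_pos _).le

lemma aq_lower {a : ℕ → ℕ} {γ r y : ℝ} (hy : 1 ≤ y)
    (h : ∀ j : ℕ, 1 ≤ j → γ * (j : ℝ) ^ (r - 1) * y ^ j ≤ (a j : ℝ)) (δ : ℝ) {j : ℕ} (hj : 1 ≤ j) :
    γ * (j : ℝ) ^ (r - 1) * Real.exp (-(j * δ)) ≤ a j * Real.exp (-(j * (δ + Real.log y))) := by
  rw [← aq_eq hy δ j, ← mul_assoc]
  exact mul_le_mul_of_nonneg_right (h j hj) (Real.exp_pos _).le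

lemma aq_lower' {a : ℕ → ℕ} {γ r y : ℝ} (hy : 1 ≤ y) (hγ : 0 < γ) (hr : 0 < r)
    (h : ∀ j : ℕ, 1 ≤ j → γ * (j : ℝ) ^ (r - 1) * y ^ j ≤ (a j : ℝ)) {δ D : ℝ} (hδ : 0 < δ)
    {j : ℕ} (hj : 1 ≤ j) (h1 : 1 ≤ j * δ) (hD : j * δ ≤ D) :
    γ * Real.exp (-(2 * D)) * δ ^ (1 - r) ≤ a j * Real.exp (-(j * (δ + Real.log y))) := by
  refine le_trans ?_ (aq_lower hy h δ hj)
  have hj0 : (0 : ℝ) < j := by exact_mod_cast hj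
  have e : (j : ℝ) ^ (r - 1) = (j * δ) ^ (r - 1) * δ ^ (1 - r) := by
    rw [Real.mul_rpow hj0.le hδ.le, mul_assoc, ← Real.rpow_add hδ]
    simp
  set u := j * δ with hu
  have hu0 : 0 < u := by linarith
  have h2 : Real.exp (-u) ≤ u ^ (r - 1) := by
    have : u ^ (-1 : ℝ) ≤ u ^ (r - 1) := Real.rpow_le_rpow_of_exponent_le h1 (by linarith)
    refine le_trans ?_ this
    rw [Real.rpow_neg_one, Real.exp_neg]
    apply inv_anti₀ hu0
    linarith [Real.add_one_le_exp u]
  rw [e]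
  have h3 : Real.exp (-(2 * D)) ≤ Real.exp (-u) * Real.exp (-u) := by
    rw [← Real.exp_add, Real.exp_le_exp]; linarith
  have h4 : Real.exp (-(2 * D)) ≤ u ^ (r - 1) * Real.exp (-u) :=
    h3.trans (mul_le_mul_of_nonneg_right h2 (Real.exp_pos _).le)
  calc _ = γ * δ ^ (1 - r) * Real.exp (-(2 * D)) := by ring
    _ ≤ γ * δ ^ (1 - r) * (u ^ (r - 1) * Real.exp (-u)) := by
        apply mul_le_mul_of_nonneg_left h4; positivity
    _ = _ := by ring

lemma one_sub_exp_ge {u : ℝ} (hu : 0 ≤ u) : u / (1 + u) ≤ 1 - Real.exp (-u) := by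
  have h1 := Real.add_one_le_exp u
  have h2 : Real.exp (-u) ≤ 1 / (1 + u) := by
    rw [Real.exp_neg, ← one_div]
    apply one_div_le_one_div_of_le (by linarith) (by linarith)
  have : u / (1 + u) = 1 - 1 / (1 + u) := by field_simp; ring
  linarith

lemma rho_bound {a : ℕ → ℕ} {γ r y η : ℝ} (hy : 1 ≤ y) (hγ : 0 < γ) (hr : 0 < r) (hη : 0 < η)
    (h : ∀ j : ℕ, 1 ≤ j → (a j : ℝ) ≤ γ * (j : ℝ) ^ (r - 1) * y ^ j) (k : ℕ) (hk : 1 ≤ k) :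
    ∃ C : ℝ, 0 < C ∧ ∀ (δ : ℝ) (N : ℕ), 0 < δ →
      ∑ j ∈ Finset.Icc 1 N, a j * Real.exp (-(j * (δ + Real.log y))) * j ^ k /
        (1 - Real.exp (-(j * (δ + Real.log y)))) ^ k ≤ C * δ ^ (-(r + η)) / δ ^ k := by
  obtain ⟨C1, hC1, hC⟩ := sum_rpow_bound η hη
  have hs : 0 < r + η := by linarith
  set s := r + η with hsd
  have hk0 : (0 : ℝ) < k := by exact_mod_cast hk
  refine ⟨γ * (2 * k) ^ k * (2 ^ s * s ^ s) * C1, by positivity, ?_⟩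
  intro δ N hδ
  have key : ∀ j ∈ Finset.Icc 1 N, a j * Real.exp (-(j * (δ + Real.log y))) * j ^ k /
        (1 - Real.exp (-(j * (δ + Real.log y)))) ^ k ≤
        γ * (2 * k) ^ k * (2 ^ s * s ^ s) * (δ ^ (-s) / δ ^ k) * (j : ℝ) ^ (-1 - η) := by
    intro j hj
    rw [Finset.mem_Icc] at hj
    have hj0 : (0 : ℝ) < j := by exact_mod_cast hj.1
    have hL : 0 ≤ Real.log y := Real.log_nonneg hy
    have h1 := aq_upper hy h δ hj.1
    set u := (j : ℝ) * δ with hu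
    have hu0 : 0 < u := by positivity
    have h2 : u / (1 + u) ≤ 1 - Real.exp (-(j * (δ + Real.log y))) := by
      refine (one_sub_exp_ge hu0.le).trans ?_
      have : Real.exp (-(j * (δ + Real.log y))) ≤ Real.exp (-u) := by
        rw [Real.exp_le_exp, hu]; nlinarith
      linarith
    have h2p : 0 < u / (1 + u) := by positivity
    have h3 : (j : ℝ) / (1 - Real.exp (-(j * (δ + Real.log y)))) ≤ (1 + u) / δ := by
      rw [div_le_iff₀ (by linarith)]
      have : (1 + u) / δ * (u / (1 + u)) = j := by rw [hu]; field_simp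
      calc (j : ℝ) = (1 + u) / δ * (u / (1 + u)) := this.symm
        _ ≤ _ := by gcongr
    have h4 : (1 + u) ^ k ≤ (2 * k) ^ k * Real.exp (u / 2) := by
      have : 1 + u ≤ 2 * k * Real.exp (u / (2 * k)) := by
        have h5 := Real.add_one_le_exp (u / (2 * k))
        have h6 : 2 * k * (u / (2 * k) + 1) ≤ 2 * k * Real.exp (u / (2 * k)) := by gcongr
        have h7 : 2 * k * (u / (2 * k) + 1) = u + 2 * k := by field_simp
        have : (1 : ℝ) ≤ k := by exact_mod_cast hk
        linarith
      calc _ ≤ (2 * k * Real.exp (u / (2 * k))) ^ k := by gcongr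
        _ = _ := by
          rw [mul_pow, ← Real.exp_nat_mul]
          congr 2
          field_simp
    have h5 : u ^ s ≤ 2 ^ s * s ^ s * Real.exp (u / 2) := by
      have := rpow_exp_bound s hs (u / 2) (by positivity)
      rw [Real.div_rpow hu0.le (by norm_num), div_le_iff₀ (by positivity)] at this
      linarith
    have h6 : (j : ℝ) ^ (r - 1) = (j : ℝ) ^ (-1 - η) * (δ ^ (-s) * u ^ s) := by
      rw [hu, Real.mul_rpow hj0.le hδ.le, Real.rpow_neg hδ.le]
      have : δ ^ s ≠ 0 := by positivity
      field_simp
      rw [← Real.rpow_add hj0]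
      congr 1
      rw [hsd]; ring
    have hden : 0 ≤ (j : ℝ) / (1 - Real.exp (-(j * (δ + Real.log y)))) :=
      div_nonneg hj0.le (by linarith)
    calc _ = (a j * Real.exp (-(j * (δ + Real.log y)))) *
          (j / (1 - Real.exp (-(j * (δ + Real.log y))))) ^ k := by rw [div_pow]; ring
      _ ≤ (γ * (j : ℝ) ^ (r - 1) * Real.exp (-u)) * ((1 + u) / δ) ^ k := by gcongr
      _ = γ * ((j : ℝ) ^ (-1 - η) * (δ ^ (-s) * u ^ s)) * Real.exp (-u) * ((1 + u) ^ k / δ ^ k) := by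
          rw [h6, div_pow]
      _ ≤ γ * ((j : ℝ) ^ (-1 - η) * (δ ^ (-s) * (2 ^ s * s ^ s * Real.exp (u / 2)))) * Real.exp (-u) *
          (((2 * k) ^ k * Real.exp (u / 2)) / δ ^ k) := by gcongr
      _ = γ * (2 * k) ^ k * (2 ^ s * s ^ s) * (δ ^ (-s) / δ ^ k) * (j : ℝ) ^ (-1 - η) *
          (Real.exp (u / 2) * Real.exp (u / 2) * Real.exp (-u)) := by ring
      _ = _ := by
          rw [← Real.exp_add, ← Real.exp_add]
          ring_nf
          simp
  refine (Finset.sum_le_sum key).trans ?_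
  rw [← Finset.mul_sum]
  calc _ ≤ γ * (2 * k) ^ k * (2 ^ s * s ^ s) * (δ ^ (-s) / δ ^ k) * C1 := by
        gcongr
        exact hC N
    _ = _ := by ring

lemma cos_sum_bound {J : ℕ} {θ : ℝ} (hθ : |θ| ≤ Real.pi) (hJ : 2 * Real.pi ≤ J * |θ|) :
    (J : ℝ) / 2 ≤ ∑ j ∈ Finset.Ioc J (2 * J), (1 - Real.cos (j * θ)) := by
  wlog h0 : 0 ≤ θ generalizing θ
  · have := this (θ := -θ) (by simpa using hθ) (by simpa using hJ) (by linarith)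
    simpa using this
  rw [abs_of_nonneg h0] at hθ hJ
  have hpi := Real.pi_pos
  have tel : ∀ m : ℕ, J ≤ m → 2 * Real.sin (θ / 2) * ∑ j ∈ Finset.Ioc J m, Real.cos (j * θ) =
      Real.sin ((m + 1 / 2) * θ) - Real.sin ((J + 1 / 2) * θ) := by
    intro m hm
    induction m, hm using Nat.le_induction with
    | base => simp
    | succ m hm ih =>
      rw [Finset.sum_Ioc_succ_top (by omega), mul_add, ih]
      have e1 : ((m + 1 : ℕ) + 1 / 2 : ℝ) * θ = (m + 1 : ℕ) * θ + θ / 2 := by push_cast; ring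
      have e2 : (m + 1 / 2 : ℝ) * θ = (m + 1 : ℕ) * θ - θ / 2 := by push_cast; ring
      rw [e1, e2, Real.sin_add, Real.sin_sub]
      ring
  have t := tel (2 * J) (by omega)
  have hs : θ / Real.pi ≤ Real.sin (θ / 2) := by
    have := Real.mul_le_sin (x := θ / 2) (by linarith) (by linarith)
    calc _ = 2 / Real.pi * (θ / 2) := by field_simp
      _ ≤ _ := this
  set S := ∑ j ∈ Finset.Ioc J (2 * J), Real.cos (j * θ) with hS
  have hS1 : Real.sin (θ / 2) * S ≤ 1 := by
    have := Real.sin_le_one (((2 * J : ℕ) + 1 / 2) * θ)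
    have := Real.neg_one_le_sin ((J + 1 / 2) * θ)
    linarith
  have hS2 : S ≤ J / 2 := by
    by_contra hcon
    push Not at hcon
    have hJ0 : (0 : ℝ) ≤ J := Nat.cast_nonneg _
    have hSp : 0 < S := by linarith
    have : θ / Real.pi * S ≤ 1 := (mul_le_mul_of_nonneg_right hs hSp.le).trans hS1
    have hθp : 0 < θ := by
      rcases h0.eq_or_lt with h | h
      · rw [← h] at hJ; simp at hJ; linarith
      · exact h
    have h3 : θ / Real.pi * (J / 2) < 1 := lt_of_lt_of_le (by gcongr) this
    have h4 : θ / Real.pi * (J / 2) = (J * θ) / (2 * Real.pi) := by field_simp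
    rw [h4, div_lt_one (by positivity)] at h3
    linarith
  rw [Finset.sum_sub_distrib, ← hS]
  simp
  rw [show 2 * J - J = J by omega]
  linarith

lemma ceil_facts {A δ : ℝ} (hδ : 0 < δ) (hδ1 : δ ≤ 1) (hA : 1 ≤ A) :
    1 ≤ ⌈A / δ⌉₊ ∧ A ≤ (⌈A / δ⌉₊ : ℝ) * δ ∧ (⌈A / δ⌉₊ : ℝ) * δ ≤ A + 1 := by
  have h1 := Nat.le_ceil (A / δ)
  have h2 := Nat.ceil_lt_add_one (a := A / δ) (by positivity)
  have e : A / δ * δ = A := by field_simp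
  refine ⟨Nat.ceil_pos.2 (by positivity), ?_, ?_⟩
  · calc A = A / δ * δ := e.symm
      _ ≤ _ := by gcongr
  · calc _ ≤ (A / δ + 1) * δ := by gcongr
      _ = A + δ := by rw [add_mul, e]; ring
      _ ≤ _ := by linarith

/-- lower bound for weighted sums over a dyadic block -/
lemma block_lower {a : ℕ → ℕ} {γ r y : ℝ} (hy : 1 ≤ y) (hγ : 0 < γ) (hr : 0 < r)
    (h : ∀ j : ℕ, 1 ≤ j → γ * (j : ℝ) ^ (r - 1) * y ^ j ≤ (a j : ℝ)) {δ A : ℝ} (hδ : 0 < δ)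
    (hδ1 : δ ≤ 1) (hA : 1 ≤ A) (N : ℕ) (hN : 2 * A + 2 ≤ N * δ) (f : ℕ → ℝ) (hf : ∀ j, 0 ≤ f j) :
    γ * Real.exp (-(2 * (2 * A + 2))) * δ ^ (1 - r) * ∑ j ∈ Finset.Ioc ⌈A / δ⌉₊ (2 * ⌈A / δ⌉₊), f j ≤
      ∑ j ∈ Finset.Icc 1 N, a j * Real.exp (-(j * (δ + Real.log y))) * f j := by
  obtain ⟨h1, h2, h3⟩ := ceil_facts hδ hδ1 hA
  set J := ⌈A / δ⌉₊
  have hsub : Finset.Ioc J (2 * J) ⊆ Finset.Icc 1 N := by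
    intro j hj
    rw [Finset.mem_Ioc] at hj
    rw [Finset.mem_Icc]
    refine ⟨by omega, ?_⟩
    have : (2 * J : ℝ) ≤ N := by
      by_contra hc
      push Not at hc
      have := mul_lt_mul_of_pos_right hc hδ
      linarith
    have : 2 * J ≤ N := by exact_mod_cast this
    omega
  refine le_trans ?_ (Finset.sum_le_sum_of_subset_of_nonneg hsub fun j _ _ =>
    mul_nonneg (by positivity) (hf j))
  rw [Finset.mul_sum]
  apply Finset.sum_le_sum
  intro j hj
  rw [Finset.mem_Ioc] at hj
  apply mul_le_mul_of_nonneg_right _ (hf j)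
  have hJj : (J : ℝ) ≤ j := by exact_mod_cast hj.1.le
  have hj2 : (j : ℝ) ≤ 2 * J := by exact_mod_cast hj.2
  apply aq_lower' hy hγ hr h hδ (by omega)
  · have := mul_le_mul_of_nonneg_right hJj hδ.le
    linarith
  · have := mul_le_mul_of_nonneg_right hj2 hδ.le
    linarith

lemma Mfun_lower (a : ℕ → ℕ) (n : ℕ) {σ : ℝ} (hσ : 0 < σ) :
    ∑ j ∈ Finset.Icc 1 n, a j * Real.exp (-(j * σ)) * (j : ℝ) ≤ Mfun a n σ := by
  apply Finset.sum_le_sum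
  intro j hj
  rw [Finset.mem_Icc] at hj
  obtain ⟨h1, h2⟩ := q_pos_lt hσ hj.1
  rw [le_div_iff₀ (by linarith)]
  have : 0 ≤ a j * Real.exp (-(j * σ)) * (j : ℝ) := by positivity
  nlinarith

lemma n_lower {a : ℕ → ℕ} {γ r y : ℝ} (hy : 1 ≤ y) (hγ : 0 < γ) (hr : 0 < r)
    (h : ∀ j : ℕ, 1 ≤ j → γ * (j : ℝ) ^ (r - 1) * y ^ j ≤ (a j : ℝ)) {δ : ℝ} (hδ : 0 < δ)
    (hδ1 : δ ≤ 1) (n : ℕ) (hN : 4 ≤ n * δ) (hM : Mfun a n (δ + Real.log y) = n) :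
    γ * Real.exp (-8) * δ ^ (-r) ≤ n * δ := by
  have hσ : 0 < δ + Real.log y := by linarith [Real.log_nonneg hy]
  have h1 := block_lower hy hγ hr h hδ hδ1 le_rfl n (by linarith) (fun j => (j : ℝ)) (fun j => Nat.cast_nonneg j)
  have h2 := Mfun_lower a n hσ
  obtain ⟨c1, c2, c3⟩ := ceil_facts hδ hδ1 (le_refl (1 : ℝ))
  set J := ⌈1 / δ⌉₊
  have h3 : (J : ℝ) * J ≤ ∑ j ∈ Finset.Ioc J (2 * J), (j : ℝ) := by
    have : ∑ j ∈ Finset.Ioc J (2 * J), (J : ℝ) ≤ ∑ j ∈ Finset.Ioc J (2 * J), (j : ℝ) := by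
      apply Finset.sum_le_sum
      intro j hj
      rw [Finset.mem_Ioc] at hj
      exact_mod_cast hj.1.le
    refine le_trans (le_of_eq ?_) this
    simp
    left
    rw [show 2 * J - J = J by omega]
  have h4 : 1 ≤ (J : ℝ) * J * δ * δ := by
    have : (1 : ℝ) * 1 ≤ (J * δ) * (J * δ) := mul_le_mul c2 c2 (by norm_num) (by linarith)
    linarith
  have e : δ ^ (1 - r) = δ * δ ^ (-r) := by
    rw [sub_eq_add_neg, Real.rpow_add hδ, Real.rpow_one]
  have hp : 0 < γ * Real.exp (-8) * δ ^ (-r) := by positivity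
  calc γ * Real.exp (-8) * δ ^ (-r) ≤ γ * Real.exp (-8) * δ ^ (-r) * ((J : ℝ) * J * δ * δ) := by
        nlinarith
    _ = γ * Real.exp (-(2 * (2 * 1 + 2))) * δ ^ (1 - r) * (J * J) * δ := by
        rw [e]; norm_num; ring
    _ ≤ γ * Real.exp (-(2 * (2 * 1 + 2))) * δ ^ (1 - r) * (∑ j ∈ Finset.Ioc J (2 * J), (j : ℝ)) * δ := by
        gcongr
    _ ≤ n * δ := by
        apply mul_le_mul_of_nonneg_right _ hδ.le
        linarith

lemma n_delta_large {a : ℕ → ℕ} {γ r y : ℝ} (hy : 1 ≤ y) (hγ : 0 < γ) (hr : 0 < r)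
    (h : ∀ j : ℕ, 1 ≤ j → γ * (j : ℝ) ^ (r - 1) * y ^ j ≤ (a j : ℝ))
    (σ : ℕ → ℝ) (hσ : ∀ n : ℕ, 1 ≤ n → 0 < σ n ∧ Mfun a n (σ n) = n) (K : ℝ) (hK : 0 ≤ K) :
    ∀ᶠ n : ℕ in atTop, K < n * (σ n - Real.log y) := by
  have ht : Tendsto (fun n : ℕ => ((n : ℝ) / 2) ^ r) atTop atTop := by
    apply (tendsto_rpow_atTop hr).comp
    apply Filter.Tendsto.atTop_div_const (by norm_num) tendsto_natCast_atTop_atTop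
  filter_upwards [ht.eventually_gt_atTop (2 * Real.exp K / γ), eventually_ge_atTop 1] with n hn hn1
  by_contra hcon
  push Not at hcon
  obtain ⟨hs, hM⟩ := hσ n hn1
  set δ := σ n - Real.log y with hδ
  have hσe : σ n = δ + Real.log y := by rw [hδ]; ring
  have h1 := Mfun_lower a n hs
  rw [hM] at h1
  have hn0 : (0 : ℝ) < n := by exact_mod_cast hn1
  have hsub : Finset.Ioc (n / 2) n ⊆ Finset.Icc 1 n := by
    intro j; rw [Finset.mem_Ioc, Finset.mem_Icc]; omega
  have h2 : ∑ j ∈ Finset.Ioc (n / 2) n, γ * Real.exp (-K) * ((n : ℝ) / 2) ^ r ≤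
      ∑ j ∈ Finset.Icc 1 n, a j * Real.exp (-(j * σ n)) * (j : ℝ) := by
    refine le_trans ?_ (Finset.sum_le_sum_of_subset_of_nonneg hsub fun j _ _ => by positivity)
    apply Finset.sum_le_sum
    intro j hj
    rw [Finset.mem_Ioc] at hj
    have hj1 : 1 ≤ j := by omega
    have hj0 : (0 : ℝ) < j := by exact_mod_cast hj1
    have hjn : (n : ℝ) / 2 ≤ j := by
      have : n ≤ 2 * j := by omega
      have : (n : ℝ) ≤ 2 * j := by exact_mod_cast this
      linarith
    have hjn2 : (j : ℝ) ≤ n := by exact_mod_cast hj.2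
    have := aq_lower hy h δ hj1
    rw [← hσe] at this
    have e : (j : ℝ) ^ (r - 1) * j = (j : ℝ) ^ r := by
      rw [← Real.rpow_add_one hj0.ne']; ring_nf
    have hjd : j * δ ≤ K := by
      rcases le_total δ 0 with hd | hd
      · have : j * δ ≤ 0 := mul_nonpos_of_nonneg_of_nonpos hj0.le hd
        linarith
      · exact (mul_le_mul_of_nonneg_right hjn2 hd).trans hcon
    calc _ ≤ γ * Real.exp (-(j * δ)) * (j : ℝ) ^ r := by gcongr
      _ = γ * (j : ℝ) ^ (r - 1) * Real.exp (-(j * δ)) * j := by rw [← e]; ring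
      _ ≤ _ := by gcongr
  rw [Finset.sum_const, nsmul_eq_mul, Nat.card_Ioc] at h2
  have h3 : (n : ℝ) / 2 ≤ ((n - n / 2 : ℕ) : ℝ) := by
    have : n ≤ 2 * (n - n / 2) := by omega
    have : (n : ℝ) ≤ 2 * ((n - n / 2 : ℕ) : ℝ) := by exact_mod_cast this
    linarith
  have h4 : (n : ℝ) / 2 * (γ * Real.exp (-K) * ((n : ℝ) / 2) ^ r) ≤ n := by
    refine (mul_le_mul_of_nonneg_right h3 (by positivity)).trans (h2.trans h1)
  have h5 : 2 < γ * Real.exp (-K) * ((n : ℝ) / 2) ^ r := by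
    rw [div_lt_iff₀ hγ] at hn
    have : Real.exp (-K) * Real.exp K = 1 := by rw [← Real.exp_add]; simp
    calc 2 = Real.exp (-K) * (2 * Real.exp K) := by linear_combination (-2 : ℝ) * this
      _ < Real.exp (-K) * (((n : ℝ) / 2) ^ r * γ) := by gcongr
      _ = _ := by ring
  nlinarith

lemma delta_tendsto {a : ℕ → ℕ} {γ γ' r r' y : ℝ} (hy : 1 ≤ y) (hγ : 0 < γ) (hr : 0 < r)
    (h : ∀ j : ℕ, 1 ≤ j → γ * (j : ℝ) ^ (r - 1) * y ^ j ≤ (a j : ℝ)) (hγ' : 0 < γ') (hr' : 0 < r')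
    (h' : ∀ j : ℕ, 1 ≤ j → (a j : ℝ) ≤ γ' * (j : ℝ) ^ (r' - 1) * y ^ j)
    (σ : ℕ → ℝ) (hσ : ∀ n : ℕ, 1 ≤ n → 0 < σ n ∧ Mfun a n (σ n) = n) :
    Tendsto (fun n : ℕ => σ n - Real.log y) atTop (nhdsWithin 0 (Set.Ioi 0)) := by
  have hpos : ∀ᶠ n : ℕ in atTop, 0 < σ n - Real.log y := by
    filter_upwards [n_delta_large hy hγ hr h σ hσ 0 le_rfl, eventually_ge_atTop 1] with n hn h1
    have hn0 : (0 : ℝ) < n := by exact_mod_cast h1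
    exact pos_of_mul_pos_right hn hn0.le
  obtain ⟨C, hC, hb⟩ := rho_bound (η := 1) hy hγ' hr' one_pos h' 1 le_rfl
  rw [tendsto_nhdsWithin_iff]
  refine ⟨?_, hpos⟩
  rw [Metric.tendsto_atTop']
  intro e he
  have ht : ∀ᶠ n : ℕ in atTop, C * e ^ (-(r' + 1)) / e ^ 1 < n :=
    tendsto_natCast_atTop_atTop.eventually_gt_atTop _
  have : ∀ᶠ n : ℕ in atTop, dist (σ n - Real.log y) 0 < e := by
    filter_upwards [ht, hpos, eventually_ge_atTop 1] with n h1 h2 h3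
    rw [Real.dist_eq, sub_zero, abs_of_pos h2]
    by_contra hcon
    push Not at hcon
    obtain ⟨_, hM⟩ := hσ n h3
    set δ := σ n - Real.log y with hδ
    have hσe : σ n = δ + Real.log y := by rw [hδ]; ring
    have hb' := hb δ n h2
    have hMe : Mfun a n (σ n) = ∑ j ∈ Finset.Icc 1 n, a j * Real.exp (-(j * (δ + Real.log y))) * (j : ℝ) ^ 1 /
        (1 - Real.exp (-(j * (δ + Real.log y)))) ^ 1 := by
      rw [hσe, Mfun]
      apply Finset.sum_congr rfl
      intro j _
      ring
    rw [← hMe, hM] at hb'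
    have : C * δ ^ (-(r' + 1)) / δ ^ 1 ≤ C * e ^ (-(r' + 1)) / e ^ 1 := by
      have : δ ^ (-(r' + 1)) ≤ e ^ (-(r' + 1)) :=
        Real.rpow_le_rpow_of_nonpos he hcon (by linarith)
      gcongr
    linarith
  obtain ⟨N, hN⟩ := eventually_atTop.1 this
  exact ⟨N, fun n hn => hN n hn.le⟩

lemma phi_decay {a : ℕ → ℕ} {γ r y : ℝ} (hy : 1 ≤ y) (hγ : 0 < γ) (hr : 0 < r)
    (h : ∀ j : ℕ, 1 ≤ j → γ * (j : ℝ) ^ (r - 1) * y ^ j ≤ (a j : ℝ)) {δ : ℝ} (hδ : 0 < δ)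
    (hδ1 : δ ≤ 1) (N : ℕ) (hN : 30 ≤ N * δ) {η : ℝ} (hη : 2 * η ≤ r) (θ : ℝ)
    (hθ1 : δ ^ (1 + r / 2 - η) ≤ |θ|) (hθ2 : |θ| ≤ Real.pi) :
    ‖Phi a N (δ + Real.log y) θ‖ ≤ Real.exp (-(γ * Real.exp (-60) / 40 * δ ^ (-(2 * η)))) := by
  have hσ : 0 < δ + Real.log y := by linarith [Real.log_nonneg hy]
  refine (phi_norm_le a N hσ θ).trans ?_
  rw [Real.exp_le_exp, neg_le_neg_iff]
  have hcos : ∀ j : ℕ, 0 ≤ 1 - Real.cos (j * θ) := fun j => by linarith [Real.cos_le_one (j * θ)]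
  have e : δ ^ (1 - r) = δ * δ ^ (-r) := by
    rw [sub_eq_add_neg, Real.rpow_add hδ, Real.rpow_one]
  have hpi := Real.pi_gt_three
  have hpi' := Real.pi_lt_d2
  rcases le_total |θ| (δ / 2) with hz | hz
  · have h1 := block_lower hy hγ hr h hδ hδ1 le_rfl N (by linarith) _ hcos
    obtain ⟨c1, c2, c3⟩ := ceil_facts hδ hδ1 (le_refl (1 : ℝ))
    set J := ⌈1 / δ⌉₊
    have h3 : (J : ℝ) * (J ^ 2 * θ ^ 2 / 8) ≤ ∑ j ∈ Finset.Ioc J (2 * J), (1 - Real.cos (j * θ)) := by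
      have : ∑ j ∈ Finset.Ioc J (2 * J), ((J : ℝ) ^ 2 * θ ^ 2 / 8) ≤
          ∑ j ∈ Finset.Ioc J (2 * J), (1 - Real.cos (j * θ)) := by
        apply Finset.sum_le_sum
        intro j hj
        rw [Finset.mem_Ioc] at hj
        have hJj : (J : ℝ) ≤ j := by exact_mod_cast hj.1.le
        have hj2 : (j : ℝ) ≤ 2 * J := by exact_mod_cast hj.2
        have hb : |j * θ| ≤ Real.pi := by
          rw [abs_mul, Nat.abs_cast]
          calc (j : ℝ) * |θ| ≤ (2 * J) * (δ / 2) := by gcongr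
            _ = J * δ := by ring
            _ ≤ _ := by linarith
        have hq := Real.cos_le_one_sub_mul_cos_sq hb
        have : (1 : ℝ) / 8 ≤ 2 / Real.pi ^ 2 := by
          rw [div_le_div_iff₀ (by norm_num) (by positivity)]
          nlinarith
        calc (J : ℝ) ^ 2 * θ ^ 2 / 8 ≤ (j : ℝ) ^ 2 * θ ^ 2 / 8 := by gcongr
          _ = 1 / 8 * (j * θ) ^ 2 := by ring
          _ ≤ 2 / Real.pi ^ 2 * (j * θ) ^ 2 := by gcongr
          _ ≤ _ := by linarith
      refine le_trans (le_of_eq ?_) this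
      simp
      left
      rw [show 2 * J - J = J by omega]
    have h4 : 1 ≤ ((J : ℝ) * δ) ^ 3 := one_le_pow₀ c2
    have h5 : δ ^ (-(2 * η)) * (δ ^ 2 * δ ^ r) ≤ θ ^ 2 := by
      rw [← sq_abs θ]
      calc _ = (δ ^ (1 + r / 2 - η)) ^ 2 := by
            rw [← Real.rpow_natCast δ 2, ← Real.rpow_add hδ, ← Real.rpow_add hδ, ← Real.rpow_natCast _ 2,
              ← Real.rpow_mul hδ.le]
            congr 1; push_cast; ring
        _ ≤ _ := by gcongr
    have h6 : δ ^ (-(2 * η)) ≤ δ ^ (1 - r) * ((J : ℝ) * (J ^ 2 * θ ^ 2)) := by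
      have hrr : δ ^ (-r) * δ ^ r = 1 := by rw [← Real.rpow_add hδ]; simp
      calc δ ^ (-(2 * η)) = δ ^ (-(2 * η)) * (δ ^ (-r) * δ ^ r) * 1 := by rw [hrr]; ring
        _ ≤ δ ^ (-(2 * η)) * (δ ^ (-r) * δ ^ r) * ((J : ℝ) * δ) ^ 3 := by gcongr
        _ = δ * δ ^ (-r) * (J * J ^ 2) * (δ ^ (-(2 * η)) * (δ ^ 2 * δ ^ r)) := by ring
        _ ≤ δ * δ ^ (-r) * (J * J ^ 2) * θ ^ 2 := by gcongr
        _ = _ := by rw [e]; ring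
    have h7 : Real.exp (-60) ≤ Real.exp (-(2 * (2 * 1 + 2))) := by
      rw [Real.exp_le_exp]; norm_num
    calc γ * Real.exp (-60) / 40 * δ ^ (-(2 * η)) ≤
        γ * Real.exp (-(2 * (2 * 1 + 2))) / 40 * (δ ^ (1 - r) * ((J : ℝ) * (J ^ 2 * θ ^ 2))) := by gcongr
      _ = 1 / 5 * (γ * Real.exp (-(2 * (2 * 1 + 2))) * δ ^ (1 - r) * ((J : ℝ) * (J ^ 2 * θ ^ 2 / 8))) := by ring
      _ ≤ 1 / 5 * (γ * Real.exp (-(2 * (2 * 1 + 2))) * δ ^ (1 - r) *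
          ∑ j ∈ Finset.Ioc J (2 * J), (1 - Real.cos (j * θ))) := by gcongr
      _ ≤ _ := mul_le_mul_of_nonneg_left h1 (by norm_num)
  · have h1 := block_lower hy hγ hr h hδ hδ1 (show (1 : ℝ) ≤ 14 by norm_num) N (by linarith) _ hcos
    obtain ⟨c1, c2, c3⟩ := ceil_facts hδ hδ1 (show (1 : ℝ) ≤ 14 by norm_num)
    set J := ⌈14 / δ⌉₊
    have h3 := cos_sum_bound (J := J) hθ2 (by
      have : (J : ℝ) * (δ / 2) ≤ J * |θ| := by gcongr
      linarith)
    have h4 : δ ^ (-(2 * η)) ≤ δ ^ (-r) := Real.rpow_le_rpow_of_exponent_ge hδ hδ1 (by linarith)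
    have h5 : δ ^ (-r) ≤ δ ^ (1 - r) * (J / 2) := by
      rw [e]
      have : 0 < δ ^ (-r) := by positivity
      nlinarith
    calc γ * Real.exp (-60) / 40 * δ ^ (-(2 * η)) ≤
        γ * Real.exp (-60) / 5 * (δ ^ (1 - r) * (J / 2)) := by
          gcongr
          · norm_num
          · exact h4.trans h5
      _ = 1 / 5 * (γ * Real.exp (-(2 * (2 * 14 + 2))) * δ ^ (1 - r) * (J / 2)) := by norm_num; ring
      _ ≤ 1 / 5 * (γ * Real.exp (-(2 * (2 * 14 + 2))) * δ ^ (1 - r) *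
          ∑ j ∈ Finset.Ioc J (2 * J), (1 - Real.cos (j * θ))) := by gcongr
      _ ≤ _ := mul_le_mul_of_nonneg_left h1 (by norm_num)

lemma M_diff {a : ℕ → ℕ} {γ' r1 r y c3 : ℝ} (hy : 1 ≤ y) (hr1 : 0 < r1) (hγ' : 0 < γ') (hr : 0 < r)
    (h' : ∀ j : ℕ, 1 ≤ j → (a j : ℝ) ≤ γ' * (j : ℝ) ^ (r - 1) * y ^ j) (hc3 : 0 < c3) :
    ∃ C : ℝ, 0 < C ∧ ∀ (δ : ℝ) (n : ℕ), 0 < δ → 1 ≤ n * δ → c3 * δ ^ (-r1) ≤ n * δ →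
      Mfun a n (δ + Real.log y) = n → |Mfun a (n + 1) (δ + Real.log y) - n| ≤ C := by
  set μ := r / r1 with hμ
  have hμ0 : 0 < μ := by positivity
  have hs : 0 < r + μ := by linarith
  refine ⟨2 * γ' * ((r + μ) ^ (r + μ) * c3 ^ (-μ)), by positivity, ?_⟩
  intro δ n hδ hn hnc hM
  have hL := Real.log_nonneg hy
  have hσ : 0 < δ + Real.log y := by linarith
  have e1 : Mfun a (n + 1) (δ + Real.log y) - n = ((n + 1 : ℕ) : ℝ) * (a (n + 1)) *
      Real.exp (-((n + 1 : ℕ) * (δ + Real.log y))) / (1 - Real.exp (-((n + 1 : ℕ) * (δ + Real.log y)))) := by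
    rw [Mfun, Finset.sum_Icc_succ_top (by omega)]
    rw [Mfun] at hM
    rw [hM]; ring
  rw [e1]
  obtain ⟨q0, q1⟩ := q_pos_lt hσ (show 1 ≤ n + 1 by omega)
  have hup := aq_upper hy h' δ (show 1 ≤ n + 1 by omega)
  have hm0 : (0 : ℝ) < (n + 1 : ℕ) := by positivity
  have hmn : (n : ℝ) ≤ (n + 1 : ℕ) := by push_cast; linarith
  generalize (n + 1 : ℕ) = m at *
  set x := (m : ℝ) * δ with hx
  have hnx : n * δ ≤ x := mul_le_mul_of_nonneg_right hmn hδ.le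
  have hx1 : 1 ≤ x := hn.trans hnx
  have hx0 : 0 < x := by linarith
  have hxc : c3 * δ ^ (-r1) ≤ x := hnc.trans hnx
  have hhalf : 1 / 2 ≤ 1 - Real.exp (-(m * (δ + Real.log y))) := by
    have h1 := one_sub_exp_ge hx0.le
    have h2 : 1 / 2 ≤ x / (1 + x) := by
      rw [div_le_div_iff₀ (by norm_num) (by linarith)]; linarith
    have h3 : Real.exp (-(m * (δ + Real.log y))) ≤ Real.exp (-x) := by
      rw [Real.exp_le_exp, hx]; nlinarith
    linarith
  rw [abs_of_nonneg (div_nonneg (by positivity) (by linarith))]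
  rw [div_le_iff₀ (by linarith)]
  have h1 : x ^ r * Real.exp (-x) ≤ (r + μ) ^ (r + μ) * x ^ (-μ) := by
    have := rpow_exp_bound (r + μ) hs x hx0.le
    rw [Real.rpow_add hx0] at this
    rw [Real.exp_neg, Real.rpow_neg hx0.le, ← div_eq_mul_inv, ← div_eq_mul_inv,
      div_le_div_iff₀ (Real.exp_pos _) (by positivity)]
    exact this
  have h2 : x ^ (-μ) ≤ c3 ^ (-μ) * δ ^ r := by
    calc x ^ (-μ) ≤ (c3 * δ ^ (-r1)) ^ (-μ) :=
          Real.rpow_le_rpow_of_nonpos (by positivity) hxc (by linarith)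
      _ = _ := by
        rw [Real.mul_rpow hc3.le (by positivity), ← Real.rpow_mul hδ.le]
        congr 2
        rw [hμ]; field_simp
  have e2 : (m : ℝ) * (m : ℝ) ^ (r - 1) = δ ^ (-r) * x ^ r := by
    rw [hx, Real.mul_rpow hm0.le hδ.le, Real.rpow_sub_one hm0.ne', Real.rpow_neg hδ.le]
    have : δ ^ r ≠ 0 := by positivity
    field_simp
  have hrr : δ ^ (-r) * δ ^ r = 1 := by rw [← Real.rpow_add hδ]; simp
  calc (m : ℝ) * a m * Real.exp (-(m * (δ + Real.log y)))
      = m * (a m * Real.exp (-(m * (δ + Real.log y)))) := by ring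
    _ ≤ m * (γ' * (m : ℝ) ^ (r - 1) * Real.exp (-x)) := by gcongr
    _ = γ' * (m * (m : ℝ) ^ (r - 1)) * Real.exp (-x) := by ring
    _ = γ' * δ ^ (-r) * (x ^ r * Real.exp (-x)) := by rw [e2]; ring
    _ ≤ γ' * δ ^ (-r) * ((r + μ) ^ (r + μ) * (c3 ^ (-μ) * δ ^ r)) := by
        apply mul_le_mul_of_nonneg_left _ (by positivity)
        exact h1.trans (mul_le_mul_of_nonneg_left h2 (by positivity))
    _ = γ' * ((r + μ) ^ (r + μ) * c3 ^ (-μ)) * (δ ^ (-r) * δ ^ r) := by ring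
    _ = 2 * γ' * ((r + μ) ^ (r + μ) * c3 ^ (-μ)) * (1 / 2) := by rw [hrr]; ring
    _ ≤ _ := by gcongr

lemma rpow_small {p : ℝ} (hp : 0 < p) :
    Tendsto (fun δ : ℝ => δ ^ p) (nhdsWithin 0 (Set.Ioi 0)) (nhds 0) := by
  have h := (Real.continuousAt_rpow_const 0 p (Or.inr hp.le)).tendsto
  rw [Real.zero_rpow hp.ne'] at h
  exact h.mono_left nhdsWithin_le_nhds

lemma exp_small {c q : ℝ} (hc : 0 < c) (hq : 0 < q) (p : ℝ) :
    Tendsto (fun δ : ℝ => Real.exp (-(c * δ ^ (-q))) * δ ^ (-p))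
      (nhdsWithin 0 (Set.Ioi 0)) (nhds 0) := by
  have h := (tendsto_rpow_mul_exp_neg_mul_atTop_nhds_zero (p / q) c hc).comp
    (tendsto_rpow_neg_nhdsGT_zero (neg_lt_zero.mpr hq))
  refine h.congr' ?_
  filter_upwards [self_mem_nhdsWithin] with δ hδ
  have hδ : 0 < δ := hδ
  simp only [Function.comp]
  rw [← Real.rpow_mul hδ.le, show -q * (p / q) = -p by field_simp]
  rw [mul_comm, neg_mul]

lemma small_facts {r ε c1 κ C3 C4 : ℝ} (hr : 0 < r) (hε : 0 < ε)
    (hc1 : 0 < c1) (hκ : 0 < κ) :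
    (∀ᶠ δ : ℝ in nhdsWithin 0 (Set.Ioi 0),
      δ ^ (1 + (2 * r / 3 + ε) / 2 - ε / 4) ≤ 1 ∧
      (δ ^ (1 + (2 * r / 3 + ε) / 2 - ε / 4)) ^ 3 * (C3 * δ ^ (-(r + ε / 4)) / δ ^ 3) +
        C4 * δ ^ (1 + (2 * r / 3 + ε) / 2 - ε / 4) ≤ 1 ∧
      2 * Real.pi * Real.exp (-(c1 * δ ^ (-(2 * (ε / 4))))) ≤ δ ^ (1 + (r + ε / 4) / 2) * κ) ∧
    Tendsto (fun δ : ℝ => (2 * (δ ^ (1 + (2 * r / 3 + ε) / 2 - ε / 4)) ^ 2 +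
      2 * Real.pi * (2 * Real.exp (-(c1 * δ ^ (-(2 * (ε / 4))))))) /
        (δ ^ (1 + (r + ε / 4) / 2) * κ) / δ) (nhdsWithin 0 (Set.Ioi 0)) (nhds 0) := by
  have hT := rpow_small (show 0 < 1 + (2 * r / 3 + ε) / 2 - ε / 4 by linarith)
  have hA := rpow_small (show 0 < ε / 2 by linarith)
  have hB := rpow_small (show 0 < r / 6 + 3 * ε / 8 by linarith)
  have hq : 0 < 2 * (ε / 4) := by linarith
  have hE1 := exp_small hc1 hq (1 + (r + ε / 4) / 2)
  have hE2 := exp_small hc1 hq (2 + (r + ε / 4) / 2)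
  constructor
  · have h2 := (hA.const_mul C3).add (hT.const_mul C4)
    have h3 := hE1.const_mul (2 * Real.pi)
    simp only [mul_zero, add_zero] at h2 h3
    filter_upwards [hT.eventually_le_const one_pos, h2.eventually_le_const one_pos,
      h3.eventually_le_const hκ, self_mem_nhdsWithin] with δ k1 k2 k3 hδ
    have hδ : 0 < δ := hδ
    refine ⟨k1, ?_, ?_⟩
    · refine le_trans (le_of_eq ?_) k2
      congr 1
      have : δ ^ (ε / 2) = (δ ^ (1 + (2 * r / 3 + ε) / 2 - ε / 4)) ^ 3 * δ ^ (-(r + ε / 4)) / δ ^ 3 := by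
        rw [← Real.rpow_natCast δ 3, ← Real.rpow_natCast _ 3, ← Real.rpow_mul hδ.le,
          ← Real.rpow_add hδ, ← Real.rpow_sub hδ]
        congr 1; push_cast; ring
      rw [this]; ring
    · rw [Real.rpow_neg hδ.le (1 + (r + ε / 4) / 2)] at k3
      have hp : 0 < δ ^ (1 + (r + ε / 4) / 2) := by positivity
      rw [← mul_assoc, ← div_eq_mul_inv, div_le_iff₀ hp] at k3
      linarith
  · have h4 := (hB.const_mul (2 / κ)).add (hE2.const_mul (4 * Real.pi / κ))
    simp only [mul_zero, add_zero] at h4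
    refine h4.congr' ?_
    filter_upwards [self_mem_nhdsWithin] with δ hδ
    have hδ : 0 < δ := hδ
    have e1 : δ ^ (r / 6 + 3 * ε / 8) =
        (δ ^ (1 + (2 * r / 3 + ε) / 2 - ε / 4)) ^ 2 / (δ ^ (1 + (r + ε / 4) / 2) * δ) := by
      rw [← Real.rpow_natCast _ 2, ← Real.rpow_mul hδ.le, ← Real.rpow_add_one hδ.ne', ← Real.rpow_sub hδ]
      congr 1; push_cast; ring
    have e2 : δ ^ (-(2 + (r + ε / 4) / 2)) = 1 / (δ ^ (1 + (r + ε / 4) / 2) * δ) := by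
      rw [← Real.rpow_add_one hδ.ne', Real.rpow_neg hδ.le, one_div]
      congr 2; ring
    rw [e1, e2]
    have hp : 0 < δ ^ (1 + (r + ε / 4) / 2) := by positivity
    field_simp
    ring

lemma log_bound {x : ℝ} (hx : |x| ≤ 1 / 2) : |Real.log (1 + x)| ≤ 2 * |x| := by
  have h := abs_le.mp hx
  have h0 : 0 < 1 + x := by linarith
  have u := Real.log_le_sub_one_of_pos h0
  have l := Real.one_sub_inv_le_log_of_pos h0
  have l2 : 1 - (1 + x)⁻¹ = x / (1 + x) := by field_simp; ring
  rw [l2] at l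
  rw [abs_le]
  constructor
  · refine le_trans ?_ l
    rw [le_div_iff₀ h0]
    rcases abs_cases x with ⟨e, _⟩ | ⟨e, _⟩ <;> rw [e] <;> nlinarith
  · have := le_abs_self x
    have := abs_nonneg x
    linarith

lemma final_step {c d σ L δ x : ℝ} (hc : 0 < c) (hδ : 0 < δ) (hσ : σ = δ + L)
    (hx : d * Real.exp (-σ) / c - 1 = x) (hx1 : |x| ≤ 1 / 2) :
    |(Real.log (c / d) + L) / δ + 1| ≤ 2 * (|x| / δ) := by
  have h := abs_le.mp hx1
  have h0 : 0 < 1 + x := by linarith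
  have hd : d = c * (1 + x) * Real.exp σ := by
    rw [← hx, Real.exp_neg]
    have := Real.exp_pos σ
    field_simp
    ring
  have e : c / d = (1 + x)⁻¹ * Real.exp (-σ) := by
    rw [hd, Real.exp_neg]
    have := Real.exp_pos σ
    field_simp
  have e2 : (Real.log (c / d) + L) / δ + 1 = - Real.log (1 + x) / δ := by
    rw [e, Real.log_mul (by positivity) (Real.exp_ne_zero _), Real.log_inv, Real.log_exp, hσ]
    field_simp
    ring
  rw [e2, abs_div, abs_neg, abs_of_pos hδ, ← mul_div_assoc]
  gcongr
  exact log_bound hx1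

lemma main_bound {a : ℕ → ℕ} {r ε y : ℝ} (hr : 0 < r)
    (hε : 0 < ε) (hε' : ε ≤ r / 3) (hy : 1 ≤ y) {γ₁ γ₂ : ℝ} (hγ₁ : 0 < γ₁) (hγ₂ : 0 < γ₂)
    (hlo : ∀ j : ℕ, 1 ≤ j → γ₁ * (j : ℝ) ^ ((2 * r / 3 + ε) - 1) * y ^ j ≤ (a j : ℝ))
    (hup : ∀ j : ℕ, 1 ≤ j → (a j : ℝ) ≤ γ₂ * (j : ℝ) ^ (r - 1) * y ^ j)
    (σ : ℕ → ℝ) (hσ : ∀ n : ℕ, 1 ≤ n → 0 < σ n ∧ Mfun a n (σ n) = n) :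
    ∃ Q : ℝ → ℝ, Tendsto (fun δ => Q δ / δ) (nhdsWithin 0 (Set.Ioi 0)) (nhds 0) ∧
      ∀ᶠ n : ℕ in atTop, 0 < (multisetCount a n : ℝ) ∧
        |(multisetCount a (n + 1) : ℝ) * Real.exp (-(σ n)) / multisetCount a n - 1| ≤
          Q (σ n - Real.log y) := by
  have ha : ∀ j, 1 ≤ j → 1 ≤ a j := by
    intro j hj
    have hj0 : (0 : ℝ) < j := by exact_mod_cast hj
    have hy0 : 0 < y := by linarith
    have : (0 : ℝ) < a j := lt_of_lt_of_le (by positivity) (hlo j hj)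
    exact_mod_cast this
  have hr1 : 0 < 2 * r / 3 + ε := by linarith
  have hη : 0 < ε / 4 := by linarith
  have hc1 : 0 < γ₁ * Real.exp (-60) / 40 := by positivity
  obtain ⟨C2, hC2, hb2⟩ := rho_bound hy hγ₂ hr hη hup 2 (by norm_num)
  obtain ⟨C3, hC3, hb3⟩ := rho_bound hy hγ₂ hr hη hup 3 (by norm_num)
  obtain ⟨C4, hC4, hb4⟩ := M_diff (c3 := γ₁ * Real.exp (-8)) hy hr1 hγ₂ hr hup (by positivity)
  have hκ : 0 < Real.exp (-C2) / 2 := by positivity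
  obtain ⟨hev, ht⟩ := small_facts (C3 := C3) (C4 := C4) hr hε hc1 hκ
  refine ⟨_, ht, ?_⟩
  have hδt := delta_tendsto hy hγ₁ hr1 hlo hγ₂ hr hup σ hσ
  have hδ1 : ∀ᶠ δ : ℝ in nhdsWithin 0 (Set.Ioi 0), δ ≤ 1 :=
    (tendsto_id.mono_left nhdsWithin_le_nhds).eventually_le_const one_pos
  filter_upwards [hδt.eventually hev, hδt.eventually hδ1, hδt.eventually self_mem_nhdsWithin,
    n_delta_large hy hγ₁ hr1 hlo σ hσ 30 (by norm_num), eventually_ge_atTop 1] with n k1 k2 k3 k4 k5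
  obtain ⟨hs, hM⟩ := hσ n k5
  generalize hδe : σ n - Real.log y = δ at k1 k2 k3 k4 ⊢
  have hσe : σ n = δ + Real.log y := by rw [← hδe]; ring
  rw [hσe] at hs hM ⊢
  have hδ : 0 < δ := k3
  obtain ⟨t1, t2, t3⟩ := k1
  have hpi := Real.pi_gt_three
  set T := δ ^ (1 + (2 * r / 3 + ε) / 2 - ε / 4) with hT
  set w := δ ^ (1 + (r + ε / 4) / 2) with hw
  set E := Real.exp (-(γ₁ * Real.exp (-60) / 40 * δ ^ (-(2 * (ε / 4))))) with hE
  have hw0 : 0 < w := by positivity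
  have hT0 : 0 < T := by positivity
  have hE0 : 0 < E := Real.exp_pos _
  have hwκ : 0 < w * (Real.exp (-C2) / 2) := by positivity
  have hd4 := hb4 δ n hδ (by linarith) (n_lower hy hγ₁ hr1 hlo hδ k2 n (by linarith) hM) hM
  have hcr := core_ratio a ha n hs (w := w) (T := T) (E := E) (κ := Real.exp (-C2) / 2) hw0.le
    (Real.rpow_le_rpow_of_exponent_ge hδ k2 (by linarith)) (by linarith) hE0.le
    (fun θ h1 h2 => phi_decay hy hγ₁ hr1 hlo hδ k2 (n + 1) (by push_cast; nlinarith)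
      (by linarith) θ h1 h2)
    (fun θ h1 => by
      refine (phi_arg a (n + 1) n hs θ).trans (le_trans ?_ t2)
      have hn : 0 ≤ |θ| := abs_nonneg θ
      have hb := hb3 δ (n + 1) hδ
      have hP : 0 ≤ C3 * δ ^ (-(r + ε / 4)) / δ ^ 3 := by positivity
      apply add_le_add
      · calc _ ≤ |θ| ^ 3 * (C3 * δ ^ (-(r + ε / 4)) / δ ^ 3) :=
              mul_le_mul_of_nonneg_left hb (by positivity)
          _ ≤ _ := by gcongr
      · exact mul_le_mul hd4 h1 hn hC4.le)
    (fun θ h1 => by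
      refine le_trans ?_ (phi_norm_ge a (n + 1) hs θ)
      rw [show 2 * (Real.exp (-C2) / 2) = Real.exp (-C2) by ring, Real.exp_le_exp, neg_le_neg_iff]
      have hb := hb2 δ (n + 1) hδ
      have hP : 0 ≤ C2 * δ ^ (-(r + ε / 4)) / δ ^ 2 := by positivity
      calc _ ≤ θ ^ 2 * (C2 * δ ^ (-(r + ε / 4)) / δ ^ 2) :=
              mul_le_mul_of_nonneg_left hb (by positivity)
        _ = |θ| ^ 2 * (C2 * δ ^ (-(r + ε / 4)) / δ ^ 2) := by rw [sq_abs]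
        _ ≤ w ^ 2 * (C2 * δ ^ (-(r + ε / 4)) / δ ^ 2) := by gcongr
        _ = C2 * (w ^ 2 * δ ^ (-(r + ε / 4)) / δ ^ 2) := by ring
        _ = C2 * 1 := by
          congr 1
          rw [hw, ← Real.rpow_natCast δ 2, ← Real.rpow_natCast _ 2, ← Real.rpow_mul hδ.le,
            ← Real.rpow_add hδ, ← Real.rpow_sub hδ]
          rw [show (1 + (r + ε / 4) / 2) * ((2 : ℕ) : ℝ) + -(r + ε / 4) - ((2 : ℕ) : ℝ) = 0 by
            push_cast; ring, Real.rpow_zero]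
        _ = C2 := mul_one _)
    (by linarith)
  refine ⟨hcr.1, hcr.2.trans ?_⟩
  apply div_le_div_of_nonneg_left (by positivity) hwκ
  linarith

/-- Corollary: for `r > 0`, `0 < ε ≤ r/3`, `y ≥ 1` and
`a ∈ 𝓕(2r/3 + ε, r, y)`, one has `δ_n → 0` and
`c_n/c_{n+1} = y^{-1} exp(-δ_n + o(δ_n))`, i.e.
`(log(c_n/c_{n+1}) + log y)/δ_n → -1`, where `δ_n = σ_n - log y`. -/
theorem ratio_delta_asymptotics_oscillation (a : ℕ → ℕ) (r ε y : ℝ) (hr : 0 < r)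
    (hε : 0 < ε) (hε' : ε ≤ r / 3) (hy : 1 ≤ y)
    (hF : FCond a (2 * r / 3 + ε) r y)
    (σ : ℕ → ℝ) (hσ : ∀ n : ℕ, 1 ≤ n → 0 < σ n ∧ Mfun a n (σ n) = n) :
    Tendsto (fun n : ℕ => σ n - Real.log y) atTop (nhds 0) ∧
    Tendsto (fun n : ℕ =>
      (Real.log ((multisetCount a n : ℝ) / (multisetCount a (n + 1) : ℝ)) + Real.log y) /
        (σ n - Real.log y))
      atTop (nhds (-1)) := by
  obtain ⟨γ₁, γ₂, hγ₁, hγ₂, h⟩ := hF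
  have hlo := fun j hj => (h j hj).1
  have hup := fun j hj => (h j hj).2
  have hδt := delta_tendsto hy hγ₁ (by linarith) hlo hγ₂ hr hup σ hσ
  refine ⟨hδt.mono_right nhdsWithin_le_nhds, ?_⟩
  obtain ⟨Q, hQ, hev⟩ := main_bound hr hε hε' hy hγ₁ hγ₂ hlo hup σ hσ
  have hQ2 := hQ.comp hδt
  have hlim : Tendsto (fun n : ℕ => 2 * (Q (σ n - Real.log y) / (σ n - Real.log y))) atTop (nhds 0) := by
    simpa using hQ2.const_mul 2
  have hδ1 : ∀ᶠ δ : ℝ in nhdsWithin 0 (Set.Ioi 0), δ ≤ 1 :=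
    (tendsto_id.mono_left nhdsWithin_le_nhds).eventually_le_const one_pos
  rw [tendsto_iff_dist_tendsto_zero]
  refine squeeze_zero' (Eventually.of_forall fun _ => dist_nonneg) ?_ hlim
  filter_upwards [hev, hδt.eventually self_mem_nhdsWithin, hδt.eventually hδ1,
    hlim.eventually_le_const one_pos] with n k1 k2 k3 k4
  have hδ : 0 < σ n - Real.log y := k2
  have hq : Q (σ n - Real.log y) ≤ 1 / 2 := by
    have : Q (σ n - Real.log y) / (σ n - Real.log y) ≤ 1 / 2 := by linarith
    rw [div_le_iff₀ hδ] at this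
    linarith
  have hf := final_step k1.1 hδ (σ := σ n) (L := Real.log y) (by ring) rfl (k1.2.trans hq)
  rw [Real.dist_eq, sub_neg_eq_add]
  refine hf.trans ?_
  have := k1.2
  gcongr
end

section
/- Assume a_j = K j^{r−1} y^j + O(y^{νj}) (i.e. there is C > 0 with |a_j − K j^{r−1} y^j| ≤ C y^{νj} for all j ≥ 1), where K > 0, r > 0, y > 1 and ν ∈ (0,1). Then n = K Γ(r+1) δ_n^{−r−1} + O(1) as n → ∞, and consequently δ_n = (n / (K Γ(r+1)))^{−1/(r+1)} + o(n^{−1}). -/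
open Finset Filter

lemma F_bound (k : ℕ) (hk : 1 ≤ k) : ∃ C : ℝ, 0 < C ∧ ∀ x : ℝ, 0 < x →
    |∑' j : ℕ, (j : ℝ) ^ k * Real.exp (-(j * x)) - (k.factorial : ℝ) / x ^ (k + 1)| ≤ C := by
  set c : ℂ := (-2 * (Real.pi : ℂ) * Complex.I) ^ (k + 1) / (k.factorial : ℂ) with hc
  have hπ : (Real.pi : ℂ) ≠ 0 := by exact_mod_cast Real.pi_ne_zero
  have hfac : (k.factorial : ℂ) ≠ 0 := by exact_mod_cast k.factorial_ne_zero
  have hc0 : c ≠ 0 := by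
    rw [hc]
    refine div_ne_zero (pow_ne_zero _ ?_) hfac
    simp [hπ]
  have hsum : Summable (fun n : ℤ => |1 / (n : ℝ) ^ (k + 1)|) :=
    (Real.summable_one_div_int_pow.2 (by omega)).abs
  set B : ℝ := ∑' n : ℤ, |1 / (n : ℝ) ^ (k + 1)| with hB
  have hB0 : 0 ≤ B := tsum_nonneg fun _ => abs_nonneg _
  refine ⟨‖c⁻¹‖ * B + 1, by positivity, fun x hx => ?_⟩
  let z : UpperHalfPlane := ⟨Complex.I * ((x / (2 * Real.pi) : ℝ) : ℂ), by
    simp only [Complex.mul_im, Complex.I_re, Complex.I_im, Complex.ofReal_re, Complex.ofReal_im]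
    have := Real.pi_pos
    simp; positivity⟩
  have hz : (z : ℂ) = Complex.I * ((x / (2 * Real.pi) : ℝ) : ℂ) := rfl
  have hz0 : (z : ℂ) ≠ 0 := z.ne_zero
  have hre : ∀ n : ℤ, ((z : ℂ) + n).re = n := by
    intro n; rw [hz, Complex.add_re, Complex.I_mul_re, Complex.ofReal_im]; simp
  have hb : ∀ n : ℤ, n ≠ 0 → ‖1 / ((z : ℂ) + n) ^ (k + 1)‖ ≤ |1 / (n : ℝ) ^ (k + 1)| := by
    intro n hn
    have h1 : |(n : ℝ)| ≤ ‖(z : ℂ) + n‖ := by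
      have := Complex.abs_re_le_norm ((z : ℂ) + n)
      rwa [hre] at this
    have h2 : 0 < |(n : ℝ)| := by simpa using hn
    rw [norm_div, norm_pow, abs_div, abs_pow, norm_one, abs_one]
    gcongr
  have hsw : Summable (fun n : ℤ => 1 / ((z : ℂ) + n) ^ (k + 1)) := by
    refine Summable.of_norm_bounded_eventually hsum ?_
    filter_upwards [(Set.finite_singleton (0 : ℤ)).compl_mem_cofinite] with n hn
    exact hb n (by simpa using hn)
  have key := EisensteinSeries.qExpansion_identity hk z
  rw [hsw.tsum_eq_add_tsum_ite 0, ← hc] at key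
  have hexp : Complex.exp (2 * Real.pi * Complex.I * z) = ((Real.exp (-x) : ℝ) : ℂ) := by
    rw [hz, Complex.ofReal_exp]
    congr 1
    push_cast
    field_simp
    simp
  have hF : ∑' n : ℕ, (n : ℂ) ^ k * Complex.exp (2 * Real.pi * Complex.I * z) ^ n
      = ((∑' j : ℕ, (j : ℝ) ^ k * Real.exp (-(j * x)) : ℝ) : ℂ) := by
    rw [Complex.ofReal_tsum]
    refine tsum_congr fun n => ?_
    rw [hexp, ← Complex.ofReal_pow, ← Real.exp_nat_mul]
    push_cast
    congr 2
    ring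
  rw [hF] at key
  have h0 : 1 / ((z : ℂ) + ((0 : ℤ) : ℂ)) ^ (k + 1) = c * ((k.factorial / x ^ (k + 1) : ℝ) : ℂ) := by
    have hxc : (x : ℂ) ≠ 0 := by exact_mod_cast hx.ne'
    have : (-2 * (Real.pi : ℂ) * Complex.I) * z = x := by
      rw [hz]; push_cast; field_simp; simp
    have h3 : (-2 * (Real.pi : ℂ) * Complex.I) ^ (k + 1) * (z : ℂ) ^ (k + 1) = x ^ (k + 1) := by
      rw [← mul_pow, this]
    rw [hc]; push_cast
    rw [add_zero]
    rw [div_mul_div_comm, mul_comm (k.factorial : ℂ) ((x : ℂ) ^ (k + 1)),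
      mul_div_mul_right _ _ hfac, ← h3, one_div, ]
    field_simp
  rw [h0] at key
  set F := ∑' j : ℕ, (j : ℝ) ^ k * Real.exp (-(j * x))
  have h5 : ((F - k.factorial / x ^ (k + 1) : ℝ) : ℂ) = c⁻¹ *
      ∑' n : ℤ, (if n = 0 then 0 else 1 / ((z : ℂ) + n) ^ (k + 1)) := by
    rw [eq_inv_mul_iff_mul_eq₀ hc0, Complex.ofReal_sub, mul_sub, ← key]
    ring
  rw [← Real.norm_eq_abs, ← Complex.norm_real, h5, norm_mul]
  have h6 : ‖∑' n : ℤ, (if n = 0 then 0 else 1 / ((z : ℂ) + n) ^ (k + 1))‖ ≤ B := by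
    refine tsum_of_norm_bounded hsum.hasSum fun n => ?_
    split_ifs with h
    · simp
    · exact hb n h
  have := mul_le_mul_of_nonneg_left h6 (norm_nonneg c⁻¹)
  linarith

lemma F_decay (k : ℕ) (hk : 1 ≤ k) : ∃ C : ℝ, 0 < C ∧ ∀ x : ℝ, 1 ≤ x →
    |∑' j : ℕ, (j : ℝ) ^ k * Real.exp (-(j * x)) - (k.factorial : ℝ) / x ^ (k + 1)|
      ≤ C / x ^ (k + 1) := by
  have hs : Summable (fun j : ℕ => 1 / (j : ℝ) ^ 2) := Real.summable_one_div_nat_pow.2 (by norm_num)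
  set B := ∑' j : ℕ, 1 / (j : ℝ) ^ 2
  have hB0 : 0 ≤ B := tsum_nonneg fun _ => by positivity
  refine ⟨(k + 2).factorial * B + k.factorial, by positivity, fun x hx => ?_⟩
  have hx0 : 0 < x := by linarith
  have h1 : ‖∑' j : ℕ, (j : ℝ) ^ k * Real.exp (-(j * x))‖
      ≤ ((k + 2).factorial / x ^ (k + 2)) * B := by
    refine tsum_of_norm_bounded (hs.hasSum.mul_left _) fun j => ?_
    rcases Nat.eq_zero_or_pos j with rfl | hj
    · have : k ≠ 0 := by omega
      simp [this]
    have hj' : (0 : ℝ) < j := by exact_mod_cast hj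
    have h := Real.pow_div_factorial_le_exp (j * x) (by positivity) (k + 2)
    rw [Real.norm_of_nonneg (by positivity), Real.exp_neg]
    have h2 : (Real.exp (j * x))⁻¹ ≤ ((j * x) ^ (k + 2) / (k + 2).factorial)⁻¹ := by
      gcongr
    refine (mul_le_mul_of_nonneg_left h2 (by positivity)).trans (le_of_eq ?_)
    field_simp
    ring
  have h2 : 1 / x ^ (k + 2) ≤ 1 / x ^ (k + 1) := by
    gcongr
    norm_num
  rw [Real.norm_eq_abs] at h1
  refine (abs_sub _ _).trans ?_
  rw [abs_of_nonneg (by positivity : (0 : ℝ) ≤ k.factorial / x ^ (k + 1))]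
  have h3 : ((k + 2).factorial / x ^ (k + 2)) * B ≤ (k + 2).factorial * B * (1 / x ^ (k + 1)) := by
    calc _ = (k + 2).factorial * B * (1 / x ^ (k + 2)) := by ring
      _ ≤ _ := by gcongr
  calc _ ≤ (k + 2).factorial * B * (1 / x ^ (k + 1)) + k.factorial / x ^ (k + 1) := by linarith
    _ = _ := by ring
open MeasureTheory in
lemma summable_rpow_exp (r δ : ℝ) (hr : 0 < r) (hδ : 0 < δ) :
    Summable (fun j : ℕ => (j : ℝ) ^ r * Real.exp (-(j * δ))) := by
  obtain ⟨k, hk⟩ := exists_nat_gt r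
  refine Summable.of_nonneg_of_le (fun j => by positivity) (fun j => ?_)
    (Real.summable_pow_mul_exp_neg_nat_mul k hδ)
  rcases Nat.eq_zero_or_pos j with rfl | hj
  · simp [Real.zero_rpow hr.ne']
  have hj' : (1 : ℝ) ≤ j := by exact_mod_cast hj
  have h1 : (j : ℝ) ^ r ≤ (j : ℝ) ^ k := by
    rw [← Real.rpow_natCast]
    exact Real.rpow_le_rpow_of_exponent_le hj' hk.le
  rw [show -(j * δ) = -δ * j by ring]
  gcongr

open MeasureTheory in
lemma integrable_gamma (p c : ℝ) (hp : 0 < p) (hc : 0 < c) :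
    IntegrableOn (fun t : ℝ => t ^ (p - 1) * Real.exp (-(c * t))) (Set.Ioi 0) := by
  apply Integrable.of_integral_ne_zero
  rw [Real.integral_rpow_mul_exp_neg_mul_Ioi hp hc]
  have := Real.Gamma_pos_of_pos hp
  positivity

open MeasureTheory in
lemma frac_sum (r δ : ℝ) (k : ℕ) (hr : 0 < r) (hk : r < k) (hδ : 0 < δ) :
    ∫ t in Set.Ioi (0 : ℝ), t ^ ((k - r) - 1) *
      ∑' j : ℕ, (j : ℝ) ^ k * Real.exp (-(j * (δ + t)))
    = Real.Gamma (k - r) * ∑' j : ℕ, (j : ℝ) ^ r * Real.exp (-(j * δ)) := by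
  have hp : 0 < k - r := by linarith
  have hk0 : k ≠ 0 := by rintro rfl; simp at hk; linarith
  have hform : ∀ (j : ℕ) (t : ℝ), t ^ ((k - r) - 1) * ((j : ℝ) ^ k * Real.exp (-(j * (δ + t))))
      = ((j : ℝ) ^ k * Real.exp (-(j * δ))) * (t ^ ((k - r) - 1) * Real.exp (-(j * t))) := by
    intro j t
    rw [show -((j : ℝ) * (δ + t)) = -(j * δ) + -(j * t) by ring, Real.exp_add]
    ring
  have hint : ∀ j : ℕ, Integrable (fun t : ℝ => t ^ ((k - r) - 1) *
      ((j : ℝ) ^ k * Real.exp (-(j * (δ + t))))) (volume.restrict (Set.Ioi 0)) := by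
    intro j
    simp only [hform]
    rcases Nat.eq_zero_or_pos j with rfl | hj
    · simp [hk0]
    have hj' : (0 : ℝ) < j := by exact_mod_cast hj
    exact (integrable_gamma _ _ hp hj').const_mul _
  have hval : ∀ j : ℕ, ∫ t in Set.Ioi (0 : ℝ), t ^ ((k - r) - 1) *
      ((j : ℝ) ^ k * Real.exp (-(j * (δ + t))))
      = Real.Gamma (k - r) * ((j : ℝ) ^ r * Real.exp (-(j * δ))) := by
    intro j
    simp only [hform]
    rcases Nat.eq_zero_or_pos j with rfl | hj
    · simp [hk0, Real.zero_rpow hr.ne']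
    have hj' : (0 : ℝ) < j := by exact_mod_cast hj
    rw [integral_const_mul, Real.integral_rpow_mul_exp_neg_mul_Ioi hp hj']
    have : (j : ℝ) ^ r = (j : ℝ) ^ k * (1 / (j : ℝ)) ^ ((k : ℝ) - r) := by
      rw [one_div, Real.inv_rpow hj'.le, ← Real.rpow_neg hj'.le, ← Real.rpow_natCast,
        ← Real.rpow_add hj']
      congr 1; ring
    rw [this]; ring
  have hnorm : ∀ j : ℕ, ∫ t in Set.Ioi (0 : ℝ), ‖t ^ ((k - r) - 1) *
      ((j : ℝ) ^ k * Real.exp (-(j * (δ + t))))‖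
      = Real.Gamma (k - r) * ((j : ℝ) ^ r * Real.exp (-(j * δ))) := by
    intro j
    rw [← hval j]
    refine setIntegral_congr_fun measurableSet_Ioi fun t ht => ?_
    have ht' : (0 : ℝ) < t := ht
    exact Real.norm_of_nonneg (by positivity)
  have H := hasSum_integral_of_summable_integral_norm hint (by
    simp only [hnorm]
    exact (summable_rpow_exp r δ hr hδ).mul_left _)
  simp only [hval, tsum_mul_left] at H
  rw [← H.tsum_eq, tsum_mul_left]

open MeasureTheory in
lemma frac_int (r δ : ℝ) (k : ℕ) (hr : 0 < r) (hk : r < k) (hδ : 0 < δ) :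
    ∫ t in Set.Ioi (0 : ℝ), t ^ ((k - r) - 1) * ((k.factorial : ℝ) / (δ + t) ^ (k + 1))
    = Real.Gamma (k - r) * (Real.Gamma (r + 1) * δ ^ (-r - 1)) := by
  have hp : 0 < k - r := by linarith
  have hform : ∀ (t u : ℝ), t ^ ((k - r) - 1) * (u ^ (((k : ℝ) + 1) - 1) * Real.exp (-((δ + t) * u)))
      = (u ^ (((k : ℝ) + 1) - 1) * Real.exp (-(δ * u))) * (t ^ ((k - r) - 1) * Real.exp (-(u * t))) := by
    intro j t
    rw [show -((δ + j) * t) = -(δ * t) + -(t * j) by ring, Real.exp_add]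
    ring
  have hmul : ∀ u : ℝ, 0 < u → u ^ (((k : ℝ) + 1) - 1) * Real.exp (-(δ * u)) *
      ((1 / u) ^ (k - r) * Real.Gamma (k - r)) =
      Real.Gamma (k - r) * (u ^ ((r + 1) - 1) * Real.exp (-(δ * u))) := by
    intro u hu
    have : u ^ ((r + 1) - 1) = u ^ (((k : ℝ) + 1) - 1) * (1 / u) ^ ((k : ℝ) - r) := by
      rw [one_div, Real.inv_rpow hu.le, ← Real.rpow_neg hu.le, ← Real.rpow_add hu]
      congr 1; ring
    rw [this]; ring
  have hinner : ∀ t ∈ Set.Ioi (0 : ℝ), t ^ ((k - r) - 1) * ((k.factorial : ℝ) / (δ + t) ^ (k + 1))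
      = ∫ u in Set.Ioi (0 : ℝ), t ^ ((k - r) - 1) *
          (u ^ (((k : ℝ) + 1) - 1) * Real.exp (-((δ + t) * u))) := by
    intro t ht
    have ht' : (0 : ℝ) < t := ht
    rw [integral_const_mul, Real.integral_rpow_mul_exp_neg_mul_Ioi (by positivity) (by positivity),
      Real.Gamma_nat_eq_factorial]
    congr 1
    rw [one_div, Real.inv_rpow (by positivity)]
    norm_cast
    rw [div_eq_inv_mul]
  have hswapped : ∀ u ∈ Set.Ioi (0 : ℝ), ∫ t in Set.Ioi (0 : ℝ), t ^ ((k - r) - 1) *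
          (u ^ (((k : ℝ) + 1) - 1) * Real.exp (-((δ + t) * u)))
      = Real.Gamma (k - r) * (u ^ ((r + 1) - 1) * Real.exp (-(δ * u))) := by
    intro u hu
    have hu' : (0 : ℝ) < u := hu
    simp only [hform]
    rw [integral_const_mul, Real.integral_rpow_mul_exp_neg_mul_Ioi hp hu', hmul u hu']
  rw [setIntegral_congr_fun measurableSet_Ioi hinner, integral_integral_swap]
  · rw [setIntegral_congr_fun measurableSet_Ioi hswapped, integral_const_mul,
      Real.integral_rpow_mul_exp_neg_mul_Ioi (by positivity) hδ]
    rw [one_div, Real.inv_rpow hδ.le, ← Real.rpow_neg hδ.le, neg_add']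
    ring
  · rw [integrable_prod_iff']
    · constructor
      · refine (ae_restrict_iff' measurableSet_Ioi).2 (ae_of_all _ fun u hu => ?_)
        simp only [Function.uncurry, hform]
        exact (integrable_gamma _ _ hp hu).const_mul _
      · have h := (integrable_gamma (r + 1) δ (by positivity) hδ).const_mul (Real.Gamma (k - r))
        refine (integrableOn_congr_fun (fun u hu => ?_) measurableSet_Ioi).1 h
        rw [← hswapped u hu]
        refine setIntegral_congr_fun measurableSet_Ioi fun t ht => ?_
        have ht' : (0 : ℝ) < t := ht
        have hu' : (0 : ℝ) < u := hu
        exact (Real.norm_of_nonneg (by positivity)).symm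
    · apply Measurable.aestronglyMeasurable
      simp only [Function.uncurry_def]
      fun_prop


open MeasureTheory in
lemma S_asymp (r : ℝ) (hr : 0 < r) : ∃ B : ℝ, 0 < B ∧ ∀ δ : ℝ, 0 < δ →
    |∑' j : ℕ, (j : ℝ) ^ r * Real.exp (-(j * δ)) - Real.Gamma (r + 1) * δ ^ (-r - 1)| ≤ B := by
  obtain ⟨k, hk⟩ := exists_nat_gt r
  have hk1 : 1 ≤ k := by
    have : (0 : ℝ) < k := hr.trans hk
    exact_mod_cast this
  have hp : 0 < k - r := by linarith
  have hG : 0 < Real.Gamma (k - r) := Real.Gamma_pos_of_pos hp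
  obtain ⟨C₁, hC₁, h₁⟩ := F_bound k hk1
  obtain ⟨C₂, hC₂, h₂⟩ := F_decay k hk1
  let h : ℝ → ℝ := fun t => if t ≤ 1 then C₁ * t ^ ((k - r) - 1) else C₂ * t ^ (-r - 2)
  have hint : IntegrableOn h (Set.Ioi 0) := by
    rw [← Set.Ioc_union_Ioi_eq_Ioi (zero_le_one' ℝ)]
    refine IntegrableOn.union ?_ ?_
    · have : IntegrableOn (fun t : ℝ => C₁ * t ^ ((k - r) - 1)) (Set.Ioc 0 1) := by
        have := (intervalIntegral.intervalIntegrable_rpow' (a := 0) (b := 1)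
          (r := (k - r) - 1) (by linarith))
        rw [intervalIntegrable_iff_integrableOn_Ioc_of_le zero_le_one] at this
        exact this.const_mul _
      refine (integrableOn_congr_fun (fun t ht => ?_) measurableSet_Ioc).1 this
      simp [h, ht.2]
    · have : IntegrableOn (fun t : ℝ => C₂ * t ^ (-r - 2)) (Set.Ioi 1) :=
        (integrableOn_Ioi_rpow_of_lt (by linarith) one_pos).const_mul _
      refine (integrableOn_congr_fun (fun t ht => ?_) measurableSet_Ioi).1 this
      have : ¬ t ≤ 1 := not_le.2 ht
      simp [h, this]
  set I := ∫ t in Set.Ioi (0 : ℝ), h t with hI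
  refine ⟨|I| / Real.Gamma (k - r) + 1, by positivity, fun δ hδ => ?_⟩
  have e1 := frac_sum r δ k hr hk hδ
  have e2 := frac_int r δ k hr hk hδ
  have hSpos : 0 < ∑' j : ℕ, (j : ℝ) ^ r * Real.exp (-(j * δ)) :=
    (summable_rpow_exp r δ hr hδ).tsum_pos (fun j => by positivity) 1 (by simp; positivity)
  have i1 := Integrable.of_integral_ne_zero (by rw [e1]; positivity)
  have i2 := Integrable.of_integral_ne_zero (by
    rw [e2]
    have := Real.Gamma_pos_of_pos (show 0 < r + 1 by linarith)
    positivity)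
  have e3 := integral_sub i1 i2
  rw [e1, e2, ← mul_sub] at e3
  have hbd := norm_integral_le_of_norm_le (μ := volume.restrict (Set.Ioi 0)) (f := fun t : ℝ =>
      t ^ ((k - r) - 1) * ∑' j : ℕ, (j : ℝ) ^ k * Real.exp (-(j * (δ + t))) -
      t ^ ((k - r) - 1) * ((k.factorial : ℝ) / (δ + t) ^ (k + 1))) hint (by
    refine (ae_restrict_iff' measurableSet_Ioi).2 (ae_of_all _ fun t ht => ?_)
    have ht' : (0 : ℝ) < t := ht
    rw [← mul_sub, norm_mul, Real.norm_of_nonneg (by positivity), Real.norm_eq_abs]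
    by_cases h1 : t ≤ 1
    · simp only [h, h1, if_true]
      rw [mul_comm C₁]
      gcongr
      exact h₁ _ (by positivity)
    · simp only [h, h1, if_false]
      push Not at h1
      have e4 : t ^ (-r - 2) = t ^ ((k - r) - 1) * (1 / t ^ (k + 1)) := by
        rw [one_div, ← Real.rpow_natCast, ← Real.rpow_neg ht'.le, ← Real.rpow_add ht']
        congr 1; push_cast; ring
      rw [e4, mul_left_comm]
      gcongr
      refine (h₂ _ (by linarith)).trans ?_
      rw [mul_one_div]
      gcongr
      linarith)
  rw [e3, ← hI, norm_mul, Real.norm_of_nonneg hG.le, Real.norm_eq_abs] at hbd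
  have : |∑' j : ℕ, (j : ℝ) ^ r * Real.exp (-(j * δ)) - Real.Gamma (r + 1) * δ ^ (-r - 1)|
      ≤ |I| / Real.Gamma (k - r) := by
    rw [le_div_iff₀ hG]
    have := le_abs_self I
    linarith
  linarith

lemma M_comp (a : ℕ → ℕ) (K r y ν C : ℝ)
    (hK : 0 < K) (hr : 0 < r) (hy : 1 < y) (hν₁ : ν < 1) (hC : 0 < C)
    (ha : ∀ j : ℕ, 1 ≤ j →
      |(a j : ℝ) - K * (j : ℝ) ^ (r - 1) * y ^ j| ≤ C * y ^ (ν * j)) :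
    ∃ E : ℝ, 0 ≤ E ∧ ∀ (n : ℕ) (δ : ℝ), 0 < δ →
      |Mfun a n (Real.log y + δ) - K * ∑ j ∈ Finset.Icc 1 n, (j : ℝ) ^ r * Real.exp (-(j * δ))|
        ≤ E := by
  have hy0 : 0 < y := by linarith
  have hL : 0 < Real.log y := Real.log_pos hy
  set d : ℝ := 1 - y⁻¹ with hd
  have hd0 : 0 < d := by
    have := inv_lt_one_of_one_lt₀ hy
    linarith
  have hL' : 0 < (1 - ν) * Real.log y := mul_pos (by linarith) hL
  have s1 := (summable_rpow_exp 1 _ one_pos hL').mul_left (C / d)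
  have s2 := (summable_rpow_exp r _ hr hL).mul_left (K / d)
  have s := s1.add s2
  refine ⟨_, tsum_nonneg (L := SummationFilter.unconditional ℕ) (g := fun j : ℕ => C / d * ((j : ℝ) ^ (1 : ℝ) *
    Real.exp (-(j * ((1 - ν) * Real.log y)))) + K / d * ((j : ℝ) ^ r *
    Real.exp (-(j * Real.log y)))) (fun j => by positivity), fun n δ hδ => ?_⟩
  rw [Mfun, Finset.mul_sum, ← Finset.sum_sub_distrib]
  refine (Finset.abs_sum_le_sum_abs _ _).trans (le_trans (Finset.sum_le_sum fun j hj => ?_)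
    (s.sum_le_tsum (Finset.Icc 1 n) (fun j _ => by positivity)))
  have hj1 : 1 ≤ j := (Finset.mem_Icc.1 hj).1
  have hj0 : (0 : ℝ) < j := by exact_mod_cast hj1
  have hj1' : (1 : ℝ) ≤ j := by exact_mod_cast hj1
  set q := Real.exp (-(j * (Real.log y + δ))) with hq
  set e := Real.exp (-(j * δ)) with he
  set Q := Real.exp (-(j * Real.log y)) with hQ
  have hq0 : 0 < q := Real.exp_pos _
  have he0 : 0 < e := Real.exp_pos _
  have hQ0 : 0 < Q := Real.exp_pos _
  have hqe : q = Q * e := by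
    rw [hq, he, hQ, ← Real.exp_add]; congr 1; ring
  have he1 : e ≤ 1 := by
    rw [he, Real.exp_le_one_iff]
    have := mul_pos hj0 hδ
    linarith
  have hqQ : q ≤ Q := by rw [hqe]; exact mul_le_of_le_one_right hQ0.le he1
  have hQy : Q ≤ y⁻¹ := by
    rw [← Real.exp_log (inv_pos.2 hy0), Real.log_inv, hQ, Real.exp_le_exp]
    nlinarith
  have hdq : d ≤ 1 - q := by rw [hd]; linarith
  have hq1 : 0 < 1 - q := by linarith
  have hQpow : y ^ j * Q = 1 := by
    rw [hQ, ← Real.exp_log (pow_pos hy0 j), Real.log_pow, ← Real.exp_add]; simp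
  have hQν : y ^ (ν * j) * Q = Real.exp (-(j * ((1 - ν) * Real.log y))) := by
    rw [Real.rpow_def_of_pos hy0, hQ, ← Real.exp_add]; congr 1; ring
  have hjr : (j : ℝ) * (j : ℝ) ^ (r - 1) = (j : ℝ) ^ r := by
    rw [← Real.rpow_one_add' hj0.le (by linarith)]; congr 1; ring
  have hdec : (j : ℝ) * (a j) * q / (1 - q) - K * ((j : ℝ) ^ r * e)
      = j * ((a j : ℝ) - K * (j : ℝ) ^ (r - 1) * y ^ j) * q / (1 - q)
        + K * (j : ℝ) ^ r * e * q / (1 - q) := by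
    have h1 : K * ((j : ℝ) ^ r * e) * (1 - q) = j * (K * (j : ℝ) ^ (r - 1) * y ^ j) * q
        - K * (j : ℝ) ^ r * e * q := by
      have : y ^ j * q = e := by rw [hqe, ← mul_assoc, hQpow, one_mul]
      rw [← hjr]
      linear_combination -(K * j * (j : ℝ) ^ (r - 1)) * this
    field_simp
    linear_combination -h1
  rw [hdec]
  refine (abs_add_le _ _).trans (add_le_add ?_ ?_)
  · rw [abs_div, abs_mul, abs_mul, abs_of_pos hj0, abs_of_pos hq0, abs_of_pos hq1, Real.rpow_one]
    calc _ ≤ j * (C * y ^ (ν * j)) * Q / d := by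
          gcongr
          exact ha j hj1
      _ = _ := by rw [← hQν]; ring
  · rw [abs_of_nonneg (by positivity)]
    calc _ ≤ K * (j : ℝ) ^ r * 1 * Q / d := by gcongr
      _ = _ := by ring

lemma M_anti (a : ℕ → ℕ) (n : ℕ) (s t : ℝ) (hs : 0 < s) (hst : s ≤ t) :
    Mfun a n t ≤ Mfun a n s := by
  refine Finset.sum_le_sum fun j hj => ?_
  have hj0 : (0 : ℝ) < j := by exact_mod_cast (Finset.mem_Icc.1 hj).1
  have h1 : Real.exp (-(j * t)) ≤ Real.exp (-(j * s)) := by gcongr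
  have h2 : Real.exp (-(j * s)) < 1 := by
    rw [Real.exp_lt_one_iff]; have := mul_pos hj0 hs; linarith
  have : 0 < 1 - Real.exp (-(j * s)) := by linarith
  gcongr

lemma summable_stretched (r u : ℝ) (hr : 0 < r) (hu : 0 < u) :
    Summable (fun j : ℕ => (j : ℝ) ^ r * Real.exp (-((j : ℝ) ^ u))) := by
  obtain ⟨m, hm⟩ := exists_nat_gt ((r + 2) / u)
  have hm' : r + 2 < m * u := by rwa [div_lt_iff₀ hu] at hm
  have hs : Summable (fun j : ℕ => (m.factorial : ℝ) * (1 / (j : ℝ) ^ 2)) :=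
    (Real.summable_one_div_nat_pow.2 (by norm_num)).mul_left _
  refine Summable.of_nonneg_of_le (fun j => by positivity) (fun j => ?_) hs
  rcases Nat.eq_zero_or_pos j with rfl | hj
  · simp [Real.zero_rpow hr.ne']
  have hj0 : (0 : ℝ) < j := by exact_mod_cast hj
  have hj1 : (1 : ℝ) ≤ j := by exact_mod_cast hj
  have h := Real.pow_div_factorial_le_exp ((j : ℝ) ^ u) (by positivity) m
  rw [Real.exp_neg]
  have h2 : (Real.exp ((j : ℝ) ^ u))⁻¹ ≤ (((j : ℝ) ^ u) ^ m / m.factorial)⁻¹ := by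
    gcongr
  refine (mul_le_mul_of_nonneg_left h2 (by positivity)).trans ?_
  have h3 : (j : ℝ) ^ r * (j : ℝ) ^ 2 ≤ ((j : ℝ) ^ u) ^ m := by
    rw [← Real.rpow_natCast, ← Real.rpow_natCast, ← Real.rpow_mul hj0.le, ← Real.rpow_add hj0]
    refine Real.rpow_le_rpow_of_exponent_le hj1 ?_
    push_cast
    linarith
  rw [inv_div, mul_div_assoc', mul_one_div, div_le_div_iff₀ (by positivity) (by positivity)]
  calc _ = (m.factorial : ℝ) * ((j : ℝ) ^ r * (j : ℝ) ^ 2) := by ring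
    _ ≤ _ := by gcongr

lemma M_asymp (a : ℕ → ℕ) (K r y ν C s : ℝ)
    (hK : 0 < K) (hr : 0 < r) (hy : 1 < y) (hν₁ : ν < 1) (hC : 0 < C)
    (ha : ∀ j : ℕ, 1 ≤ j →
      |(a j : ℝ) - K * (j : ℝ) ^ (r - 1) * y ^ j| ≤ C * y ^ (ν * j))
    (hs0 : 0 < s) (hs : s < 1) :
    ∃ E : ℝ, 0 ≤ E ∧ ∀ (n : ℕ) (δ : ℝ), 1 ≤ n → (n : ℝ) ^ (-s) ≤ δ →
      |Mfun a n (Real.log y + δ) - K * Real.Gamma (r + 1) * δ ^ (-r - 1)| ≤ E := by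
  obtain ⟨E, hE, h1⟩ := M_comp a K r y ν C hK hr hy hν₁ hC ha
  obtain ⟨B, hB, h2⟩ := S_asymp r hr
  have hT := summable_stretched r (1 - s) hr (by linarith)
  set T := ∑' j : ℕ, (j : ℝ) ^ r * Real.exp (-((j : ℝ) ^ (1 - s)))
  have hT0 : 0 ≤ T := tsum_nonneg fun j => by positivity
  refine ⟨E + K * (T + B), by positivity, fun n δ hn hδ => ?_⟩
  have hn0 : (0 : ℝ) < n := by exact_mod_cast hn
  have hδ0 : 0 < δ := lt_of_lt_of_le (by positivity) hδ
  have hS := summable_rpow_exp r δ hr hδ0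
  have htail : |∑ j ∈ Finset.Icc 1 n, (j : ℝ) ^ r * Real.exp (-(j * δ))
      - ∑' j : ℕ, (j : ℝ) ^ r * Real.exp (-(j * δ))| ≤ T := by
    have e0 : ∑ j ∈ Finset.Icc 1 n, (j : ℝ) ^ r * Real.exp (-(j * δ))
        = ∑ j ∈ Finset.range (n + 1), (j : ℝ) ^ r * Real.exp (-(j * δ)) := by
      refine Finset.sum_subset (fun j hj => ?_) (fun j hj hj' => ?_)
      · simp at hj ⊢; omega
      · have : j = 0 := by simp at hj hj'; omega
        subst this
        simp [Real.zero_rpow hr.ne']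
    rw [e0, ← hS.sum_add_tsum_nat_add (n + 1), abs_sub_comm, add_sub_cancel_left,
      abs_of_nonneg (tsum_nonneg fun j => by positivity)]
    have hS' := (summable_nat_add_iff (n + 1)).2 hS
    have hT' := (summable_nat_add_iff (n + 1)).2 hT
    have hle : ∑' j : ℕ, ((j + (n + 1) : ℕ) : ℝ) ^ r * Real.exp (-(((j + (n + 1) : ℕ) : ℝ) * δ))
        ≤ ∑' j : ℕ, ((j + (n + 1) : ℕ) : ℝ) ^ r *
            Real.exp (-(((j + (n + 1) : ℕ) : ℝ) ^ (1 - s))) := by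
      refine Summable.tsum_le_tsum (fun j => ?_) hS' hT'
      have hm : (n : ℝ) ≤ ((j + (n + 1) : ℕ) : ℝ) :=
        Nat.cast_le.2 (by omega)
      generalize ((j + (n + 1) : ℕ) : ℝ) = m at hm
      have hm0 : 0 < m := by linarith
      gcongr
      rw [sub_eq_add_neg, Real.rpow_add hm0, Real.rpow_one]
      gcongr
      refine le_trans ?_ hδ
      exact Real.rpow_le_rpow_of_nonpos hn0 hm (by linarith)
    refine hle.trans ?_
    have := hT.sum_add_tsum_nat_add (n + 1)
    have h0 : 0 ≤ ∑ j ∈ Finset.range (n + 1), (j : ℝ) ^ r * Real.exp (-((j : ℝ) ^ (1 - s))) :=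
      Finset.sum_nonneg fun j _ => by positivity
    linarith
  have h3 := h1 n δ hδ0
  have h4 := h2 δ hδ0
  set P := ∑ j ∈ Finset.Icc 1 n, (j : ℝ) ^ r * Real.exp (-(j * δ))
  set S := ∑' j : ℕ, (j : ℝ) ^ r * Real.exp (-(j * δ))
  have e : Mfun a n (Real.log y + δ) - K * Real.Gamma (r + 1) * δ ^ (-r - 1)
      = (Mfun a n (Real.log y + δ) - K * P) + K * ((P - S) + (S - Real.Gamma (r + 1) * δ ^ (-r - 1))) := by
    ring
  rw [e]
  refine (abs_add_le _ _).trans (add_le_add h3 ?_)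
  rw [abs_mul, abs_of_pos hK]
  gcongr
  exact (abs_add_le _ _).trans (add_le_add htail h4)

/-- if `a_j = K j^{r-1} y^j + O(y^{νj})` with `K > 0`, `r > 0`, `y > 1`,
`ν ∈ (0,1)`, then `n = K Γ(r+1) δ_n^{-r-1} + O(1)`, and consequently
`δ_n = (n/(K Γ(r+1)))^{-1/(r+1)} + o(n^{-1})`, where `δ_n = σ_n - log y`. -/
theorem delta_precise_asymptotics (a : ℕ → ℕ) (K r y ν : ℝ)
    (hK : 0 < K) (hr : 0 < r) (hy : 1 < y) (hν₀ : 0 < ν) (hν₁ : ν < 1)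
    (ha : ∃ C : ℝ, 0 < C ∧ ∀ j : ℕ, 1 ≤ j →
      |(a j : ℝ) - K * (j : ℝ) ^ (r - 1) * y ^ j| ≤ C * y ^ (ν * j))
    (σ : ℕ → ℝ) (N₀ : ℕ) (hσ : ∀ n ≥ N₀, 0 < σ n ∧ Mfun a n (σ n) = n) :
    (∃ C' : ℝ, ∃ N : ℕ, ∀ n ≥ N,
      |(n : ℝ) - K * Real.Gamma (r + 1) * (σ n - Real.log y) ^ (-r - 1)| ≤ C') ∧
    Tendsto (fun n : ℕ =>
      ((σ n - Real.log y) - ((n : ℝ) / (K * Real.Gamma (r + 1))) ^ (-(1 / (r + 1)))) * n)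
      atTop (nhds 0) := by
  obtain ⟨C, hC, ha⟩ := ha
  set A : ℝ := K * Real.Gamma (r + 1) with hA
  have hA0 : 0 < A := mul_pos hK (Real.Gamma_pos_of_pos (by linarith))
  set s : ℝ := (r + 2) / (2 * (r + 1)) with hs
  have hs0 : 0 < s := by positivity
  have hs1 : s < 1 := by
    rw [hs, div_lt_one (by positivity)]; linarith
  obtain ⟨E, hE, hM⟩ := M_asymp a K r y ν C s hK hr hy hν₁ hC ha hs0 hs1
  have t1 : Tendsto (fun n : ℕ => (n : ℝ) ^ (r / 2)) atTop atTop :=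
    (tendsto_rpow_atTop (by positivity)).comp tendsto_natCast_atTop_atTop
  have hev : ∀ᶠ n : ℕ in atTop, 1 ≤ n ∧ (n : ℝ) ^ (-s) ≤ σ n - Real.log y ∧
      |(n : ℝ) - A * (σ n - Real.log y) ^ (-r - 1)| ≤ E := by
    filter_upwards [eventually_ge_atTop 1, eventually_ge_atTop N₀,
      t1.eventually_ge_atTop (2 / A), tendsto_natCast_atTop_atTop.eventually_gt_atTop E]
      with n hn hn0 h1 h2
    have hn' : (0 : ℝ) < n := by exact_mod_cast hn
    obtain ⟨hσ0, hσn⟩ := hσ n hn0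
    have hlow : (n : ℝ) ^ (-s) ≤ σ n - Real.log y := by
      by_contra! hcon
      have h3 := M_anti a n (σ n) (Real.log y + (n : ℝ) ^ (-s)) hσ0 (by linarith)
      have h4 := (abs_le.1 (hM n _ hn le_rfl)).1
      have h5 : ((n : ℝ) ^ (-s)) ^ (-r - 1) = n * (n : ℝ) ^ (r / 2) := by
        rw [← Real.rpow_mul hn'.le, ← Real.rpow_one_add' hn'.le (by positivity)]
        congr 1
        rw [hs]; field_simp; ring
      rw [h5] at h4
      have h6 : 2 ≤ A * (n : ℝ) ^ (r / 2) := by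
        rw [div_le_iff₀ hA0] at h1; linarith
      have h7 := mul_le_mul_of_nonneg_left h6 hn'.le
      nlinarith
    refine ⟨hn, hlow, ?_⟩
    have := hM n _ hn hlow
    rwa [add_sub_cancel, hσn] at this
  refine ⟨?_, ?_⟩
  · obtain ⟨N, hN⟩ := eventually_atTop.1 hev
    exact ⟨E, N, fun n hn => (hN n hn).2.2⟩
  set p : ℝ := 1 / (r + 1) with hp
  have hp0 : 0 < p := by positivity
  let x : ℕ → ℝ := fun n => A * (σ n - Real.log y) ^ (-r - 1) / n
  have hx : ∀ᶠ n : ℕ in atTop, |x n - 1| ≤ E / n := by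
    filter_upwards [hev] with n ⟨hn, _, h⟩
    have hn' : (0 : ℝ) < n := by exact_mod_cast hn
    have : x n - 1 = (A * (σ n - Real.log y) ^ (-r - 1) - n) / n := by
      simp only [x]; field_simp
    rw [this, abs_div, abs_of_pos hn', abs_sub_comm]
    gcongr
  have hx1 : Tendsto x atTop (nhds 1) := by
    rw [tendsto_iff_norm_sub_tendsto_zero]
    refine squeeze_zero' (Eventually.of_forall fun n => norm_nonneg _) hx ?_
    exact tendsto_const_div_atTop_nhds_zero_nat E
  have hder : HasDerivAt (fun u : ℝ => u ^ (-p)) (-p * 1 ^ (-p - 1)) 1 :=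
    Real.hasDerivAt_rpow_const (Or.inl one_ne_zero)
  obtain ⟨c, hc0, hc⟩ := hder.isBigO_sub.exists_pos
  have hc' := hx1.eventually hc.bound
  have t2 : Tendsto (fun n : ℕ => ((n : ℝ) / A) ^ (-p)) atTop (nhds 0) :=
    (tendsto_rpow_neg_atTop hp0).comp (tendsto_natCast_atTop_atTop.atTop_div_const hA0)
  have t3 : Tendsto (fun n : ℕ => ((n : ℝ) / A) ^ (-p) * (c * E)) atTop (nhds 0) := by
    simpa using t2.mul_const (c * E)
  refine squeeze_zero_norm' ?_ t3
  filter_upwards [hev, hx, hc'] with n ⟨hn, hlow, _⟩ hxn hcn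
  have hn' : (0 : ℝ) < n := by exact_mod_cast hn
  have hδ : 0 < σ n - Real.log y := lt_of_lt_of_le (by positivity) hlow
  have hx0 : 0 < x n := by simp only [x]; positivity
  have e1 : σ n - Real.log y = ((n : ℝ) / A) ^ (-p) * (x n) ^ (-p) := by
    rw [← Real.mul_rpow (by positivity) hx0.le]
    have : (n : ℝ) / A * x n = (σ n - Real.log y) ^ (-r - 1) := by
      simp only [x]; field_simp
    rw [this, ← Real.rpow_mul hδ.le]
    have : (-r - 1) * -p = 1 := by rw [hp]; field_simp; ring
    rw [this, Real.rpow_one]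
  have e2 : ((σ n - Real.log y) - ((n : ℝ) / A) ^ (-p)) * n
      = ((n : ℝ) / A) ^ (-p) * (((x n) ^ (-p) - 1) * n) := by
    rw [e1]; ring
  rw [e2, norm_mul, norm_mul, Real.norm_of_nonneg (by positivity), Real.norm_of_nonneg hn'.le]
  refine mul_le_mul_of_nonneg_left ?_ (by positivity)
  rw [Real.one_rpow, Real.norm_eq_abs (x n - 1)] at hcn
  calc ‖(x n) ^ (-p) - 1‖ * n ≤ c * (E / n) * n := by
        gcongr
        exact hcn.trans (by gcongr)
    _ = c * E := by field_simp
end
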